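/- Let 1 < p₁, p₂, p₃ < ∞ satisfy 1/p₁ + 1/p₂ + 1/p₃ = 1, and let p₃′ = p₃/(p₃ − 1). Then there exists a constant C = C(p₁,p₂,p₃) < ∞ such that for every finite set F ⊆ ℕ and all Schwartz functions f, g on ℝ, ‖ Σ_{k∈F} Q_{2k}(f) · P_k(g) ‖_{L^{p₃′}(ℝ)} ≤ C ‖f‖_{L^{p₁}(ℝ)} ‖g‖_{L^{p₂}(ℝ)}. -/

import Mathlib

open MeasureTheory Real FourierTransform

/-- `Q_k f`: the inverse Fourier transform of `f̂ · 1_{2^{-k-1} ≤ |ξ| ≤ 2^{-k}}`. -/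
noncomputable def Qop (k : ℤ) (f : ℝ → ℂ) : ℝ → ℂ :=
  𝓕⁻ (fun ξ : ℝ => Set.indicator {ξ : ℝ | (2 : ℝ) ^ (-k - 1) ≤ |ξ| ∧ |ξ| ≤ (2 : ℝ) ^ (-k)}
    (fun _ => (1 : ℂ)) ξ * 𝓕 f ξ)

/-- `P_k f`: the inverse Fourier transform of `f̂ · 1_{[-2^{-k}, 2^{-k}]}`. -/
noncomputable def Pop (k : ℤ) (f : ℝ → ℂ) : ℝ → ℂ :=
  𝓕⁻ (fun ξ : ℝ => Set.indicator (Set.Icc (-(2 : ℝ) ^ (-k)) ((2 : ℝ) ^ (-k)))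
    (fun _ => (1 : ℂ)) ξ * 𝓕 f ξ)

/-! ### A Bellman function -/

/-- The Bellman function `a^{p/2} + K b^{q/2} + ε b^{q/2} a / (a + b^{q-1})`. -/
noncomputable def bellman (p q K ε a b : ℝ) : ℝ :=
  a ^ (p / 2) + K * b ^ (q / 2) + ε * (b ^ (q / 2) * (a / (a + b ^ (q - 1))))

/-- First derivative of `bellman` along a path, expressed through the values
`r = a^{p/2}`, `w = b^{q/2}`, `θ = a / (a + b^{q-1})` and the logarithmic derivatives `α, ω`. -/
noncomputable def bellmanD (p q K ε r w θ α ω : ℝ) : ℝ :=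
  (p / 2) * r * α + K * ((q / 2) * w * ω)
    + ε * (w * ((q / 2) * ω * θ + θ * (1 - θ) * (α - (q - 1) * ω)))

/-- Second derivative of `bellman` along a path; `α', ω'` are the derivatives of the logarithmic
derivatives `α, ω`. -/
noncomputable def bellmanDD (p q K ε r w θ α ω α' ω' : ℝ) : ℝ :=
  (p / 2) * r * ((p / 2) * α ^ 2 + α') + K * ((q / 2) * w * ((q / 2) * ω ^ 2 + ω'))
    + ε * (w * ((q / 2) * ω * ((q / 2) * ω * θ + θ * (1 - θ) * (α - (q - 1) * ω))
      + (q / 2) * (ω' * θ + ω * (θ * (1 - θ) * (α - (q - 1) * ω)))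
      + (1 - 2 * θ) * (θ * (1 - θ)) * (α - (q - 1) * ω) ^ 2
      + θ * (1 - θ) * (α' - (q - 1) * ω')))

theorem hasDerivAt_rpow_logDeriv {a : ℝ → ℝ} {a1 s : ℝ} (c : ℝ) (ha : 0 < a s)
    (h : HasDerivAt a a1 s) :
    HasDerivAt (fun t => a t ^ c) (c * a s ^ c * (a1 / a s)) s := by
  have := h.rpow_const (p := c) (Or.inl ha.ne')
  convert this using 1
  rw [Real.rpow_sub_one ha.ne']
  field_simp

theorem hasDerivAt_bellman_theta {a b : ℝ → ℝ} {a1 b1 s : ℝ} (q : ℝ) (ha : 0 < a s) (hb : 0 < b s)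
    (h : HasDerivAt a a1 s) (h' : HasDerivAt b b1 s) :
    HasDerivAt (fun t => a t / (a t + b t ^ (q - 1)))
      ((a s / (a s + b s ^ (q - 1))) * (1 - a s / (a s + b s ^ (q - 1)))
        * (a1 / a s - (q - 1) * (b1 / b s))) s := by
  have hc : 0 < b s ^ (q - 1) := Real.rpow_pos_of_pos hb _
  have h1 := hasDerivAt_rpow_logDeriv (q - 1) hb h'
  have := h.div (h.add h1) (by simp only [Pi.add_apply]; positivity)
  refine this.congr_deriv ?_
  simp only [Pi.add_apply]
  have : a s + b s ^ (q - 1) ≠ 0 := by positivity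
  field_simp
  ring

theorem hasDerivAt_bellman {a b : ℝ → ℝ} {a1 b1 s : ℝ} (p q K ε : ℝ) (ha : 0 < a s) (hb : 0 < b s)
    (h : HasDerivAt a a1 s) (h' : HasDerivAt b b1 s) :
    HasDerivAt (fun t => bellman p q K ε (a t) (b t))
      (bellmanD p q K ε (a s ^ (p / 2)) (b s ^ (q / 2)) (a s / (a s + b s ^ (q - 1)))
        (a1 / a s) (b1 / b s)) s := by
  have h1 := hasDerivAt_rpow_logDeriv (p / 2) ha h
  have h2 := hasDerivAt_rpow_logDeriv (q / 2) hb h'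
  have h3 := hasDerivAt_bellman_theta q ha hb h h'
  have := (h1.add (h2.const_mul K)).add ((h2.mul h3).const_mul ε)
  refine this.congr_deriv ?_
  simp only [bellmanD]
  ring

theorem hasDerivAt_bellmanD {a b a1 b1 : ℝ → ℝ} {a2 b2 s : ℝ} (p q K ε : ℝ)
    (ha : 0 < a s) (hb : 0 < b s)
    (h : HasDerivAt a (a1 s) s) (h' : HasDerivAt b (b1 s) s)
    (h1 : HasDerivAt a1 a2 s) (h1' : HasDerivAt b1 b2 s) :
    HasDerivAt (fun t => bellmanD p q K ε (a t ^ (p / 2)) (b t ^ (q / 2))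
        (a t / (a t + b t ^ (q - 1))) (a1 t / a t) (b1 t / b t))
      (bellmanDD p q K ε (a s ^ (p / 2)) (b s ^ (q / 2)) (a s / (a s + b s ^ (q - 1)))
        (a1 s / a s) (b1 s / b s) (a2 / a s - (a1 s / a s) ^ 2) (b2 / b s - (b1 s / b s) ^ 2)) s := by
  have hr := hasDerivAt_rpow_logDeriv (p / 2) ha h
  have hw := hasDerivAt_rpow_logDeriv (q / 2) hb h'
  have hθ := hasDerivAt_bellman_theta q ha hb h h'
  have hα : HasDerivAt (fun t => a1 t / a t) (a2 / a s - (a1 s / a s) ^ 2) s :=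
    (h1.div h ha.ne').congr_deriv (by field_simp)
  have hω : HasDerivAt (fun t => b1 t / b t) (b2 / b s - (b1 s / b s) ^ 2) s :=
    (h1'.div h' hb.ne').congr_deriv (by field_simp)
  have hρ := hα.sub (hω.const_mul (q - 1))
  have := (((hr.const_mul (p / 2)).mul hα).add (((hw.const_mul (q / 2)).mul hω).const_mul K)).add
    ((hw.mul (((hω.const_mul (q / 2)).mul hθ).add
      ((hθ.mul (hθ.const_sub 1)).mul hρ))).const_mul ε)
  refine this.congr_deriv ?_
  simp only [bellmanDD, Pi.mul_apply, Pi.sub_apply, Pi.add_apply]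
  ring

theorem bellmanDD_add (p q K ε r w θ α ω α' ω' e e' : ℝ) :
    bellmanDD p q K ε r w θ α ω (α' + e) (ω' + e') =
      bellmanDD p q K ε r w θ α ω α' ω' + bellmanD p q K ε r w θ e e' := by
  simp only [bellmanDD, bellmanD]; ring

theorem bellmanD_add_eq_zero (p q K ε r w θ α ω : ℝ) :
    bellmanD p q K ε r w θ α ω + bellmanD p q K ε r w θ (-α) (-ω) = 0 := by
  simp only [bellmanD]; ring

private theorem bellman_cross_lower {q θ ϑ α ω X Y : ℝ} (hq : 1 < q) (hq2 : q ≤ 2)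
    (hθ0 : 0 < θ) (hθ1 : θ < 1) (hϑ0 : 0 < ϑ)
    (hα : α ^ 2 ≤ 4 * X ^ 2) (hω : ω ^ 2 ≤ 4 * Y ^ 2) :
    -(ϑ ^ 2 / 4 * X ^ 2 + 256 * Y ^ 2) ≤
      ϑ * (q - 2 * (q - 1) * (1 - 2 * θ)) * (α * ω) := by
  have e1 : |q - 2 * (q - 1) * (1 - 2 * θ)| ≤ 4 := by
    rw [abs_le]
    have h1 : (q - 1) * (1 - θ) ≤ 1 * 1 := by gcongr <;> linarith
    have h2 : 0 ≤ (q - 1) * (1 - θ) := mul_nonneg (by linarith) (by linarith)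
    have h3 : (q - 1) * θ ≤ 1 * 1 := by gcongr; linarith
    have h4 : 0 ≤ (q - 1) * θ := mul_nonneg (by linarith) (by linarith)
    constructor <;> linarith
  have h1 : |α| ≤ 2 * |X| := by
    rw [← abs_two, ← abs_mul]; exact sq_le_sq.1 (by linarith)
  have h2 : |ω| ≤ 2 * |Y| := by
    rw [← abs_two, ← abs_mul]; exact sq_le_sq.1 (by linarith)
  have hXY : |α * ω| ≤ 4 * (|X| * |Y|) := by
    rw [abs_mul]
    calc |α| * |ω| ≤ (2 * |X|) * (2 * |Y|) := by gcongr
      _ = _ := by ring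
  have e2 : |ϑ * (q - 2 * (q - 1) * (1 - 2 * θ)) * (α * ω)| ≤ ϑ * 4 * (4 * (|X| * |Y|)) := by
    rw [abs_mul, abs_mul, abs_of_pos hϑ0]
    gcongr
  have e3 := (abs_le.1 e2).1
  have e5 := sq_nonneg (ϑ * |X| / 2 - 16 * |Y|)
  have e6 : (ϑ * |X| / 2 - 16 * |Y|) ^ 2 =
      ϑ ^ 2 / 4 * X ^ 2 + 256 * Y ^ 2 - ϑ * 4 * (4 * (|X| * |Y|)) := by
    rw [← sq_abs X, ← sq_abs Y]; ring
  linarith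

private theorem bellman_omega_coeff {q θ ϑ : ℝ} (hq : 1 < q) (hq2 : q ≤ 2)
    (hθ0 : 0 < θ) (hθ1 : θ < 1) (hϑ0 : 0 < ϑ) (hϑ4 : ϑ ≤ 1 / 4) :
    -3 ≤ θ * ((q / 2) ^ 2 - q / 2)
      + ϑ * ((q - 1) ^ 2 * (1 - 2 * θ) + (q - 1) - q * (q - 1)) := by
  have f1 : -1 ≤ (q / 2) ^ 2 - q / 2 := by nlinarith
  have g1 : (q - 1) ^ 2 ≤ 1 := by nlinarith
  have g3 := sq_nonneg (q - 1)
  have g2 : -1 ≤ (q - 1) ^ 2 * (1 - 2 * θ) := by nlinarith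
  have f2 : -4 ≤ (q - 1) ^ 2 * (1 - 2 * θ) + (q - 1) - q * (q - 1) := by nlinarith
  have h1 : θ * -1 ≤ θ * ((q / 2) ^ 2 - q / 2) := mul_le_mul_of_nonneg_left f1 hθ0.le
  have h2 := mul_le_mul_of_nonneg_left f2 hϑ0.le
  linarith

private theorem bellman_alpha_coeff {p ε c r w σ θ : ℝ} (hp : 2 ≤ p)
    (hc0 : 0 < c) (hε : ε = c / 8) (hw : 0 < w) (hσ : 0 < σ)
    (hr : 0 ≤ r) (hθ : θ = σ / (1 + σ)) (hrσ : 1 / 7 ≤ σ → c * (w * σ) ≤ r) :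
    (ε / 2) * (w * σ) ≤ p * r + ε * w * (2 * (θ * (1 - θ)) * (1 - 4 * θ) - σ / 4) := by
  have hε0 : 0 < ε := by rw [hε]; positivity
  have hθ0 : 0 < θ := by rw [hθ]; positivity
  have hθ1 : θ < 1 := by rw [hθ, div_lt_one (by positivity)]; linarith
  have hθσ : θ ≤ σ := by rw [hθ]; exact div_le_self hσ.le (by linarith)
  rcases le_total σ (1 / 7) with hs | hs
  · have e1 : θ ≤ 1 / 8 := by
      rw [hθ, div_le_iff₀ (by positivity)]; linarith
    have e2 : 7 / 8 * σ ≤ θ := by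
      rw [hθ, le_div_iff₀ (by positivity)]; nlinarith
    have e3 : 3 / 4 * σ ≤ θ * (1 - θ) := by nlinarith
    have e4 : σ / 2 ≤ 2 * (θ * (1 - θ)) * (1 - 4 * θ) - σ / 4 := by nlinarith
    have := mul_le_mul_of_nonneg_left e4 (mul_pos hε0 hw).le
    have : 0 ≤ p * r := by positivity
    nlinarith
  · have e1 := hrσ hs
    have h1 : θ * (1 - θ) ≤ σ := by nlinarith
    have h0 : 0 ≤ θ * (1 - θ) := mul_nonneg hθ0.le (by linarith)
    have e2 : -(6 * σ) - σ / 4 ≤ 2 * (θ * (1 - θ)) * (1 - 4 * θ) - σ / 4 := by nlinarith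
    have e3 := mul_le_mul_of_nonneg_left e2 (mul_pos hε0 hw).le
    have e4 : 2 * (c * (w * σ)) ≤ p * r := by
      have : 2 * r ≤ p * r := mul_le_mul_of_nonneg_right hp hr
      linarith
    have e5 : c = 8 * ε := by linarith
    rw [e5] at e4
    have := mul_pos hε0 (mul_pos hw hσ)
    linarith

theorem bellmanDD_lower {p q K ε c r w σ θ α ω X Y : ℝ} (hp : 2 ≤ p) (hq : 1 < q) (hq2 : q ≤ 2)
    (hK : 270 ≤ K * (q - 1)) (hc0 : 0 < c) (hc : c ≤ 1) (hε : ε = c / 8) (hw : 0 < w) (hσ : 0 < σ)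
    (hr : 0 ≤ r) (hθ : θ = σ / (1 + σ)) (hrσ : 1 / 7 ≤ σ → c * (w * σ) ≤ r)
    (hα : α ^ 2 ≤ 4 * X ^ 2) (hω : ω ^ 2 ≤ 4 * Y ^ 2) :
    (ε / 2) * (w * σ) * X ^ 2 + w * Y ^ 2 ≤
      bellmanDD p q K ε r w θ α ω (2 * X ^ 2 - α ^ 2) (2 * Y ^ 2 - ω ^ 2) := by
  have hε0 : 0 < ε := by rw [hε]; positivity
  have hε1 : ε ≤ 1 / 8 := by rw [hε]; linarith
  have hθ0 : 0 < θ := by rw [hθ]; positivity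
  have hθ1 : θ < 1 := by rw [hθ, div_lt_one (by positivity)]; linarith
  have hθσ : θ ≤ σ := by rw [hθ]; exact div_le_self hσ.le (by linarith)
  have h8 := bellman_alpha_coeff hp hc0 hε hw hσ hr hθ hrσ
  clear hθ hε hrσ
  obtain ⟨ϑ, hϑ⟩ : ∃ x, x = θ * (1 - θ) := ⟨_, rfl⟩
  rw [← hϑ] at h8
  have hϑ0 : 0 < ϑ := by rw [hϑ]; exact mul_pos hθ0 (by linarith)
  have hϑθ : ϑ ≤ θ := by rw [hϑ]; nlinarith
  have hϑ4 : ϑ ≤ 1 / 4 := by rw [hϑ]; nlinarith [sq_nonneg (θ - 1 / 2)]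
  have hϑσ : ϑ ^ 2 ≤ σ := by nlinarith
  have key : bellmanDD p q K ε r w θ α ω (2 * X ^ 2 - α ^ 2) (2 * Y ^ 2 - ω ^ 2) =
      (p / 2) * r * ((p / 2 - 1) * α ^ 2 + 2 * X ^ 2)
      + K * (q / 2) * w * ((q / 2 - 1) * ω ^ 2 + 2 * Y ^ 2)
      + ε * w * (-2 * θ * ϑ * α ^ 2 + 2 * ϑ * X ^ 2
        + ϑ * (q - 2 * (q - 1) * (1 - 2 * θ)) * (α * ω)
        + (θ * ((q / 2) ^ 2 - q / 2) + ϑ * ((q - 1) ^ 2 * (1 - 2 * θ) + (q - 1) - q * (q - 1)))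
          * ω ^ 2
        + (q * θ - 2 * (q - 1) * ϑ) * Y ^ 2) := by
    simp only [bellmanDD, hϑ]; ring
  rw [key]
  clear key hϑ
  have h1 : p * r * X ^ 2 ≤ (p / 2) * r * ((p / 2 - 1) * α ^ 2 + 2 * X ^ 2) := by
    have h0 : 0 ≤ p / 2 - 1 := by linarith
    have : 0 ≤ (p / 2) * r * ((p / 2 - 1) * α ^ 2) := by positivity
    linarith
  have hK0 : 0 < K := by
    by_contra hcon
    push Not at hcon
    nlinarith
  have h2 : 270 * w * Y ^ 2 ≤ K * (q / 2) * w * ((q / 2 - 1) * ω ^ 2 + 2 * Y ^ 2) := by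
    have e1 : (2 * q - 2) * Y ^ 2 ≤ (q / 2 - 1) * ω ^ 2 + 2 * Y ^ 2 := by nlinarith
    have e2 : K * (q / 2) * w * ((2 * q - 2) * Y ^ 2) ≤
        K * (q / 2) * w * ((q / 2 - 1) * ω ^ 2 + 2 * Y ^ 2) :=
      mul_le_mul_of_nonneg_left e1 (by positivity)
    have e3 : 270 ≤ K * (q - 1) * q := by nlinarith
    have e4 : 270 * (w * Y ^ 2) ≤ K * (q - 1) * q * (w * Y ^ 2) :=
      mul_le_mul_of_nonneg_right e3 (by positivity)
    linarith
  have h3 : -8 * θ * ϑ * X ^ 2 ≤ -2 * θ * ϑ * α ^ 2 := by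
    have := mul_le_mul_of_nonneg_left hα (mul_pos hθ0 hϑ0).le
    linarith
  have h4 := bellman_cross_lower hq hq2 hθ0 hθ1 hϑ0 hα hω
  have h5 : -12 * Y ^ 2 ≤ (θ * ((q / 2) ^ 2 - q / 2)
      + ϑ * ((q - 1) ^ 2 * (1 - 2 * θ) + (q - 1) - q * (q - 1))) * ω ^ 2 := by
    have e1 := bellman_omega_coeff hq hq2 hθ0 hθ1 hϑ0 hϑ4
    have := mul_le_mul_of_nonneg_right e1 (sq_nonneg ω)
    linarith
  have h6 : -1 * Y ^ 2 ≤ (q * θ - 2 * (q - 1) * ϑ) * Y ^ 2 := by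
    have : -1 ≤ q * θ - 2 * (q - 1) * ϑ := by nlinarith
    exact mul_le_mul_of_nonneg_right this (sq_nonneg Y)
  have h7 : ε * w * ((2 * ϑ * (1 - 4 * θ) - σ / 4) * X ^ 2 - 269 * Y ^ 2) ≤
      ε * w * (-2 * θ * ϑ * α ^ 2 + 2 * ϑ * X ^ 2
        + ϑ * (q - 2 * (q - 1) * (1 - 2 * θ)) * (α * ω)
        + (θ * ((q / 2) ^ 2 - q / 2) + ϑ * ((q - 1) ^ 2 * (1 - 2 * θ) + (q - 1) - q * (q - 1)))
          * ω ^ 2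
        + (q * θ - 2 * (q - 1) * ϑ) * Y ^ 2) := by
    refine mul_le_mul_of_nonneg_left ?_ (by positivity)
    have := mul_le_mul_of_nonneg_right hϑσ (sq_nonneg X)
    linarith
  have h9 := mul_le_mul_of_nonneg_right h8 (sq_nonneg X)
  have h10 : ε * (269 * (w * Y ^ 2)) ≤ 1 * (269 * (w * Y ^ 2)) := by
    gcongr; linarith
  linarith

/-! ### The Poisson extension -/

/-- The Poisson kernel of the upper half plane. -/
noncomputable def poissonK (x y : ℝ) : ℝ := π⁻¹ * (y / (x ^ 2 + y ^ 2))

/-- The `x`-derivative of the Poisson kernel. -/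
noncomputable def poissonKX (x y : ℝ) : ℝ := π⁻¹ * (-(2 * x * y) / (x ^ 2 + y ^ 2) ^ 2)

/-- The `y`-derivative of the Poisson kernel. -/
noncomputable def poissonKY (x y : ℝ) : ℝ := π⁻¹ * ((x ^ 2 - y ^ 2) / (x ^ 2 + y ^ 2) ^ 2)

/-- The second `x`-derivative of the Poisson kernel. -/
noncomputable def poissonKXX (x y : ℝ) : ℝ :=
  π⁻¹ * (y * (6 * x ^ 2 - 2 * y ^ 2) / (x ^ 2 + y ^ 2) ^ 3)

section Kernel

variable {x y : ℝ}

theorem poissonK_pos (x : ℝ) (hy : 0 < y) : 0 < poissonK x y := by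
  unfold poissonK; positivity

theorem poissonK_le (x : ℝ) (hy : 0 < y) : poissonK x y ≤ y⁻¹ := by
  unfold poissonK
  have h1 : π⁻¹ ≤ 1 := inv_le_one_of_one_le₀ (by linarith [Real.pi_gt_three])
  have h2 : y / (x ^ 2 + y ^ 2) ≤ y⁻¹ := by
    rw [div_le_iff₀ (by positivity)]
    field_simp
    nlinarith [sq_nonneg x]
  calc π⁻¹ * (y / (x ^ 2 + y ^ 2)) ≤ 1 * y⁻¹ := by gcongr
    _ = _ := one_mul _

theorem abs_poissonKX_le (x : ℝ) (hy : 0 < y) : |poissonKX x y| ≤ y⁻¹ * poissonK x y := by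
  have hD : 0 < x ^ 2 + y ^ 2 := by positivity
  have : |x| * (2 * y) ≤ x ^ 2 + y ^ 2 := by
    rw [← sq_abs x]; nlinarith [sq_nonneg (|x| - y)]
  rw [poissonKX, poissonK, abs_mul, abs_div, abs_neg, abs_of_pos (by positivity : (0:ℝ) < π⁻¹),
    abs_of_pos (by positivity : 0 < (x ^ 2 + y ^ 2) ^ 2), abs_mul, abs_mul, abs_two, abs_of_pos hy]
  rw [show y⁻¹ * (π⁻¹ * (y / (x ^ 2 + y ^ 2))) = π⁻¹ * (1 / (x ^ 2 + y ^ 2)) by field_simp]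
  gcongr ?_ * ?_
  rw [div_le_div_iff₀ (by positivity) hD]
  nlinarith

theorem abs_poissonKY_le (x : ℝ) (hy : 0 < y) : |poissonKY x y| ≤ y⁻¹ * poissonK x y := by
  have hD : 0 < x ^ 2 + y ^ 2 := by positivity
  have : |x ^ 2 - y ^ 2| ≤ x ^ 2 + y ^ 2 := by
    rw [abs_le]; constructor <;> nlinarith [sq_nonneg x, sq_nonneg y]
  rw [poissonKY, poissonK, abs_mul, abs_div, abs_of_pos (by positivity : (0:ℝ) < π⁻¹),
    abs_of_pos (by positivity : 0 < (x ^ 2 + y ^ 2) ^ 2)]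
  rw [show y⁻¹ * (π⁻¹ * (y / (x ^ 2 + y ^ 2))) = π⁻¹ * (1 / (x ^ 2 + y ^ 2)) by field_simp]
  gcongr ?_ * ?_
  rw [div_le_div_iff₀ (by positivity) hD]
  nlinarith

theorem abs_poissonKXX_le (x : ℝ) (hy : 0 < y) :
    |poissonKXX x y| ≤ 6 * (y⁻¹) ^ 2 * poissonK x y := by
  have hD : 0 < x ^ 2 + y ^ 2 := by positivity
  have : |6 * x ^ 2 - 2 * y ^ 2| ≤ 6 * (x ^ 2 + y ^ 2) := by
    rw [abs_le]; constructor <;> nlinarith [sq_nonneg x, sq_nonneg y]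
  rw [poissonKXX, poissonK, abs_mul, abs_div, abs_of_pos (by positivity : (0:ℝ) < π⁻¹),
    abs_of_pos (by positivity : 0 < (x ^ 2 + y ^ 2) ^ 3), abs_mul, abs_of_pos hy]
  rw [show 6 * y⁻¹ ^ 2 * (π⁻¹ * (y / (x ^ 2 + y ^ 2))) = π⁻¹ * (6 / (y * (x ^ 2 + y ^ 2))) by
    field_simp]
  gcongr ?_ * ?_
  rw [div_le_div_iff₀ (by positivity) (by positivity)]
  have h2 : y ^ 2 ≤ x ^ 2 + y ^ 2 := by nlinarith [sq_nonneg x]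
  calc y * |6 * x ^ 2 - 2 * y ^ 2| * (y * (x ^ 2 + y ^ 2))
      = y ^ 2 * (x ^ 2 + y ^ 2) * |6 * x ^ 2 - 2 * y ^ 2| := by ring
    _ ≤ (x ^ 2 + y ^ 2) * (x ^ 2 + y ^ 2) * (6 * (x ^ 2 + y ^ 2)) := by gcongr
    _ = _ := by ring

theorem poissonK_harnack (x : ℝ) {y₀ : ℝ} (hy₀ : 0 < y₀) (h1 : y₀ / 2 < y) (h2 : y < 3 * y₀ / 2) :
    poissonK x y ≤ 6 * poissonK x y₀ := by
  have hy : 0 < y := by linarith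
  rw [poissonK, poissonK, ← mul_assoc, mul_comm 6, mul_assoc]
  gcongr ?_ * ?_
  rw [← mul_div_assoc, div_le_div_iff₀ (by positivity) (by positivity)]
  have e1 : x ^ 2 + y₀ ^ 2 ≤ 4 * (x ^ 2 + y ^ 2) := by nlinarith [sq_nonneg x]
  calc y * (x ^ 2 + y₀ ^ 2) ≤ (3 * y₀ / 2) * (4 * (x ^ 2 + y ^ 2)) := by gcongr
    _ = _ := by ring

theorem hasDerivAt_poissonK_x (x : ℝ) (hy : 0 < y) :
    HasDerivAt (fun s => poissonK s y) (poissonKX x y) x := by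
  have hD : x ^ 2 + y ^ 2 ≠ 0 := by positivity
  have := ((hasDerivAt_const x y).div (((hasDerivAt_id x).pow 2).add_const (y ^ 2)) hD).const_mul π⁻¹
  refine this.congr_deriv ?_
  simp only [poissonKX, id, Pi.pow_apply]
  field_simp
  ring

theorem hasDerivAt_poissonK_y (x : ℝ) (hy : 0 < y) :
    HasDerivAt (fun s => poissonK x s) (poissonKY x y) y := by
  have hD : x ^ 2 + y ^ 2 ≠ 0 := by positivity
  have := ((hasDerivAt_id y).div (((hasDerivAt_id y).pow 2).const_add (x ^ 2)) hD).const_mul π⁻¹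
  refine this.congr_deriv ?_
  simp only [poissonKY, id, Pi.pow_apply]
  field_simp
  ring

theorem hasDerivAt_poissonKX (x : ℝ) (hy : 0 < y) :
    HasDerivAt (fun s => poissonKX s y) (poissonKXX x y) x := by
  have hD : x ^ 2 + y ^ 2 ≠ 0 := by positivity
  have := ((((hasDerivAt_id x).const_mul 2).mul_const y).neg.div
    ((((hasDerivAt_id x).pow 2).add_const (y ^ 2)).pow 2) (pow_ne_zero 2 hD)).const_mul π⁻¹
  refine this.congr_deriv ?_
  simp only [poissonKXX, id, Pi.pow_apply, Pi.neg_apply]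
  field_simp
  ring

theorem hasDerivAt_poissonKY (x : ℝ) (hy : 0 < y) :
    HasDerivAt (fun s => poissonKY x s) (-poissonKXX x y) y := by
  have hD : x ^ 2 + y ^ 2 ≠ 0 := by positivity
  have := ((((hasDerivAt_id y).pow 2).const_sub (x ^ 2)).div
    ((((hasDerivAt_id y).pow 2).const_add (x ^ 2)).pow 2) (pow_ne_zero 2 hD)).const_mul π⁻¹
  refine this.congr_deriv ?_
  simp only [poissonKXX, id, Pi.pow_apply]
  field_simp
  ring

theorem continuous_poissonK (hy : 0 < y) : Continuous fun s => poissonK s y :=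
  continuous_iff_continuousAt.2 fun x => (hasDerivAt_poissonK_x x hy).continuousAt

theorem continuous_poissonKX (hy : 0 < y) : Continuous fun s => poissonKX s y :=
  continuous_iff_continuousAt.2 fun x => (hasDerivAt_poissonKX x hy).continuousAt

theorem measurable_poissonK : Measurable fun z : ℝ × ℝ => poissonK z.1 z.2 := by
  unfold poissonK; fun_prop

theorem measurable_poissonKX : Measurable fun z : ℝ × ℝ => poissonKX z.1 z.2 := by
  unfold poissonKX; fun_prop

theorem measurable_poissonKY : Measurable fun z : ℝ × ℝ => poissonKY z.1 z.2 := by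
  unfold poissonKY; fun_prop

theorem measurable_poissonKXX : Measurable fun z : ℝ × ℝ => poissonKXX z.1 z.2 := by
  unfold poissonKXX; fun_prop

theorem lintegral_poissonK (hy : 0 < y) : ∫⁻ x, ENNReal.ofReal (poissonK x y) = 1 := by
  have h0 : (fun x => poissonK x y) = fun x => (π⁻¹ * y⁻¹) * (1 + (y⁻¹ * x) ^ 2)⁻¹ := by
    ext x; unfold poissonK; field_simp; ring
  have hi : Integrable fun x => poissonK x y := by
    rw [h0]
    exact (integrable_inv_one_add_sq.comp_mul_left' (inv_pos.2 hy).ne').const_mul _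
  rw [← ofReal_integral_eq_lintegral_ofReal hi (ae_of_all _ fun x => (poissonK_pos x hy).le)]
  rw [h0, integral_const_mul, Measure.integral_comp_mul_left (fun x => (1 + x ^ 2)⁻¹) y⁻¹,
    integral_univ_inv_one_add_sq, inv_inv, abs_of_pos hy, smul_eq_mul]
  rw [show π⁻¹ * y⁻¹ * (y * π) = 1 by field_simp, ENNReal.ofReal_one]

end Kernel

section Ext

variable {E : Type*} [NormedAddCommGroup E] [NormedSpace ℝ E]

/-- The extension of `F` to the upper half plane by convolution with the kernels `k (·, y)`. -/
noncomputable def kernelExt (k : ℝ → ℝ → ℝ) (F : ℝ → E) (x y : ℝ) : E := ∫ t, k (x - t) y • F t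

theorem integrable_kernel_smul {k : ℝ → ℝ} {F : ℝ → E} {C : ℝ} (hk : Measurable k)
    (hC : ∀ t, |k t| ≤ C) (hF : Integrable F) (x : ℝ) : Integrable fun t => k (x - t) • F t :=
  hF.bdd_smul C (hk.comp (measurable_const.sub measurable_id)).aestronglyMeasurable
    (ae_of_all _ fun _ => hC _)

theorem measurable_left {k : ℝ → ℝ → ℝ} (hk : Measurable fun z : ℝ × ℝ => k z.1 z.2) (y : ℝ) :
    Measurable fun x => k x y := hk.comp (measurable_id.prodMk measurable_const)

theorem norm_kernelExt_le {k : ℝ → ℝ → ℝ} {F : ℝ → E} {c x y : ℝ} (hF : Integrable F) (hy : 0 < y)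
    (hk : ∀ z, |k z y| ≤ c * poissonK z y) :
    ‖kernelExt k F x y‖ ≤ c * kernelExt poissonK (fun t => ‖F t‖) x y := by
  unfold kernelExt
  rw [← integral_const_mul]
  refine norm_integral_le_of_norm_le ((integrable_kernel_smul (measurable_left measurable_poissonK y)
    (C := y⁻¹) (fun t => ?_) hF.norm x).const_mul c) (ae_of_all _ fun t => ?_)
  · rw [abs_of_pos (poissonK_pos t hy)]; exact poissonK_le t hy
  · rw [norm_smul, smul_eq_mul, ← mul_assoc]
    exact mul_le_mul_of_nonneg_right (hk _) (norm_nonneg _)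

theorem hasDerivAt_kernelExt_x {k k' : ℝ → ℝ → ℝ} {F : ℝ → E} {C x y : ℝ} (hF : Integrable F)
    (hk : Measurable fun z : ℝ × ℝ => k z.1 z.2) (hk' : Measurable fun z : ℝ × ℝ => k' z.1 z.2)
    (hC : ∀ z, |k z y| ≤ C) (hC' : ∀ z, |k' z y| ≤ C)
    (h : ∀ z, HasDerivAt (fun s => k s y) (k' z y) z) :
    HasDerivAt (fun s => kernelExt k F s y) (kernelExt k' F x y) x := by
  refine (hasDerivAt_integral_of_dominated_loc_of_deriv_le (μ := volume) (s := Set.univ)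
    (F := fun s t => k (s - t) y • F t) (F' := fun s t => k' (s - t) y • F t)
    (bound := fun t => C * ‖F t‖) Filter.univ_mem
    (Filter.Eventually.of_forall fun s =>
      (integrable_kernel_smul (measurable_left hk y) hC hF s).aestronglyMeasurable)
    (integrable_kernel_smul (measurable_left hk y) hC hF x)
    (integrable_kernel_smul (measurable_left hk' y) hC' hF x).aestronglyMeasurable
    (ae_of_all _ fun t s _ => ?_) (hF.norm.const_mul C) (ae_of_all _ fun t s _ => ?_)).2
  · rw [norm_smul]; exact mul_le_mul_of_nonneg_right (hC' _) (norm_nonneg _)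
  · exact ((h (s - t)).comp_sub_const s t).smul_const (F t)

theorem hasDerivAt_kernelExt_y {k k' : ℝ → ℝ → ℝ} {F : ℝ → E} {C x y : ℝ} {S : Set ℝ}
    (hF : Integrable F) (hS : S ∈ nhds y)
    (hk : Measurable fun z : ℝ × ℝ => k z.1 z.2) (hk' : Measurable fun z : ℝ × ℝ => k' z.1 z.2)
    (hC : ∀ z, ∀ s ∈ S, |k z s| ≤ C) (hC' : ∀ z, ∀ s ∈ S, |k' z s| ≤ C)
    (h : ∀ z, ∀ s ∈ S, HasDerivAt (fun s => k z s) (k' z s) s) :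
    HasDerivAt (fun s => kernelExt k F x s) (kernelExt k' F x y) y := by
  have hy := mem_of_mem_nhds hS
  refine (hasDerivAt_integral_of_dominated_loc_of_deriv_le (μ := volume) (s := S)
    (F := fun s t => k (x - t) s • F t) (F' := fun s t => k' (x - t) s • F t)
    (bound := fun t => C * ‖F t‖) hS
    (Filter.eventually_of_mem hS fun s hs =>
      (integrable_kernel_smul (measurable_left hk s) (fun z => hC z s hs) hF x).aestronglyMeasurable)
    (integrable_kernel_smul (measurable_left hk y) (fun z => hC z y hy) hF x)
    (integrable_kernel_smul (measurable_left hk' y) (fun z => hC' z y hy) hF x).aestronglyMeasurable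
    (ae_of_all _ fun t s hs => ?_) (hF.norm.const_mul C) (ae_of_all _ fun t s hs => ?_)).2
  · rw [norm_smul]; exact mul_le_mul_of_nonneg_right (hC' _ s hs) (norm_nonneg _)
  · exact (h (x - t) s hs).smul_const (F t)

theorem poisson_hasDerivAt_x {F : ℝ → E} (hF : Integrable F) (x : ℝ) {y : ℝ} (hy : 0 < y) :
    HasDerivAt (fun s => kernelExt poissonK F s y) (kernelExt poissonKX F x y) x := by
  have hC : ∀ z, poissonK z y ≤ y⁻¹ := fun z => poissonK_le z hy
  have hy' : 0 < y⁻¹ := inv_pos.2 hy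
  refine hasDerivAt_kernelExt_x (C := max y⁻¹ (y⁻¹ * y⁻¹)) hF measurable_poissonK
    measurable_poissonKX (fun z => ?_) (fun z => ?_) fun z => hasDerivAt_poissonK_x z hy
  · rw [abs_of_pos (poissonK_pos z hy)]; exact (hC z).trans (le_max_left _ _)
  · exact ((abs_poissonKX_le z hy).trans (mul_le_mul_of_nonneg_left (hC z) hy'.le)).trans
      (le_max_right _ _)

theorem poisson_hasDerivAt_xx {F : ℝ → E} (hF : Integrable F) (x : ℝ) {y : ℝ} (hy : 0 < y) :
    HasDerivAt (fun s => kernelExt poissonKX F s y) (kernelExt poissonKXX F x y) x := by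
  have hC : ∀ z, poissonK z y ≤ y⁻¹ := fun z => poissonK_le z hy
  have hy' : 0 < y⁻¹ := inv_pos.2 hy
  refine hasDerivAt_kernelExt_x (C := max (y⁻¹ * y⁻¹) (6 * y⁻¹ ^ 2 * y⁻¹)) hF measurable_poissonKX
    measurable_poissonKXX (fun z => ?_) (fun z => ?_) fun z => hasDerivAt_poissonKX z hy
  · exact ((abs_poissonKX_le z hy).trans (mul_le_mul_of_nonneg_left (hC z) hy'.le)).trans
      (le_max_left _ _)
  · exact ((abs_poissonKXX_le z hy).trans (mul_le_mul_of_nonneg_left (hC z) (by positivity))).trans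
      (le_max_right _ _)

theorem Ioi_half_mem_nhds {y : ℝ} (hy : 0 < y) : Set.Ioi (y / 2) ∈ nhds y :=
  Ioi_mem_nhds (by linarith)

theorem poisson_hasDerivAt_y {F : ℝ → E} (hF : Integrable F) (x : ℝ) {y : ℝ} (hy : 0 < y) :
    HasDerivAt (fun s => kernelExt poissonK F x s) (kernelExt poissonKY F x y) y := by
  have hp : ∀ s ∈ Set.Ioi (y / 2), 0 < s := fun s hs => by
    have : y / 2 < s := hs
    linarith
  have hs' : ∀ s ∈ Set.Ioi (y / 2), s⁻¹ ≤ (y / 2)⁻¹ := fun s hs =>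
    inv_anti₀ (by positivity) (le_of_lt hs)
  have hC : ∀ z, ∀ s ∈ Set.Ioi (y / 2), poissonK z s ≤ (y / 2)⁻¹ := fun z s hs =>
    (poissonK_le z (hp s hs)).trans (hs' s hs)
  refine hasDerivAt_kernelExt_y (C := max (y / 2)⁻¹ ((y / 2)⁻¹ * (y / 2)⁻¹)) hF
    (Ioi_half_mem_nhds hy) measurable_poissonK
    measurable_poissonKY (fun z s hs => ?_) (fun z s hs => ?_)
    fun z s hs => hasDerivAt_poissonK_y z (hp s hs)
  · rw [abs_of_pos (poissonK_pos z (hp s hs))]; exact (hC z s hs).trans (le_max_left _ _)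
  · exact ((abs_poissonKY_le z (hp s hs)).trans (mul_le_mul (hs' s hs) (hC z s hs)
      (poissonK_pos z (hp s hs)).le (by positivity))).trans (le_max_right _ _)

theorem poisson_hasDerivAt_yy {F : ℝ → E} (hF : Integrable F) (x : ℝ) {y : ℝ} (hy : 0 < y) :
    HasDerivAt (fun s => kernelExt poissonKY F x s) (-kernelExt poissonKXX F x y) y := by
  have hp : ∀ s ∈ Set.Ioi (y / 2), 0 < s := fun s hs => by
    have : y / 2 < s := hs
    linarith
  have hs' : ∀ s ∈ Set.Ioi (y / 2), s⁻¹ ≤ (y / 2)⁻¹ := fun s hs =>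
    inv_anti₀ (by positivity) (le_of_lt hs)
  have hC : ∀ z, ∀ s ∈ Set.Ioi (y / 2), poissonK z s ≤ (y / 2)⁻¹ := fun z s hs =>
    (poissonK_le z (hp s hs)).trans (hs' s hs)
  have := hasDerivAt_kernelExt_y (x := x) (k := poissonKY) (k' := fun x y => -poissonKXX x y)
    (C := max ((y / 2)⁻¹ * (y / 2)⁻¹) (6 * (y / 2)⁻¹ ^ 2 * (y / 2)⁻¹)) hF
    (Ioi_half_mem_nhds hy) measurable_poissonKY
    measurable_poissonKXX.neg (fun z s hs => ?_) (fun z s hs => ?_)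
    fun z s hs => hasDerivAt_poissonKY z (hp s hs)
  · refine this.congr_deriv ?_
    simp only [kernelExt, neg_smul, integral_neg]
  · exact ((abs_poissonKY_le z (hp s hs)).trans (mul_le_mul (hs' s hs) (hC z s hs)
      (poissonK_pos z (hp s hs)).le (by positivity))).trans (le_max_left _ _)
  · rw [abs_neg]
    refine ((abs_poissonKXX_le z (hp s hs)).trans (mul_le_mul ?_ (hC z s hs)
      (poissonK_pos z (hp s hs)).le (by positivity))).trans (le_max_right _ _)
    have := hs' s hs
    have := hp s hs
    gcongr

theorem integrable_poissonK_smul {F : ℝ → E} (hF : Integrable F) (x : ℝ) {y : ℝ} (hy : 0 < y) :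
    Integrable fun t => poissonK (x - t) y • F t :=
  integrable_kernel_smul (measurable_left measurable_poissonK y) (C := y⁻¹)
    (fun t => by rw [abs_of_pos (poissonK_pos t hy)]; exact poissonK_le t hy) hF x

theorem poisson_harnack {φ : ℝ → ℝ} (hφ : Integrable φ) (h0 : ∀ t, 0 ≤ φ t) (x : ℝ) {y y₀ : ℝ}
    (hy₀ : 0 < y₀) (h1 : y₀ / 2 < y) (h2 : y < 3 * y₀ / 2) :
    kernelExt poissonK φ x y ≤ 6 * kernelExt poissonK φ x y₀ := by
  unfold kernelExt
  rw [← integral_const_mul]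
  refine integral_mono (integrable_poissonK_smul hφ x (by linarith))
    ((integrable_poissonK_smul hφ x hy₀).const_mul 6) fun t => ?_
  simp only [smul_eq_mul, ← mul_assoc]
  exact mul_le_mul_of_nonneg_right (poissonK_harnack _ hy₀ h1 h2) (h0 t)

theorem poisson_nonneg {φ : ℝ → ℝ} (h0 : ∀ t, 0 ≤ φ t) (x : ℝ) {y : ℝ} (hy : 0 < y) :
    0 ≤ kernelExt poissonK φ x y :=
  integral_nonneg fun t => mul_nonneg (poissonK_pos _ hy).le (h0 t)

theorem poisson_pos {φ : ℝ → ℝ} (hφ : Integrable φ) (h0 : ∀ t, 0 ≤ φ t) (hne : ¬ φ =ᵐ[volume] 0)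
    (x : ℝ) {y : ℝ} (hy : 0 < y) : 0 < kernelExt poissonK φ x y := by
  refine lt_of_le_of_ne (poisson_nonneg h0 x hy) fun h => hne ?_
  have := (integral_eq_zero_iff_of_nonneg (fun t => mul_nonneg (poissonK_pos _ hy).le (h0 t))
    (integrable_poissonK_smul hφ x hy)).1 h.symm
  filter_upwards [this] with t ht
  simpa [(poissonK_pos (x - t) hy).ne'] using ht

theorem lintegral_poisson_rpow_le {φ : ℝ → ℝ} {p : ℝ} (hp : 1 ≤ p) (hφ : Integrable φ)
    (h0 : ∀ t, 0 ≤ φ t) {y : ℝ} (hy : 0 < y) :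
    ∫⁻ x, ENNReal.ofReal (kernelExt poissonK φ x y ^ p) ≤ ∫⁻ t, ENNReal.ofReal (φ t ^ p) := by
  have hp0 : 0 < p := by linarith
  have hm : Measurable fun z : ℝ × ℝ => ENNReal.ofReal (poissonK (z.1 - z.2) y) :=
    ((measurable_left measurable_poissonK y).comp (measurable_fst.sub measurable_snd)).ennreal_ofReal
  have hshift : ∀ x, ∫⁻ t, ENNReal.ofReal (poissonK (x - t) y) = 1 := fun x => by
    rw [lintegral_sub_left_eq_self (fun t => ENNReal.ofReal (poissonK t y)) x]
    exact lintegral_poissonK hy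
  have key : ∀ x, ENNReal.ofReal (kernelExt poissonK φ x y ^ p) ≤
      ∫⁻ t, ENNReal.ofReal (poissonK (x - t) y) * ENNReal.ofReal (φ t ^ p) := fun x => by
    have hmx : Measurable fun t => ENNReal.ofReal (poissonK (x - t) y) :=
      ((measurable_left measurable_poissonK y).comp
        (measurable_const.sub measurable_id)).ennreal_ofReal
    set ν := (volume : Measure ℝ).withDensity fun t => ENNReal.ofReal (poissonK (x - t) y) with hν
    have hνp : IsProbabilityMeasure ν := ⟨by
      rw [hν, withDensity_apply _ MeasurableSet.univ, Measure.restrict_univ]; exact hshift x⟩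
    have hac : ν ≪ volume := withDensity_absolutelyContinuous _ _
    have h1 := eLpNorm_le_eLpNorm_of_exponent_le (μ := ν) (f := φ) (p := 1)
      (q := ENNReal.ofReal p) (by simpa using hp) (hφ.1.mono_ac hac)
    rw [eLpNorm_one_eq_lintegral_enorm, eLpNorm_eq_lintegral_rpow_enorm_toReal (by simpa using hp0)
      ENNReal.ofReal_ne_top, ENNReal.toReal_ofReal hp0.le, one_div,
      ENNReal.le_rpow_inv_iff hp0] at h1
    have h2 : ENNReal.ofReal (kernelExt poissonK φ x y) = ∫⁻ t, ‖φ t‖ₑ ∂ν := by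
      rw [kernelExt, ofReal_integral_eq_lintegral_ofReal (integrable_poissonK_smul hφ x hy)
        (ae_of_all _ fun t => mul_nonneg (poissonK_pos _ hy).le (h0 t)), hν,
        lintegral_withDensity_eq_lintegral_mul₀ hmx.aemeasurable hφ.1.enorm]
      refine lintegral_congr fun t => ?_
      rw [Pi.mul_apply, smul_eq_mul, ENNReal.ofReal_mul (poissonK_pos _ hy).le,
        Real.enorm_eq_ofReal (h0 t)]
    rw [← ENNReal.ofReal_rpow_of_nonneg (poisson_nonneg h0 x hy) hp0.le, h2]
    refine h1.trans (le_of_eq ?_)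
    rw [hν, lintegral_withDensity_eq_lintegral_mul₀ hmx.aemeasurable (hφ.1.enorm.pow_const p)]
    refine lintegral_congr fun t => ?_
    rw [Pi.mul_apply, Real.enorm_eq_ofReal (h0 t), ENNReal.ofReal_rpow_of_nonneg (h0 t) hp0.le]
  refine (lintegral_mono key).trans (le_of_eq ?_)
  have hφp : AEMeasurable fun t => ENNReal.ofReal (φ t ^ p) :=
    (hφ.1.aemeasurable.pow_const p).ennreal_ofReal
  rw [lintegral_lintegral_swap (hm.aemeasurable.mul hφp.comp_snd)]
  refine lintegral_congr fun t => ?_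
  have hmt : Measurable fun x => ENNReal.ofReal (poissonK (x - t) y) :=
    ((measurable_left measurable_poissonK y).comp
      (measurable_id.sub_const t)).ennreal_ofReal
  rw [lintegral_mul_const _ hmt,
    lintegral_sub_right_eq_self (fun x => ENNReal.ofReal (poissonK x y)) t, lintegral_poissonK hy,
    one_mul]

theorem continuous_poisson_x {F : ℝ → E} (hF : Integrable F) {y : ℝ} (hy : 0 < y) :
    Continuous fun x => kernelExt poissonK F x y :=
  continuous_iff_continuousAt.2 fun x => (poisson_hasDerivAt_x hF x hy).continuousAt

theorem integrable_poisson_rpow {φ : ℝ → ℝ} {p : ℝ} (hp : 1 ≤ p) (hφ : Integrable φ)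
    (h0 : ∀ t, 0 ≤ φ t) (hφp : Integrable fun t => φ t ^ p) {y : ℝ} (hy : 0 < y) :
    Integrable (fun x => kernelExt poissonK φ x y ^ p) ∧
      ∫ x, kernelExt poissonK φ x y ^ p ≤ ∫ t, φ t ^ p := by
  have h1 := lintegral_poisson_rpow_le hp hφ h0 hy
  have h2 : ∫⁻ t, ENNReal.ofReal (φ t ^ p) < ⊤ := by
    rw [← ofReal_integral_eq_lintegral_ofReal hφp (ae_of_all _ fun t => Real.rpow_nonneg (h0 t) p)]
    exact ENNReal.ofReal_lt_top
  have hn : ∀ x, 0 ≤ kernelExt poissonK φ x y ^ p := fun x =>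
    Real.rpow_nonneg (poisson_nonneg h0 x hy) p
  have hm : AEStronglyMeasurable (fun x => kernelExt poissonK φ x y ^ p) volume :=
    ((continuous_poisson_x hφ hy).rpow_const fun x => Or.inr (by linarith)).aestronglyMeasurable
  refine ⟨⟨hm, (hasFiniteIntegral_iff_ofReal (ae_of_all _ hn)).2 (h1.trans_lt h2)⟩, ?_⟩
  rw [integral_eq_lintegral_of_nonneg_ae (ae_of_all _ hn) hm,
    integral_eq_lintegral_of_nonneg_ae (ae_of_all _ fun t => Real.rpow_nonneg (h0 t) p) hφp.1]
  exact ENNReal.toReal_mono h2.ne h1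

end Ext

section BellmanBounds

theorem abs_bellmanD_le {p q K ε r w θ α ω d : ℝ} (hp : 2 ≤ p) (hq : 1 < q) (hq2 : q ≤ 2)
    (hK : 0 ≤ K) (hε : 0 ≤ ε) (hε1 : ε ≤ 1) (hr : 0 ≤ r) (hw : 0 ≤ w) (hθ0 : 0 ≤ θ) (hθ1 : θ ≤ 1)
    (hα : |α| ≤ d) (hω : |ω| ≤ d) :
    |bellmanD p q K ε r w θ α ω| ≤ (p ^ 2 + 4 * K + 16) * ((r + w) * d) := by
  have hd : 0 ≤ d := (abs_nonneg _).trans hα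
  have hϑ0 : 0 ≤ θ * (1 - θ) := mul_nonneg hθ0 (by linarith)
  have hϑ1 : θ * (1 - θ) ≤ 1 := by nlinarith
  have e1 : |(p / 2) * r * α| ≤ (p / 2) * r * d := by
    rw [abs_mul, abs_of_nonneg (by positivity : 0 ≤ p / 2 * r)]; gcongr
  have e2 : |K * ((q / 2) * w * ω)| ≤ K * (1 * w * d) := by
    rw [abs_mul, abs_mul, abs_of_nonneg hK, abs_of_nonneg (by positivity : 0 ≤ q / 2 * w)]
    gcongr; linarith
  have e3 : |(q / 2) * ω * θ + θ * (1 - θ) * (α - (q - 1) * ω)| ≤ 3 * d := by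
    have f1 : |(q / 2) * ω * θ| ≤ 1 * d * 1 := by
      rw [abs_mul, abs_mul, abs_of_nonneg hθ0, abs_of_pos (by positivity : 0 < q / 2)]
      gcongr; linarith
    have f2 : |(q - 1) * ω| ≤ 1 * d := by
      rw [abs_mul, abs_of_pos (by linarith : 0 < q - 1)]; gcongr; linarith
    have f3 : |α - (q - 1) * ω| ≤ 2 * d := by
      have := abs_sub α ((q - 1) * ω); linarith
    have f4 : |θ * (1 - θ) * (α - (q - 1) * ω)| ≤ 1 * (2 * d) := by
      rw [abs_mul, abs_of_nonneg hϑ0]; gcongr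
    have := abs_add_le ((q / 2) * ω * θ) (θ * (1 - θ) * (α - (q - 1) * ω))
    linarith
  have e4 : |ε * (w * ((q / 2) * ω * θ + θ * (1 - θ) * (α - (q - 1) * ω)))| ≤ 1 * (w * (3 * d)) := by
    rw [abs_mul, abs_mul, abs_of_nonneg hε, abs_of_nonneg hw]; gcongr
  have e5 := abs_add_three ((p / 2) * r * α) (K * ((q / 2) * w * ω))
    (ε * (w * ((q / 2) * ω * θ + θ * (1 - θ) * (α - (q - 1) * ω))))
  have hrd : 0 ≤ r * d := by positivity
  have hwd : 0 ≤ w * d := by positivity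
  have g1 : p / 2 * (r * d) ≤ (p ^ 2 + 4 * K + 16) * (r * d) :=
    mul_le_mul_of_nonneg_right (by nlinarith) hrd
  have g2 : (K + 3) * (w * d) ≤ (p ^ 2 + 4 * K + 16) * (w * d) :=
    mul_le_mul_of_nonneg_right (by nlinarith) hwd
  unfold bellmanD
  linarith

set_option maxHeartbeats 1000000 in
theorem abs_bellmanDD_le {p q K ε r w θ α ω α' ω' d : ℝ} (hp : 2 ≤ p) (hq : 1 < q) (hq2 : q ≤ 2)
    (hK : 0 ≤ K) (hε : 0 ≤ ε) (hε1 : ε ≤ 1) (hr : 0 ≤ r) (hw : 0 ≤ w) (hθ0 : 0 ≤ θ) (hθ1 : θ ≤ 1)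
    (hα : |α| ≤ d) (hω : |ω| ≤ d) (hα' : |α'| ≤ d ^ 2) (hω' : |ω'| ≤ d ^ 2) :
    |bellmanDD p q K ε r w θ α ω α' ω'| ≤ (p ^ 2 + 4 * K + 16) * ((r + w) * d ^ 2) := by
  have hd : 0 ≤ d := (abs_nonneg _).trans hα
  have hϑ0 : 0 ≤ θ * (1 - θ) := mul_nonneg hθ0 (by linarith)
  have hϑ1 : θ * (1 - θ) ≤ 1 / 4 := by nlinarith [sq_nonneg (θ - 1 / 2)]
  have hα2 : α ^ 2 ≤ d ^ 2 := sq_le_sq' (by linarith [(abs_le.1 hα).1]) (abs_le.1 hα).2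
  have hω2 : ω ^ 2 ≤ d ^ 2 := sq_le_sq' (by linarith [(abs_le.1 hω).1]) (abs_le.1 hω).2
  have e1 : |(p / 2) * r * ((p / 2) * α ^ 2 + α')| ≤ (p / 2) * r * (p / 2 * d ^ 2 + d ^ 2) := by
    rw [abs_mul, abs_of_nonneg (by positivity : 0 ≤ p / 2 * r)]
    gcongr
    refine (abs_add_le _ _).trans ?_
    rw [abs_of_nonneg (by positivity : 0 ≤ p / 2 * α ^ 2)]
    gcongr
  have e2 : |K * ((q / 2) * w * ((q / 2) * ω ^ 2 + ω'))| ≤ K * (1 * w * (1 * d ^ 2 + d ^ 2)) := by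
    rw [abs_mul, abs_mul, abs_of_nonneg hK, abs_of_nonneg (by positivity : 0 ≤ q / 2 * w)]
    gcongr
    · linarith
    · refine (abs_add_le _ _).trans ?_
      rw [abs_of_nonneg (by positivity : 0 ≤ q / 2 * ω ^ 2)]
      gcongr
      linarith
  have f2 : |(q - 1) * ω| ≤ 1 * d := by
    rw [abs_mul, abs_of_pos (by linarith : 0 < q - 1)]; gcongr; linarith
  have f3 : |α - (q - 1) * ω| ≤ 2 * d := by
    have := abs_sub α ((q - 1) * ω); linarith
  have f2' : |(q - 1) * ω'| ≤ 1 * d ^ 2 := by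
    rw [abs_mul, abs_of_pos (by linarith : 0 < q - 1)]; gcongr; linarith
  have f3' : |α' - (q - 1) * ω'| ≤ 2 * d ^ 2 := by
    have := abs_sub α' ((q - 1) * ω'); linarith
  have f4 : |θ * (1 - θ) * (α - (q - 1) * ω)| ≤ 1 / 4 * (2 * d) := by
    rw [abs_mul, abs_of_nonneg hϑ0]; gcongr
  have f5 : |(q / 2) * ω| ≤ 1 * d := by
    rw [abs_mul, abs_of_pos (by positivity : 0 < q / 2)]
    gcongr; linarith
  have f6 : |(q / 2) * ω * θ| ≤ d := by
    rw [abs_mul, abs_of_nonneg hθ0]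
    calc _ ≤ (1 * d) * 1 := by gcongr
      _ = d := by ring
  have t1 : |(q / 2) * ω * ((q / 2) * ω * θ + θ * (1 - θ) * (α - (q - 1) * ω))| ≤
      1 * d * (2 * d) := by
    rw [abs_mul]
    gcongr
    refine (abs_add_le _ _).trans ?_
    linarith
  have t2 : |(q / 2) * (ω' * θ + ω * (θ * (1 - θ) * (α - (q - 1) * ω)))| ≤
      1 * (d ^ 2 * 1 + d * (1 / 4 * (2 * d))) := by
    rw [abs_mul, abs_of_pos (by positivity : 0 < q / 2)]
    gcongr
    · linarith
    · refine (abs_add_le _ _).trans ?_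
      rw [abs_mul ω' θ, abs_of_nonneg hθ0, abs_mul ω]
      gcongr
  have t3 : |(1 - 2 * θ) * (θ * (1 - θ)) * (α - (q - 1) * ω) ^ 2| ≤ 1 * (1 / 4) * (2 * d) ^ 2 := by
    rw [abs_mul, abs_mul, abs_of_nonneg hϑ0, abs_pow]
    gcongr
    rw [abs_le]; constructor <;> linarith
  have t4 : |θ * (1 - θ) * (α' - (q - 1) * ω')| ≤ 1 / 4 * (2 * d ^ 2) := by
    rw [abs_mul, abs_of_nonneg hϑ0]; gcongr
  have t5 := abs_add_le ((q / 2) * ω * ((q / 2) * ω * θ + θ * (1 - θ) * (α - (q - 1) * ω))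
      + (q / 2) * (ω' * θ + ω * (θ * (1 - θ) * (α - (q - 1) * ω)))
      + (1 - 2 * θ) * (θ * (1 - θ)) * (α - (q - 1) * ω) ^ 2) (θ * (1 - θ) * (α' - (q - 1) * ω'))
  have t6 := abs_add_three ((q / 2) * ω * ((q / 2) * ω * θ + θ * (1 - θ) * (α - (q - 1) * ω)))
      ((q / 2) * (ω' * θ + ω * (θ * (1 - θ) * (α - (q - 1) * ω))))
      ((1 - 2 * θ) * (θ * (1 - θ)) * (α - (q - 1) * ω) ^ 2)
  have e4 : |ε * (w * ((q / 2) * ω * ((q / 2) * ω * θ + θ * (1 - θ) * (α - (q - 1) * ω))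
      + (q / 2) * (ω' * θ + ω * (θ * (1 - θ) * (α - (q - 1) * ω)))
      + (1 - 2 * θ) * (θ * (1 - θ)) * (α - (q - 1) * ω) ^ 2
      + θ * (1 - θ) * (α' - (q - 1) * ω')))| ≤ 1 * (w * (5 * d ^ 2)) := by
    rw [abs_mul, abs_mul, abs_of_nonneg hε, abs_of_nonneg hw]
    gcongr
    linarith
  have e5 := abs_add_three ((p / 2) * r * ((p / 2) * α ^ 2 + α'))
    (K * ((q / 2) * w * ((q / 2) * ω ^ 2 + ω')))
    (ε * (w * ((q / 2) * ω * ((q / 2) * ω * θ + θ * (1 - θ) * (α - (q - 1) * ω))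
      + (q / 2) * (ω' * θ + ω * (θ * (1 - θ) * (α - (q - 1) * ω)))
      + (1 - 2 * θ) * (θ * (1 - θ)) * (α - (q - 1) * ω) ^ 2
      + θ * (1 - θ) * (α' - (q - 1) * ω'))))
  have hrd : 0 ≤ r * d ^ 2 := by positivity
  have hwd : 0 ≤ w * d ^ 2 := by positivity
  have g1 : (p / 2 * (p / 2 + 1)) * (r * d ^ 2) ≤ (p ^ 2 + 4 * K + 16) * (r * d ^ 2) :=
    mul_le_mul_of_nonneg_right (by nlinarith) hrd
  have g2 : (2 * K + 5) * (w * d ^ 2) ≤ (p ^ 2 + 4 * K + 16) * (w * d ^ 2) :=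
    mul_le_mul_of_nonneg_right (by nlinarith) hwd
  unfold bellmanDD
  linarith

end BellmanBounds

theorem norm_sq_rpow_half {E : Type*} [NormedAddCommGroup E] (u : E) (p : ℝ) : (‖u‖ ^ 2) ^ (p / 2) = ‖u‖ ^ p := by
  rw [← Real.rpow_natCast, ← Real.rpow_mul (norm_nonneg _)]
  congr 1; push_cast; ring

theorem bellman_theta_mem {E E' : Type*} [NormedAddCommGroup E] [NormedAddCommGroup E']
    (u : E) (v : E') (q : ℝ) :
    0 ≤ ‖u‖ ^ 2 / (‖u‖ ^ 2 + (‖v‖ ^ 2) ^ (q - 1)) ∧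
      ‖u‖ ^ 2 / (‖u‖ ^ 2 + (‖v‖ ^ 2) ^ (q - 1)) ≤ 1 := by
  have h : 0 ≤ (‖v‖ ^ 2) ^ (q - 1) := by positivity
  refine ⟨by positivity, div_le_one_of_le₀ (by linarith) (by positivity)⟩

section VectorBellman

variable {E E' : Type*} [NormedAddCommGroup E] [InnerProductSpace ℝ E]
  [NormedAddCommGroup E'] [InnerProductSpace ℝ E']

/-- The constant `K` of the Bellman function. -/
noncomputable def bellmanK (q : ℝ) : ℝ := 270 / (q - 1)

/-- The constant `ε` of the Bellman function. -/
noncomputable def bellmanE (p : ℝ) : ℝ := (7 : ℝ) ^ (-(p / 2 - 1)) / 8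

/-- The constant in the upper bounds for the Bellman function. -/
noncomputable def bellmanC (p q : ℝ) : ℝ := p ^ 2 + 4 * bellmanK q + 16

/-- The Bellman function evaluated at a pair of vectors. -/
noncomputable def vBell (p q : ℝ) (u : E) (v : E') : ℝ :=
  bellman p q (bellmanK q) (bellmanE p) (‖u‖ ^ 2) (‖v‖ ^ 2)

/-- First derivative of `vBell` along a curve. -/
noncomputable def vBellD (p q : ℝ) (u u₁ : E) (v v₁ : E') : ℝ :=
  bellmanD p q (bellmanK q) (bellmanE p) ((‖u‖ ^ 2) ^ (p / 2)) ((‖v‖ ^ 2) ^ (q / 2))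
    (‖u‖ ^ 2 / (‖u‖ ^ 2 + (‖v‖ ^ 2) ^ (q - 1))) (2 * inner ℝ u u₁ / ‖u‖ ^ 2)
    (2 * inner ℝ v v₁ / ‖v‖ ^ 2)

/-- Second derivative of `vBell` along a curve. -/
noncomputable def vBellDD (p q : ℝ) (u u₁ u₂ : E) (v v₁ v₂ : E') : ℝ :=
  bellmanDD p q (bellmanK q) (bellmanE p) ((‖u‖ ^ 2) ^ (p / 2)) ((‖v‖ ^ 2) ^ (q / 2))
    (‖u‖ ^ 2 / (‖u‖ ^ 2 + (‖v‖ ^ 2) ^ (q - 1))) (2 * inner ℝ u u₁ / ‖u‖ ^ 2)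
    (2 * inner ℝ v v₁ / ‖v‖ ^ 2)
    (2 * (inner ℝ u u₂ + ‖u₁‖ ^ 2) / ‖u‖ ^ 2 - (2 * inner ℝ u u₁ / ‖u‖ ^ 2) ^ 2)
    (2 * (inner ℝ v v₂ + ‖v₁‖ ^ 2) / ‖v‖ ^ 2 - (2 * inner ℝ v v₁ / ‖v‖ ^ 2) ^ 2)

theorem hasDerivAt_vBell (p q : ℝ) {u : ℝ → E} {v : ℝ → E'} {u₁ : E} {v₁ : E'} {s : ℝ}
    (hu0 : u s ≠ 0) (hv0 : v s ≠ 0) (hu : HasDerivAt u u₁ s) (hv : HasDerivAt v v₁ s) :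
    HasDerivAt (fun t => vBell p q (u t) (v t)) (vBellD p q (u s) u₁ (v s) v₁) s :=
  hasDerivAt_bellman p q _ _ (by positivity) (by positivity) hu.norm_sq hv.norm_sq

theorem hasDerivAt_vBellD (p q : ℝ) {u u₁ : ℝ → E} {v v₁ : ℝ → E'} {u₂ : E} {v₂ : E'} {s : ℝ}
    (hu0 : u s ≠ 0) (hv0 : v s ≠ 0) (hu : HasDerivAt u (u₁ s) s) (hv : HasDerivAt v (v₁ s) s)
    (hu₁ : HasDerivAt u₁ u₂ s) (hv₁ : HasDerivAt v₁ v₂ s) :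
    HasDerivAt (fun t => vBellD p q (u t) (u₁ t) (v t) (v₁ t))
      (vBellDD p q (u s) (u₁ s) u₂ (v s) (v₁ s) v₂) s := by
  have h1 : HasDerivAt (fun t => 2 * inner ℝ (u t) (u₁ t))
      (2 * (inner ℝ (u s) u₂ + ‖u₁ s‖ ^ 2)) s := by
    rw [← real_inner_self_eq_norm_sq]
    exact (hu.inner ℝ hu₁).const_mul 2
  have h2 : HasDerivAt (fun t => 2 * inner ℝ (v t) (v₁ t))
      (2 * (inner ℝ (v s) v₂ + ‖v₁ s‖ ^ 2)) s := by
    rw [← real_inner_self_eq_norm_sq]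
    exact (hv.inner ℝ hv₁).const_mul 2
  exact hasDerivAt_bellmanD (a := fun t => ‖u t‖ ^ 2) (b := fun t => ‖v t‖ ^ 2)
    (a1 := fun t => 2 * inner ℝ (u t) (u₁ t)) (b1 := fun t => 2 * inner ℝ (v t) (v₁ t))
    p q _ _ (by positivity) (by positivity) hu.norm_sq hv.norm_sq h1 h2

theorem bellmanK_pos {q : ℝ} (hq : 1 < q) : 0 < bellmanK q := by
  have : 0 < q - 1 := by linarith
  unfold bellmanK; positivity

theorem bellmanE_pos (p : ℝ) : 0 < bellmanE p := by
  unfold bellmanE; positivity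

theorem bellmanE_le {p : ℝ} (hp : 2 ≤ p) : bellmanE p ≤ 1 / 8 := by
  unfold bellmanE
  gcongr
  exact Real.rpow_le_one_of_one_le_of_nonpos (by norm_num) (by linarith)

theorem abs_logDeriv_le {u u₁ : E} {U δ : ℝ} (hU2 : U ≤ 2 * ‖u‖) (hu0 : u ≠ 0)
    (hδ : 0 < δ) (h1 : ‖u₁‖ ≤ δ * U) : |2 * inner ℝ u u₁ / ‖u‖ ^ 2| ≤ 7 * δ := by
  have h0 : 0 < ‖u‖ := norm_pos_iff.2 hu0
  rw [abs_div, abs_mul, abs_two, abs_of_pos (by positivity : 0 < ‖u‖ ^ 2),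
    div_le_iff₀ (by positivity)]
  have e1 := abs_real_inner_le_norm u u₁
  have e2 : ‖u₁‖ ≤ δ * (2 * ‖u‖) := h1.trans (by gcongr)
  have e3 : ‖u‖ * ‖u₁‖ ≤ ‖u‖ * (δ * (2 * ‖u‖)) := by gcongr
  nlinarith [mul_pos hδ (pow_pos h0 2)]

theorem abs_logDeriv_deriv_le {u u₁ u₂ : E} {U δ : ℝ} (hU2 : U ≤ 2 * ‖u‖) (hu0 : u ≠ 0)
    (hδ : 0 < δ) (h1 : ‖u₁‖ ≤ δ * U) (h2 : ‖u₂‖ ≤ 6 * δ ^ 2 * U) :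
    |2 * (inner ℝ u u₂ + ‖u₁‖ ^ 2) / ‖u‖ ^ 2 - (2 * inner ℝ u u₁ / ‖u‖ ^ 2) ^ 2| ≤
      (7 * δ) ^ 2 := by
  have h0 : 0 < ‖u‖ := norm_pos_iff.2 hu0
  have e2 : ‖u₁‖ ≤ δ * (2 * ‖u‖) := h1.trans (by gcongr)
  have e2' : ‖u₂‖ ≤ 6 * δ ^ 2 * (2 * ‖u‖) := h2.trans (by gcongr)
  have e3 : |inner ℝ u u₂| ≤ ‖u‖ * (6 * δ ^ 2 * (2 * ‖u‖)) :=
    (abs_real_inner_le_norm u u₂).trans (by gcongr)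
  have e4 : ‖u₁‖ ^ 2 ≤ (δ * (2 * ‖u‖)) ^ 2 := by gcongr
  have e5 : |2 * (inner ℝ u u₂ + ‖u₁‖ ^ 2) / ‖u‖ ^ 2| ≤ 32 * δ ^ 2 := by
    rw [abs_div, abs_mul, abs_two, abs_of_pos (by positivity : 0 < ‖u‖ ^ 2),
      div_le_iff₀ (by positivity)]
    have := abs_add_le (inner ℝ u u₂) (‖u₁‖ ^ 2)
    rw [abs_of_nonneg (sq_nonneg ‖u₁‖)] at this
    nlinarith
  have e6 : (2 * inner ℝ u u₁ / ‖u‖ ^ 2) ^ 2 ≤ 16 * δ ^ 2 := by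
    have : |2 * inner ℝ u u₁ / ‖u‖ ^ 2| ≤ 4 * δ := by
      rw [abs_div, abs_mul, abs_two, abs_of_pos (by positivity : 0 < ‖u‖ ^ 2),
        div_le_iff₀ (by positivity)]
      have e1 := abs_real_inner_le_norm u u₁
      have e3 : ‖u‖ * ‖u₁‖ ≤ ‖u‖ * (δ * (2 * ‖u‖)) := by gcongr
      nlinarith
    rw [← sq_abs]
    calc _ ≤ (4 * δ) ^ 2 := by gcongr
      _ = _ := by ring
  have e7 := abs_sub (2 * (inner ℝ u u₂ + ‖u₁‖ ^ 2) / ‖u‖ ^ 2) ((2 * inner ℝ u u₁ / ‖u‖ ^ 2) ^ 2)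
  rw [abs_of_nonneg (a := (2 * inner ℝ u u₁ / ‖u‖ ^ 2) ^ 2) (sq_nonneg _)] at e7
  nlinarith [sq_nonneg δ]

variable {p q : ℝ} {u : E} {v : E'} {U V : ℝ}

theorem bellmanC_pos (hp : 2 ≤ p) (hq : 1 < q) : 0 < bellmanC p q := by
  have := bellmanK_pos hq
  unfold bellmanC; positivity

theorem norm_rpow_add_le (hp : 2 ≤ p) (hq : 1 < q) (hU : ‖u‖ ≤ U) (hV : ‖v‖ ≤ V) :
    (‖u‖ ^ 2) ^ (p / 2) + (‖v‖ ^ 2) ^ (q / 2) ≤ U ^ p + V ^ q := by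
  rw [norm_sq_rpow_half, norm_sq_rpow_half]
  gcongr

theorem abs_vBell_le (hp : 2 ≤ p) (hq : 1 < q) (hU : ‖u‖ ≤ U) (hV : ‖v‖ ≤ V) :
    |vBell p q u v| ≤ bellmanC p q * (U ^ p + V ^ q) := by
  have hK := bellmanK_pos hq
  have hE := bellmanE_pos p
  have hE1 := bellmanE_le hp
  have hθ := bellman_theta_mem u v q
  have hr : 0 ≤ (‖u‖ ^ 2) ^ (p / 2) := by positivity
  have hw : 0 ≤ (‖v‖ ^ 2) ^ (q / 2) := by positivity
  refine le_trans ?_ (mul_le_mul_of_nonneg_left (norm_rpow_add_le hp hq hU hV)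
    (bellmanC_pos hp hq).le)
  unfold vBell bellman bellmanC
  rw [abs_of_nonneg (by positivity)]
  have e1 : bellmanE p * ((‖v‖ ^ 2) ^ (q / 2) * (‖u‖ ^ 2 / (‖u‖ ^ 2 + (‖v‖ ^ 2) ^ (q - 1)))) ≤
      1 * ((‖v‖ ^ 2) ^ (q / 2) * 1) := by
    gcongr
    · linarith
    · exact hθ.2
  have e2 : 1 * (‖u‖ ^ 2) ^ (p / 2) ≤ (p ^ 2 + 4 * bellmanK q + 16) * (‖u‖ ^ 2) ^ (p / 2) :=
    mul_le_mul_of_nonneg_right (by nlinarith) hr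
  have e3 : (bellmanK q + 1) * (‖v‖ ^ 2) ^ (q / 2) ≤
      (p ^ 2 + 4 * bellmanK q + 16) * (‖v‖ ^ 2) ^ (q / 2) :=
    mul_le_mul_of_nonneg_right (by nlinarith) hw
  linarith

theorem abs_vBellD_le {u₁ : E} {v₁ : E'} {δ : ℝ} (hp : 2 ≤ p) (hq : 1 < q) (hq2 : q ≤ 2)
    (hu0 : u ≠ 0) (hv0 : v ≠ 0) (hU : ‖u‖ ≤ U) (hV : ‖v‖ ≤ V) (hU2 : U ≤ 2 * ‖u‖)
    (hV2 : V ≤ 2 * ‖v‖) (hδ : 0 < δ) (hu1 : ‖u₁‖ ≤ δ * U) (hv1 : ‖v₁‖ ≤ δ * V) :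
    |vBellD p q u u₁ v v₁| ≤ bellmanC p q * ((U ^ p + V ^ q) * (7 * δ)) := by
  have hθ := bellman_theta_mem u v q
  have h := abs_bellmanD_le (r := (‖u‖ ^ 2) ^ (p / 2)) (w := (‖v‖ ^ 2) ^ (q / 2)) hp hq hq2
    (bellmanK_pos hq).le (bellmanE_pos p).le ((bellmanE_le hp).trans (by norm_num)) (by positivity)
    (by positivity) hθ.1 hθ.2 (abs_logDeriv_le hU2 hu0 hδ hu1) (abs_logDeriv_le hV2 hv0 hδ hv1)
  refine h.trans (mul_le_mul_of_nonneg_left ?_ (bellmanC_pos hp hq).le)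
  exact mul_le_mul_of_nonneg_right (norm_rpow_add_le hp hq hU hV) (by positivity)

theorem abs_vBellDD_le {u₁ u₂ : E} {v₁ v₂ : E'} {δ : ℝ} (hp : 2 ≤ p) (hq : 1 < q) (hq2 : q ≤ 2)
    (hu0 : u ≠ 0) (hv0 : v ≠ 0) (hU : ‖u‖ ≤ U) (hV : ‖v‖ ≤ V) (hU2 : U ≤ 2 * ‖u‖)
    (hV2 : V ≤ 2 * ‖v‖) (hδ : 0 < δ) (hu1 : ‖u₁‖ ≤ δ * U) (hv1 : ‖v₁‖ ≤ δ * V)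
    (hu2 : ‖u₂‖ ≤ 6 * δ ^ 2 * U) (hv2 : ‖v₂‖ ≤ 6 * δ ^ 2 * V) :
    |vBellDD p q u u₁ u₂ v v₁ v₂| ≤ bellmanC p q * ((U ^ p + V ^ q) * (7 * δ) ^ 2) := by
  have hθ := bellman_theta_mem u v q
  have h := abs_bellmanDD_le (r := (‖u‖ ^ 2) ^ (p / 2)) (w := (‖v‖ ^ 2) ^ (q / 2)) hp hq hq2
    (bellmanK_pos hq).le (bellmanE_pos p).le ((bellmanE_le hp).trans (by norm_num)) (by positivity)
    (by positivity) hθ.1 hθ.2 (abs_logDeriv_le hU2 hu0 hδ hu1) (abs_logDeriv_le hV2 hv0 hδ hv1)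
    (abs_logDeriv_deriv_le hU2 hu0 hδ hu1 hu2) (abs_logDeriv_deriv_le hV2 hv0 hδ hv1 hv2)
  refine h.trans (mul_le_mul_of_nonneg_left ?_ (bellmanC_pos hp hq).le)
  exact mul_le_mul_of_nonneg_right (norm_rpow_add_le hp hq hU hV) (by positivity)

theorem vBellDD_lower_single (hp : 2 ≤ p) (hpq : p.HolderConjugate q)
    (hu0 : u ≠ 0) (hv0 : v ≠ 0) (u₁ u₂ : E) (v₁ v₂ : E') :
    bellmanE p / 2 * ((‖v‖ ^ 2) ^ (1 - q / 2) * ‖u₁‖ ^ 2) +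
      (‖v‖ ^ 2) ^ (q / 2 - 1) * ‖v₁‖ ^ 2 +
      bellmanD p q (bellmanK q) (bellmanE p) ((‖u‖ ^ 2) ^ (p / 2)) ((‖v‖ ^ 2) ^ (q / 2))
        (‖u‖ ^ 2 / (‖u‖ ^ 2 + (‖v‖ ^ 2) ^ (q - 1))) (2 * inner ℝ u u₂ / ‖u‖ ^ 2)
        (2 * inner ℝ v v₂ / ‖v‖ ^ 2) ≤ vBellDD p q u u₁ u₂ v v₁ v₂ := by
  have hq : 1 < q := hpq.symm.lt
  have hq2 : q ≤ 2 := by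
    have h1 := hpq.inv_add_inv_eq_one
    have h2 : p⁻¹ ≤ 2⁻¹ := inv_anti₀ (by norm_num) hp
    have h3 : (2 : ℝ)⁻¹ ≤ q⁻¹ := by linarith
    exact (inv_le_inv₀ (by norm_num) (by linarith)).1 h3
  have h0 : 0 < ‖u‖ := norm_pos_iff.2 hu0
  have h0' : 0 < ‖v‖ := norm_pos_iff.2 hv0
  obtain ⟨a, ha⟩ : ∃ a, a = ‖u‖ ^ 2 := ⟨_, rfl⟩
  obtain ⟨b, hb⟩ : ∃ b, b = ‖v‖ ^ 2 := ⟨_, rfl⟩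
  have ha0 : 0 < a := by rw [ha]; positivity
  have hb0 : 0 < b := by rw [hb]; positivity
  have hα : (2 * inner ℝ u u₁ / a) ^ 2 ≤ 4 * (‖u₁‖ / √a) ^ 2 := by
    rw [div_pow, div_pow, Real.sq_sqrt ha0.le, mul_pow, ← mul_div_assoc,
      div_le_div_iff₀ (by positivity) (by positivity)]
    have e1 : (inner ℝ u u₁) ^ 2 ≤ a * ‖u₁‖ ^ 2 := by
      rw [ha, ← mul_pow, ← sq_abs]
      gcongr
      exact abs_real_inner_le_norm u u₁
    nlinarith
  have hω : (2 * inner ℝ v v₁ / b) ^ 2 ≤ 4 * (‖v₁‖ / √b) ^ 2 := by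
    rw [div_pow, div_pow, Real.sq_sqrt hb0.le, mul_pow, ← mul_div_assoc,
      div_le_div_iff₀ (by positivity) (by positivity)]
    have e1 : (inner ℝ v v₁) ^ 2 ≤ b * ‖v₁‖ ^ 2 := by
      rw [hb, ← mul_pow, ← sq_abs]
      gcongr
      exact abs_real_inner_le_norm v v₁
    nlinarith
  have hbq : 0 < b ^ (q - 1) := Real.rpow_pos_of_pos hb0 _
  have key := bellmanDD_lower (p := p) (q := q) (K := bellmanK q) (ε := bellmanE p)
    (c := (7 : ℝ) ^ (-(p / 2 - 1))) (r := a ^ (p / 2)) (w := b ^ (q / 2)) (σ := a / b ^ (q - 1))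
    (θ := a / (a + b ^ (q - 1))) (α := 2 * inner ℝ u u₁ / a) (ω := 2 * inner ℝ v v₁ / b)
    (X := ‖u₁‖ / √a) (Y := ‖v₁‖ / √b) hp hq hq2 (by
      have : q - 1 ≠ 0 := by linarith
      rw [bellmanK, div_mul_cancel₀ _ this]) (by positivity)
    (Real.rpow_le_one_of_one_le_of_nonpos (by norm_num) (by linarith)) rfl (by positivity)
    (by positivity) (by positivity) (by field_simp; ring) (fun hs => ?_) hα hω
  · have e1 : b ^ (q / 2) * (a / b ^ (q - 1)) * (‖u₁‖ / √a) ^ 2 = b ^ (1 - q / 2) * ‖u₁‖ ^ 2 := by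
      rw [div_pow, Real.sq_sqrt ha0.le]
      have : b ^ (1 - q / 2) = b ^ (q / 2) / b ^ (q - 1) := by
        rw [← Real.rpow_sub hb0]; congr 1; ring
      rw [this]; field_simp
    have e2 : b ^ (q / 2) * (‖v₁‖ / √b) ^ 2 = b ^ (q / 2 - 1) * ‖v₁‖ ^ 2 := by
      rw [div_pow, Real.sq_sqrt hb0.le, Real.rpow_sub_one hb0.ne']; field_simp
    rw [mul_assoc (bellmanE p / 2), e1, e2, div_pow ‖u₁‖, div_pow ‖v₁‖,
      Real.sq_sqrt ha0.le, Real.sq_sqrt hb0.le] at key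
    unfold vBellDD
    rw [← ha, ← hb]
    have e3 : 2 * (inner ℝ u u₂ + ‖u₁‖ ^ 2) / a - (2 * inner ℝ u u₁ / a) ^ 2 =
        (2 * (‖u₁‖ ^ 2 / a) - (2 * inner ℝ u u₁ / a) ^ 2) + 2 * inner ℝ u u₂ / a := by ring
    have e4 : 2 * (inner ℝ v v₂ + ‖v₁‖ ^ 2) / b - (2 * inner ℝ v v₁ / b) ^ 2 =
        (2 * (‖v₁‖ ^ 2 / b) - (2 * inner ℝ v v₁ / b) ^ 2) + 2 * inner ℝ v v₂ / b := by ring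
    rw [e3, e4, bellmanDD_add]
    linarith
  · have e1 : a ^ (p / 2) =
        b ^ (q / 2) * (a / b ^ (q - 1)) * (a / b ^ (q - 1)) ^ (p / 2 - 1) := by
      rw [Real.rpow_sub_one (div_pos ha0 hbq).ne', Real.div_rpow ha0.le hbq.le, ← Real.rpow_mul hb0.le]
      have : (q - 1) * (p / 2) = q / 2 := by
        have := hpq.mul_eq_add
        linarith
      rw [this]
      field_simp
    rw [e1, mul_comm]
    gcongr
    rw [Real.rpow_neg (by norm_num), ← Real.inv_rpow (by norm_num)]
    have : 0 ≤ p / 2 - 1 := by linarith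
    gcongr
    linarith

theorem vBellDD_lower (hp : 2 ≤ p) (hpq : p.HolderConjugate q)
    (hu0 : u ≠ 0) (hv0 : v ≠ 0) (ux uy uxx : E) (vx vy vxx : E') :
    bellmanE p / 2 * ((‖ux‖ + ‖uy‖) * (‖vx‖ + ‖vy‖)) ≤
      vBellDD p q u ux uxx v vx vxx + vBellDD p q u uy (-uxx) v vy (-vxx) := by
  have h1 := vBellDD_lower_single hp hpq hu0 hv0 ux uxx vx vxx
  have h2 := vBellDD_lower_single hp hpq hu0 hv0 uy (-uxx) vy (-vxx)
  rw [inner_neg_right, inner_neg_right, mul_neg, mul_neg, neg_div, neg_div] at h2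
  have h3 := bellmanD_add_eq_zero p q (bellmanK q) (bellmanE p) ((‖u‖ ^ 2) ^ (p / 2))
    ((‖v‖ ^ 2) ^ (q / 2)) (‖u‖ ^ 2 / (‖u‖ ^ 2 + (‖v‖ ^ 2) ^ (q - 1))) (2 * inner ℝ u uxx / ‖u‖ ^ 2)
        (2 * inner ℝ v vxx / ‖v‖ ^ 2)
  have h0' : 0 < ‖v‖ := norm_pos_iff.2 hv0
  obtain ⟨m, hm⟩ : ∃ m, m = (‖v‖ ^ 2) ^ (1 - q / 2) := ⟨_, rfl⟩
  have hm0 : 0 < m := by rw [hm]; positivity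
  have hm' : (‖v‖ ^ 2) ^ (q / 2 - 1) = m⁻¹ := by
    rw [hm, ← Real.rpow_neg (by positivity)]; congr 1; ring
  rw [hm', ← hm] at h1 h2
  have hE := bellmanE_pos p
  have hE1 := bellmanE_le hp
  have hA : (‖ux‖ + ‖uy‖) ^ 2 ≤ 2 * (‖ux‖ ^ 2 + ‖uy‖ ^ 2) := by nlinarith [sq_nonneg (‖ux‖ - ‖uy‖)]
  have hB : (‖vx‖ + ‖vy‖) ^ 2 ≤ 2 * (‖vx‖ ^ 2 + ‖vy‖ ^ 2) := by nlinarith [sq_nonneg (‖vx‖ - ‖vy‖)]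
  have hAB : 2 * ((‖ux‖ + ‖uy‖) * (‖vx‖ + ‖vy‖)) ≤
      m * (‖ux‖ + ‖uy‖) ^ 2 + m⁻¹ * (‖vx‖ + ‖vy‖) ^ 2 := by
    have e : m * (‖ux‖ + ‖uy‖) ^ 2 + m⁻¹ * (‖vx‖ + ‖vy‖) ^ 2 -
        2 * ((‖ux‖ + ‖uy‖) * (‖vx‖ + ‖vy‖)) = m⁻¹ * (m * (‖ux‖ + ‖uy‖) - (‖vx‖ + ‖vy‖)) ^ 2 := by
      field_simp; ring
    have := mul_nonneg (inv_pos.2 hm0).le (sq_nonneg (m * (‖ux‖ + ‖uy‖) - (‖vx‖ + ‖vy‖)))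
    linarith
  have hmA := mul_le_mul_of_nonneg_left hA hm0.le
  have hmB := mul_le_mul_of_nonneg_left hB (inv_pos.2 hm0).le
  have hX : (‖ux‖ + ‖uy‖) * (‖vx‖ + ‖vy‖) ≤ m * (‖ux‖ ^ 2 + ‖uy‖ ^ 2) +
      m⁻¹ * (‖vx‖ ^ 2 + ‖vy‖ ^ 2) := by linarith
  have hE2 := mul_le_mul_of_nonneg_left hX (by linarith : 0 ≤ bellmanE p / 2)
  have hY : bellmanE p / 2 * (m⁻¹ * (‖vx‖ ^ 2 + ‖vy‖ ^ 2)) ≤ 1 * (m⁻¹ * (‖vx‖ ^ 2 + ‖vy‖ ^ 2)) := by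
    gcongr; linarith
  linarith

end VectorBellman

section Embedding

variable {E E' : Type*} [NormedAddCommGroup E] [InnerProductSpace ℝ E]
  [NormedAddCommGroup E'] [InnerProductSpace ℝ E']

theorem continuous_kernelExt {k : ℝ → ℝ → ℝ} {F : ℝ → E} {C y : ℝ} (hF : Integrable F)
    (hk : Continuous fun x => k x y) (hC : ∀ z, |k z y| ≤ C) :
    Continuous fun x => kernelExt k F x y := by
  refine continuous_of_dominated (bound := fun t => C * ‖F t‖) (fun x =>
    (integrable_kernel_smul hk.measurable hC hF x).aestronglyMeasurable)
    (fun x => ae_of_all _ fun t => ?_) (hF.norm.const_mul C) (ae_of_all _ fun t => ?_)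
  · rw [norm_smul]; exact mul_le_mul_of_nonneg_right (hC _) (norm_nonneg _)
  · exact (hk.comp (continuous_id.sub continuous_const)).smul continuous_const

theorem continuous_poissonKXX {y : ℝ} (hy : 0 < y) : Continuous fun s => poissonKXX s y := by
  unfold poissonKXX
  have : ∀ x : ℝ, (x ^ 2 + y ^ 2) ^ 3 ≠ 0 := fun x => by positivity
  fun_prop (disch := exact this _)

theorem continuous_poissonKY {y : ℝ} (hy : 0 < y) : Continuous fun s => poissonKY s y := by
  unfold poissonKY
  have : ∀ x : ℝ, (x ^ 2 + y ^ 2) ^ 2 ≠ 0 := fun x => by positivity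
  fun_prop (disch := exact this _)

theorem measurable_vBell (p q : ℝ) {u : ℝ → E} {v : ℝ → E'} (hu : Continuous u)
    (hv : Continuous v) : Measurable fun x => vBell p q (u x) (v x) := by
  have h1 : Measurable fun x => ‖u x‖ ^ 2 := (hu.norm.pow 2).measurable
  have h2 : Measurable fun x => ‖v x‖ ^ 2 := (hv.norm.pow 2).measurable
  unfold vBell bellman
  fun_prop

theorem measurable_vBellD (p q : ℝ) {u u₁ : ℝ → E} {v v₁ : ℝ → E'} (hu : Continuous u)
    (hv : Continuous v) (hu₁ : Continuous u₁) (hv₁ : Continuous v₁) :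
    Measurable fun x => vBellD p q (u x) (u₁ x) (v x) (v₁ x) := by
  have h1 : Measurable fun x => ‖u x‖ ^ 2 := (hu.norm.pow 2).measurable
  have h2 : Measurable fun x => ‖v x‖ ^ 2 := (hv.norm.pow 2).measurable
  have h3 : Measurable fun x => inner ℝ (u x) (u₁ x) := (hu.inner hu₁).measurable
  have h4 : Measurable fun x => inner ℝ (v x) (v₁ x) := (hv.inner hv₁).measurable
  unfold vBellD bellmanD
  fun_prop

theorem measurable_vBellDD (p q : ℝ) {u u₁ u₂ : ℝ → E} {v v₁ v₂ : ℝ → E'} (hu : Continuous u)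
    (hv : Continuous v) (hu₁ : Continuous u₁) (hv₁ : Continuous v₁) (hu₂ : Continuous u₂)
    (hv₂ : Continuous v₂) :
    Measurable fun x => vBellDD p q (u x) (u₁ x) (u₂ x) (v x) (v₁ x) (v₂ x) := by
  have h1 : Measurable fun x => ‖u x‖ ^ 2 := (hu.norm.pow 2).measurable
  have h2 : Measurable fun x => ‖v x‖ ^ 2 := (hv.norm.pow 2).measurable
  have h3 : Measurable fun x => inner ℝ (u x) (u₁ x) := (hu.inner hu₁).measurable
  have h4 : Measurable fun x => inner ℝ (v x) (v₁ x) := (hv.inner hv₁).measurable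
  have h5 : Measurable fun x => inner ℝ (u x) (u₂ x) := (hu.inner hu₂).measurable
  have h6 : Measurable fun x => inner ℝ (v x) (v₂ x) := (hv.inner hv₂).measurable
  have h7 : Measurable fun x => ‖u₁ x‖ ^ 2 := (hu₁.norm.pow 2).measurable
  have h8 : Measurable fun x => ‖v₁ x‖ ^ 2 := (hv₁.norm.pow 2).measurable
  unfold vBellDD bellmanDD
  fun_prop

/-- Functions `F, G` to which the Bellman function argument applies: they are integrable,
`‖F‖ ^ p` and `‖G‖ ^ q` are integrable, and there is no cancellation in the Poisson extensions. -/
structure BellmanPair (p q : ℝ) (F : ℝ → E) (G : ℝ → E') : Prop where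
  two_le : 2 ≤ p
  conj : p.HolderConjugate q
  intF : Integrable F
  intG : Integrable G
  powF : Integrable fun t => ‖F t‖ ^ p
  powG : Integrable fun t => ‖G t‖ ^ q
  neF : ¬ (fun t => ‖F t‖) =ᵐ[volume] 0
  neG : ¬ (fun t => ‖G t‖) =ᵐ[volume] 0
  cmpF : ∀ x y, 0 < y → kernelExt poissonK (fun t => ‖F t‖) x y ≤ 2 * ‖kernelExt poissonK F x y‖
  cmpG : ∀ x y, 0 < y → kernelExt poissonK (fun t => ‖G t‖) x y ≤ 2 * ‖kernelExt poissonK G x y‖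

/-- The dominating function `(P_y ‖F‖)^p + (P_y ‖G‖)^q`. -/
noncomputable def bellBd (p q : ℝ) (F : ℝ → E) (G : ℝ → E') (x y : ℝ) : ℝ :=
  kernelExt poissonK (fun t => ‖F t‖) x y ^ p + kernelExt poissonK (fun t => ‖G t‖) x y ^ q

/-- The Bellman function along the Poisson extensions. -/
noncomputable def bellW (p q : ℝ) (F : ℝ → E) (G : ℝ → E') (x y : ℝ) : ℝ :=
  vBell p q (kernelExt poissonK F x y) (kernelExt poissonK G x y)

/-- Directional first derivative of `bellW`. -/
noncomputable def bellWD (p q : ℝ) (k : ℝ → ℝ → ℝ) (F : ℝ → E) (G : ℝ → E') (x y : ℝ) : ℝ :=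
  vBellD p q (kernelExt poissonK F x y) (kernelExt k F x y)
    (kernelExt poissonK G x y) (kernelExt k G x y)

/-- Directional second derivative of `bellW`. -/
noncomputable def bellWDD (p q : ℝ) (k k' : ℝ → ℝ → ℝ) (F : ℝ → E) (G : ℝ → E') (x y : ℝ) : ℝ :=
  vBellDD p q (kernelExt poissonK F x y) (kernelExt k F x y) (kernelExt k' F x y)
    (kernelExt poissonK G x y) (kernelExt k G x y) (kernelExt k' G x y)

namespace BellmanPair

variable {p q : ℝ} {F : ℝ → E} {G : ℝ → E'} {x y : ℝ}

theorem one_lt (h : BellmanPair p q F G) : 1 < q := h.conj.symm.lt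

theorem le_two (h : BellmanPair p q F G) : q ≤ 2 := by
  have h1 := h.conj.inv_add_inv_eq_one
  have h2 : p⁻¹ ≤ 2⁻¹ := inv_anti₀ (by norm_num) h.two_le
  have h3 : (2 : ℝ)⁻¹ ≤ q⁻¹ := by linarith
  exact (inv_le_inv₀ (by norm_num) (by linarith [h.one_lt])).1 h3

theorem ne_zeroF (h : BellmanPair p q F G) (x : ℝ) (hy : 0 < y) :
    kernelExt poissonK F x y ≠ 0 := fun h0 => by
  have h1 := poisson_pos h.intF.norm (fun t => norm_nonneg _) h.neF x hy
  have h2 := h.cmpF x y hy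
  rw [h0, norm_zero] at h2
  linarith

theorem ne_zeroG (h : BellmanPair p q F G) (x : ℝ) (hy : 0 < y) :
    kernelExt poissonK G x y ≠ 0 := fun h0 => by
  have h1 := poisson_pos h.intG.norm (fun t => norm_nonneg _) h.neG x hy
  have h2 := h.cmpG x y hy
  rw [h0, norm_zero] at h2
  linarith

theorem norm_poisson_le {F : ℝ → E} (hF : Integrable F) (x : ℝ) (hy : 0 < y) :
    ‖kernelExt poissonK F x y‖ ≤ kernelExt poissonK (fun t => ‖F t‖) x y := by
  have := norm_kernelExt_le (x := x) (c := 1) hF hy fun z => by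
    rw [abs_of_pos (poissonK_pos z hy), one_mul]
  rwa [one_mul] at this

theorem abs_bellW_le (h : BellmanPair p q F G) (x : ℝ) (hy : 0 < y) :
    |bellW p q F G x y| ≤ bellmanC p q * bellBd p q F G x y :=
  abs_vBell_le h.two_le h.one_lt (norm_poisson_le h.intF x hy) (norm_poisson_le h.intG x hy)

theorem abs_bellWD_le (h : BellmanPair p q F G) {k : ℝ → ℝ → ℝ} (x : ℝ) (hy : 0 < y)
    (hk : ∀ z, |k z y| ≤ y⁻¹ * poissonK z y) :
    |bellWD p q k F G x y| ≤ bellmanC p q * (bellBd p q F G x y * (7 * y⁻¹)) :=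
  abs_vBellD_le h.two_le h.one_lt h.le_two (h.ne_zeroF x hy) (h.ne_zeroG x hy)
    (norm_poisson_le h.intF x hy) (norm_poisson_le h.intG x hy) (h.cmpF x y hy) (h.cmpG x y hy)
    (inv_pos.2 hy) (norm_kernelExt_le h.intF hy hk) (norm_kernelExt_le h.intG hy hk)

theorem abs_bellWDD_le (h : BellmanPair p q F G) {k k' : ℝ → ℝ → ℝ} (x : ℝ) (hy : 0 < y)
    (hk : ∀ z, |k z y| ≤ y⁻¹ * poissonK z y) (hk' : ∀ z, |k' z y| ≤ 6 * y⁻¹ ^ 2 * poissonK z y) :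
    |bellWDD p q k k' F G x y| ≤ bellmanC p q * (bellBd p q F G x y * (7 * y⁻¹) ^ 2) :=
  abs_vBellDD_le h.two_le h.one_lt h.le_two (h.ne_zeroF x hy) (h.ne_zeroG x hy)
    (norm_poisson_le h.intF x hy) (norm_poisson_le h.intG x hy) (h.cmpF x y hy) (h.cmpG x y hy)
    (inv_pos.2 hy) (norm_kernelExt_le h.intF hy hk) (norm_kernelExt_le h.intG hy hk)
    (norm_kernelExt_le h.intF hy hk') (norm_kernelExt_le h.intG hy hk')

theorem integrable_bellBd (h : BellmanPair p q F G) (hy : 0 < y) :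
    Integrable (fun x => bellBd p q F G x y) ∧
      ∫ x, bellBd p q F G x y ≤ (∫ t, ‖F t‖ ^ p) + ∫ t, ‖G t‖ ^ q := by
  have h1 := integrable_poisson_rpow (by linarith [h.two_le]) h.intF.norm
    (fun t => norm_nonneg _) h.powF hy
  have h2 := integrable_poisson_rpow h.one_lt.le h.intG.norm (fun t => norm_nonneg _) h.powG hy
  refine ⟨h1.1.add h2.1, ?_⟩
  unfold bellBd
  rw [integral_add h1.1 h2.1]
  exact add_le_add h1.2 h2.2

theorem bellBd_nonneg (F : ℝ → E) (G : ℝ → E') (x : ℝ) (hy : 0 < y) : 0 ≤ bellBd p q F G x y := by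
  have h1 := poisson_nonneg (φ := fun t => ‖F t‖) (fun t => norm_nonneg _) x hy
  have h2 := poisson_nonneg (φ := fun t => ‖G t‖) (fun t => norm_nonneg _) x hy
  unfold bellBd; positivity

theorem bellBd_harnack (h : BellmanPair p q F G) (x : ℝ) {y₀ : ℝ}
    (hy₀ : 0 < y₀) (h1 : y₀ / 2 < y) (h2 : y < 3 * y₀ / 2) :
    bellBd p q F G x y ≤ 6 ^ p * bellBd p q F G x y₀ := by
  have hy : 0 < y := by linarith
  have hp := h.two_le
  have hq := h.one_lt
  have hqp : q ≤ p := h.le_two.trans hp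
  have e1 := poisson_harnack h.intF.norm (fun t => norm_nonneg _) x hy₀ h1 h2
  have e2 := poisson_harnack h.intG.norm (fun t => norm_nonneg _) x hy₀ h1 h2
  have f1 := poisson_nonneg (φ := fun t => ‖F t‖) (fun t => norm_nonneg _) x hy
  have f2 := poisson_nonneg (φ := fun t => ‖G t‖) (fun t => norm_nonneg _) x hy
  have f3 := poisson_nonneg (φ := fun t => ‖F t‖) (fun t => norm_nonneg _) x hy₀
  have f4 := poisson_nonneg (φ := fun t => ‖G t‖) (fun t => norm_nonneg _) x hy₀
  have g1 := Real.rpow_le_rpow f1 e1 (by linarith : 0 ≤ p)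
  have g2 := Real.rpow_le_rpow f2 e2 (by linarith : 0 ≤ q)
  rw [Real.mul_rpow (by norm_num) f3] at g1
  rw [Real.mul_rpow (by norm_num) f4] at g2
  have g3 : (6 : ℝ) ^ q ≤ 6 ^ p := Real.rpow_le_rpow_of_exponent_le (by norm_num) hqp
  have g4 := mul_le_mul_of_nonneg_right g3 (Real.rpow_nonneg f4 q)
  unfold bellBd
  linarith

theorem abs_negXX_le (z : ℝ) (hy : 0 < y) :
    |-poissonKXX z y| ≤ 6 * y⁻¹ ^ 2 * poissonK z y := by
  rw [abs_neg]; exact abs_poissonKXX_le z hy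

theorem continuous_ext {F : ℝ → E} (hF : Integrable F) {k : ℝ → ℝ → ℝ} {c : ℝ} (hy : 0 < y)
    (hc : 0 ≤ c) (hk : ∀ z, |k z y| ≤ c * poissonK z y) (hk' : Continuous fun z => k z y) :
    Continuous fun x => kernelExt k F x y :=
  continuous_kernelExt (C := c * y⁻¹) hF hk' fun z =>
    (hk z).trans (mul_le_mul_of_nonneg_left (poissonK_le z hy) hc)

theorem kernelExt_neg (F : ℝ → E) (k : ℝ → ℝ → ℝ) (x y : ℝ) :
    kernelExt (fun x y => -k x y) F x y = -kernelExt k F x y := by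
  simp only [kernelExt, neg_smul, integral_neg]

theorem measurable_bellW (h : BellmanPair p q F G) (hy : 0 < y) :
    Measurable fun x => bellW p q F G x y :=
  measurable_vBell p q (continuous_poisson_x h.intF hy) (continuous_poisson_x h.intG hy)

theorem measurable_bellWD (h : BellmanPair p q F G) {k : ℝ → ℝ → ℝ} (hy : 0 < y)
    (hk : ∀ z, |k z y| ≤ y⁻¹ * poissonK z y) (hkc : Continuous fun z => k z y) :
    Measurable fun x => bellWD p q k F G x y :=
  measurable_vBellD p q (continuous_poisson_x h.intF hy) (continuous_poisson_x h.intG hy)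
    (continuous_ext h.intF hy (inv_pos.2 hy).le hk hkc)
    (continuous_ext h.intG hy (inv_pos.2 hy).le hk hkc)

theorem measurable_bellWDD (h : BellmanPair p q F G) {k k' : ℝ → ℝ → ℝ} (hy : 0 < y)
    (hk : ∀ z, |k z y| ≤ y⁻¹ * poissonK z y) (hkc : Continuous fun z => k z y)
    (hk' : ∀ z, |k' z y| ≤ 6 * y⁻¹ ^ 2 * poissonK z y) (hkc' : Continuous fun z => k' z y) :
    Measurable fun x => bellWDD p q k k' F G x y :=
  measurable_vBellDD p q (continuous_poisson_x h.intF hy) (continuous_poisson_x h.intG hy)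
    (continuous_ext h.intF hy (inv_pos.2 hy).le hk hkc)
    (continuous_ext h.intG hy (inv_pos.2 hy).le hk hkc)
    (continuous_ext h.intF hy (by positivity) hk' hkc')
    (continuous_ext h.intG hy (by positivity) hk' hkc')

theorem integrable_bellW (h : BellmanPair p q F G) (hy : 0 < y) :
    Integrable fun x => bellW p q F G x y :=
  ((h.integrable_bellBd hy).1.const_mul _).mono' (h.measurable_bellW hy).aestronglyMeasurable
    (ae_of_all _ fun x => h.abs_bellW_le x hy)

theorem integrable_bellWD (h : BellmanPair p q F G) {k : ℝ → ℝ → ℝ} (hy : 0 < y)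
    (hk : ∀ z, |k z y| ≤ y⁻¹ * poissonK z y) (hkc : Continuous fun z => k z y) :
    Integrable fun x => bellWD p q k F G x y :=
  (((h.integrable_bellBd hy).1.mul_const _).const_mul _).mono'
    (h.measurable_bellWD hy hk hkc).aestronglyMeasurable
    (ae_of_all _ fun x => h.abs_bellWD_le x hy hk)

theorem integrable_bellWDD (h : BellmanPair p q F G) {k k' : ℝ → ℝ → ℝ} (hy : 0 < y)
    (hk : ∀ z, |k z y| ≤ y⁻¹ * poissonK z y) (hkc : Continuous fun z => k z y)
    (hk' : ∀ z, |k' z y| ≤ 6 * y⁻¹ ^ 2 * poissonK z y) (hkc' : Continuous fun z => k' z y) :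
    Integrable fun x => bellWDD p q k k' F G x y :=
  (((h.integrable_bellBd hy).1.mul_const _).const_mul _).mono'
    (h.measurable_bellWDD hy hk hkc hk' hkc').aestronglyMeasurable
    (ae_of_all _ fun x => h.abs_bellWDD_le x hy hk hk')

theorem Ioo_mem_nhds (hy : 0 < y) : Set.Ioo (y / 2) (3 * y / 2) ∈ nhds y :=
  _root_.Ioo_mem_nhds (by linarith) (by linarith)

/-- `Φ(y) = ∫ W(u, v) dx` has derivative `∫ ∂_y W(u, v) dx`. -/
theorem hasDerivAt_integral_bellW (h : BellmanPair p q F G) (hy : 0 < y) :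
    HasDerivAt (fun s => ∫ x, bellW p q F G x s) (∫ x, bellWD p q poissonKY F G x y) y := by
  have hC := bellmanC_pos h.two_le h.one_lt
  refine (hasDerivAt_integral_of_dominated_loc_of_deriv_le (μ := volume)
    (F := fun s x => bellW p q F G x s) (F' := fun s x => bellWD p q poissonKY F G x s)
    (bound := fun x => bellmanC p q * ((6 ^ p * bellBd p q F G x y) * (7 * (y / 2)⁻¹)))
    (Ioo_mem_nhds hy)
    (Filter.eventually_of_mem (Ioo_mem_nhds hy) fun s hs =>
      (h.measurable_bellW (by linarith [hs.1])).aestronglyMeasurable)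
    (h.integrable_bellW hy)
    (h.measurable_bellWD hy (fun z => abs_poissonKY_le z hy)
      (continuous_poissonKY hy)).aestronglyMeasurable
    (ae_of_all _ fun x s hs => ?_)
    (((((h.integrable_bellBd hy).1.const_mul _).mul_const _).const_mul _))
    (ae_of_all _ fun x s hs => ?_)).2
  · have hs0 : 0 < s := by linarith [hs.1]
    refine (h.abs_bellWD_le x hs0 fun z => abs_poissonKY_le z hs0).trans ?_
    have e1 := h.bellBd_harnack x hy hs.1 hs.2
    have e2 : s⁻¹ ≤ (y / 2)⁻¹ := inv_anti₀ (by positivity) hs.1.le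
    have e3 := bellBd_nonneg (p := p) (q := q) F G x hs0
    gcongr
    exact e3.trans e1
  · have hs0 : 0 < s := by linarith [hs.1]
    exact hasDerivAt_vBell p q (h.ne_zeroF x hs0) (h.ne_zeroG x hs0)
      (poisson_hasDerivAt_y h.intF x hs0) (poisson_hasDerivAt_y h.intG x hs0)

theorem hasDerivAt_integral_bellWD (h : BellmanPair p q F G) (hy : 0 < y) :
    HasDerivAt (fun s => ∫ x, bellWD p q poissonKY F G x s)
      (∫ x, bellWDD p q poissonKY (fun x y => -poissonKXX x y) F G x y) y := by
  have hC := bellmanC_pos h.two_le h.one_lt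
  refine (hasDerivAt_integral_of_dominated_loc_of_deriv_le (μ := volume)
    (F := fun s x => bellWD p q poissonKY F G x s)
    (F' := fun s x => bellWDD p q poissonKY (fun x y => -poissonKXX x y) F G x s)
    (bound := fun x => bellmanC p q * ((6 ^ p * bellBd p q F G x y) * (7 * (y / 2)⁻¹) ^ 2))
    (Ioo_mem_nhds hy)
    (Filter.eventually_of_mem (Ioo_mem_nhds hy) fun s hs =>
      (h.measurable_bellWD (by linarith [hs.1]) (fun z => abs_poissonKY_le z (by linarith [hs.1]))
      (continuous_poissonKY (by linarith [hs.1]))).aestronglyMeasurable)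
    (h.integrable_bellWD hy (fun z => abs_poissonKY_le z hy) (continuous_poissonKY hy))
    (h.measurable_bellWDD hy (fun z => abs_poissonKY_le z hy) (continuous_poissonKY hy)
      (fun z => abs_negXX_le z hy) (continuous_poissonKXX hy).neg).aestronglyMeasurable
    (ae_of_all _ fun x s hs => ?_)
    (((((h.integrable_bellBd hy).1.const_mul _).mul_const _).const_mul _))
    (ae_of_all _ fun x s hs => ?_)).2
  · have hs0 : 0 < s := by linarith [hs.1]
    refine (h.abs_bellWDD_le x hs0 (fun z => abs_poissonKY_le z hs0)
      fun z => abs_negXX_le z hs0).trans ?_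
    have e1 := h.bellBd_harnack x hy hs.1 hs.2
    have e2 : s⁻¹ ≤ (y / 2)⁻¹ := inv_anti₀ (by positivity) hs.1.le
    have e3 := bellBd_nonneg (p := p) (q := q) F G x hs0
    gcongr
    exact e3.trans e1
  · have hs0 : 0 < s := by linarith [hs.1]
    unfold bellWDD
    rw [kernelExt_neg, kernelExt_neg]
    exact hasDerivAt_vBellD p q (u := fun s => kernelExt poissonK F x s)
      (v := fun s => kernelExt poissonK G x s) (u₁ := fun s => kernelExt poissonKY F x s)
      (v₁ := fun s => kernelExt poissonKY G x s) (h.ne_zeroF x hs0) (h.ne_zeroG x hs0)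
      (poisson_hasDerivAt_y h.intF x hs0) (poisson_hasDerivAt_y h.intG x hs0)
      (poisson_hasDerivAt_yy h.intF x hs0) (poisson_hasDerivAt_yy h.intG x hs0)

theorem integral_bellWDD_x (h : BellmanPair p q F G) (hy : 0 < y) :
    ∫ x, bellWDD p q poissonKX poissonKXX F G x y = 0 := by
  refine integral_eq_zero_of_hasDerivAt_of_integrable
    (f := fun x => bellWD p q poissonKX F G x y) (fun x => ?_)
    (h.integrable_bellWDD hy (fun z => abs_poissonKX_le z hy) (continuous_poissonKX hy)
      (fun z => abs_poissonKXX_le z hy) (continuous_poissonKXX hy))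
    (h.integrable_bellWD hy (fun z => abs_poissonKX_le z hy) (continuous_poissonKX hy))
  exact hasDerivAt_vBellD p q (u := fun s => kernelExt poissonK F s y)
    (v := fun s => kernelExt poissonK G s y) (u₁ := fun s => kernelExt poissonKX F s y)
    (v₁ := fun s => kernelExt poissonKX G s y) (h.ne_zeroF x hy) (h.ne_zeroG x hy)
    (poisson_hasDerivAt_x h.intF x hy) (poisson_hasDerivAt_x h.intG x hy)
    (poisson_hasDerivAt_xx h.intF x hy) (poisson_hasDerivAt_xx h.intG x hy)

end BellmanPair

/-- The sum of the norms of the partial derivatives of the Poisson extension. -/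
noncomputable def gradNorm (F : ℝ → E) (x y : ℝ) : ℝ :=
  ‖kernelExt poissonKX F x y‖ + ‖kernelExt poissonKY F x y‖

theorem gradNorm_nonneg (F : ℝ → E) (x y : ℝ) : 0 ≤ gradNorm F x y := by
  unfold gradNorm; positivity

namespace BellmanPair

variable {p q : ℝ} {F : ℝ → E} {G : ℝ → E'} {x y : ℝ}

theorem lintegral_grad_le (h : BellmanPair p q F G) (hy : 0 < y) :
    ENNReal.ofReal (bellmanE p / 2) *
        ∫⁻ x, ENNReal.ofReal (gradNorm F x y * gradNorm G x y) ≤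
      ENNReal.ofReal (∫ x, bellWDD p q poissonKY (fun x y => -poissonKXX x y) F G x y) := by
  have hE := bellmanE_pos p
  have ix := h.integrable_bellWDD hy (fun z => abs_poissonKX_le z hy) (continuous_poissonKX hy)
      (fun z => abs_poissonKXX_le z hy) (continuous_poissonKXX hy)
  have iy := h.integrable_bellWDD (k := poissonKY) (k' := fun x y => -poissonKXX x y) hy (fun z => abs_poissonKY_le z hy) (continuous_poissonKY hy)
      (fun z => abs_negXX_le z hy) (continuous_poissonKXX hy).neg
  have ixy : Integrable fun x => bellWDD p q poissonKX poissonKXX F G x y +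
      bellWDD p q poissonKY (fun x y => -poissonKXX x y) F G x y := ix.add iy
  have hle : ∀ x, bellmanE p / 2 * (gradNorm F x y * gradNorm G x y) ≤
      bellWDD p q poissonKX poissonKXX F G x y +
        bellWDD p q poissonKY (fun x y => -poissonKXX x y) F G x y := fun x => by
    unfold bellWDD
    rw [kernelExt_neg, kernelExt_neg]
    exact vBellDD_lower h.two_le h.conj (h.ne_zeroF x hy) (h.ne_zeroG x hy) _ _ _ _ _ _
  have h0 : ∀ x, 0 ≤ bellmanE p / 2 * (gradNorm F x y * gradNorm G x y) := fun x => by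
    have := gradNorm_nonneg F x y
    have := gradNorm_nonneg G x y
    positivity
  rw [← zero_add (∫ x, bellWDD p q poissonKY (fun x y => -poissonKXX x y) F G x y),
    ← h.integral_bellWDD_x hy, ← integral_add ix iy,
    ofReal_integral_eq_lintegral_ofReal ixy
      (ae_of_all _ fun x => (h0 x).trans (hle x)), ← lintegral_const_mul']
  · refine lintegral_mono fun x => ?_
    rw [← ENNReal.ofReal_mul (by positivity)]
    exact ENNReal.ofReal_le_ofReal (hle x)
  · exact ENNReal.ofReal_ne_top

theorem lintegral_Ioc_grad_le (h : BellmanPair p q F G) {a b : ℝ} (ha : 0 < a) (hab : a ≤ b) :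
    ENNReal.ofReal (bellmanE p / 2) * ∫⁻ y in Set.Ioc a b, ENNReal.ofReal y *
        ∫⁻ x, ENNReal.ofReal (gradNorm F x y * gradNorm G x y) ≤
      ENNReal.ofReal (16 * (bellmanC p q * ((∫ t, ‖F t‖ ^ p) + ∫ t, ‖G t‖ ^ q))) := by
  obtain ⟨M, hM⟩ : ∃ M, M = (∫ t, ‖F t‖ ^ p) + ∫ t, ‖G t‖ ^ q := ⟨_, rfl⟩
  obtain ⟨D, hD⟩ : ∃ D : ℝ → ℝ, D = fun y =>
    ∫ x, bellWDD p q poissonKY (fun x y => -poissonKXX x y) F G x y := ⟨_, rfl⟩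
  obtain ⟨Φ, hΦ⟩ : ∃ Φ : ℝ → ℝ, Φ = fun y => ∫ x, bellW p q F G x y := ⟨_, rfl⟩
  obtain ⟨Φ', hΦ'⟩ : ∃ Φ' : ℝ → ℝ, Φ' = fun y => ∫ x, bellWD p q poissonKY F G x y := ⟨_, rfl⟩
  have hC := bellmanC_pos h.two_le h.one_lt
  have hD0 : ∀ y, 0 < y → 0 ≤ D y := fun y hy => by
    have hE := bellmanE_pos p
    have ix := h.integrable_bellWDD hy (fun z => abs_poissonKX_le z hy) (continuous_poissonKX hy)
        (fun z => abs_poissonKXX_le z hy) (continuous_poissonKXX hy)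
    have iy := h.integrable_bellWDD (k := poissonKY) (k' := fun x y => -poissonKXX x y) hy (fun z => abs_poissonKY_le z hy) (continuous_poissonKY hy)
        (fun z => abs_negXX_le z hy) (continuous_poissonKXX hy).neg
    rw [hD]
    dsimp only
    have e := integral_add ix iy
    rw [h.integral_bellWDD_x hy, zero_add] at e
    rw [← e]
    refine integral_nonneg fun x => ?_
    have := gradNorm_nonneg F x y
    have := gradNorm_nonneg G x y
    refine le_trans (by positivity : 0 ≤ bellmanE p / 2 * (gradNorm F x y * gradNorm G x y)) ?_
    unfold bellWDD
    rw [kernelExt_neg, kernelExt_neg]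
    exact vBellDD_lower h.two_le h.conj (h.ne_zeroF x hy) (h.ne_zeroG x hy) _ _ _ _ _ _
  have hΨ : ∀ y, 0 < y → HasDerivAt (fun y => y * Φ' y - Φ y) (y * D y) y := fun y hy => by
    have h1 := h.hasDerivAt_integral_bellW hy
    have h2 := h.hasDerivAt_integral_bellWD hy
    have := ((hasDerivAt_id y).mul h2).sub h1
    rw [hΦ, hΦ', hD]
    refine this.congr_deriv ?_
    simp
  have hbd : ∀ y, 0 < y → |y * Φ' y - Φ y| ≤ 8 * (bellmanC p q * M) := fun y hy => by
    have e1 : |Φ y| ≤ bellmanC p q * M := by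
      rw [hΦ, hM]
      refine (norm_integral_le_of_norm_le (f := fun x => bellW p q F G x y)
        ((h.integrable_bellBd hy).1.const_mul _)
        (ae_of_all _ fun x => h.abs_bellW_le x hy)).trans ?_
      rw [integral_const_mul]
      gcongr
      exact (h.integrable_bellBd hy).2
    have e2 : |Φ' y| ≤ bellmanC p q * (M * (7 * y⁻¹)) := by
      rw [hΦ', hM]
      refine (norm_integral_le_of_norm_le (f := fun x => bellWD p q poissonKY F G x y)
        (((h.integrable_bellBd hy).1.mul_const _).const_mul _)
        (ae_of_all _ fun x => h.abs_bellWD_le x hy fun z => abs_poissonKY_le z hy)).trans ?_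
      rw [integral_const_mul, integral_mul_const]
      gcongr
      exact (h.integrable_bellBd hy).2
    have e3 : |y * Φ' y| ≤ 7 * (bellmanC p q * M) := by
      rw [abs_mul, abs_of_pos hy]
      calc y * |Φ' y| ≤ y * (bellmanC p q * (M * (7 * y⁻¹))) := by gcongr
        _ = _ := by field_simp
    have := abs_sub (y * Φ' y) (Φ y)
    linarith
  have hcont : ContinuousOn (fun y => y * Φ' y - Φ y) (Set.Icc a b) := fun y hy =>
    (hΨ y (ha.trans_le hy.1)).continuousAt.continuousWithinAt
  have hint : IntegrableOn (fun y => y * D y) (Set.Ioc a b) :=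
    intervalIntegral.integrableOn_deriv_of_nonneg hcont
      (fun y hy => hΨ y (ha.trans hy.1)) fun y hy =>
        mul_nonneg (ha.trans hy.1).le (hD0 y (ha.trans hy.1))
  have hftc : ∫ y in Set.Ioc a b, y * D y = (b * Φ' b - Φ b) - (a * Φ' a - Φ a) := by
    rw [← intervalIntegral.integral_of_le hab]
    exact intervalIntegral.integral_eq_sub_of_hasDerivAt_of_le hab hcont
      (fun y hy => hΨ y (ha.trans hy.1)) ((intervalIntegrable_iff_integrableOn_Ioc_of_le hab).2 hint)
  have h16 : (b * Φ' b - Φ b) - (a * Φ' a - Φ a) ≤ 16 * (bellmanC p q * M) := by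
    have := (abs_le.1 (hbd b (ha.trans_le hab))).2
    have := (abs_le.1 (hbd a ha)).1
    linarith
  rw [← lintegral_const_mul' _ _ ENNReal.ofReal_ne_top]
  calc ∫⁻ y in Set.Ioc a b, ENNReal.ofReal (bellmanE p / 2) * (ENNReal.ofReal y *
        ∫⁻ x, ENNReal.ofReal (gradNorm F x y * gradNorm G x y))
      ≤ ∫⁻ y in Set.Ioc a b, ENNReal.ofReal (y * D y) := by
        refine setLIntegral_mono' measurableSet_Ioc fun y hy => ?_
        have hy0 : 0 < y := ha.trans hy.1
        rw [ENNReal.ofReal_mul hy0.le, mul_left_comm, hD]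
        gcongr
        exact h.lintegral_grad_le hy0
    _ = ENNReal.ofReal (∫ y in Set.Ioc a b, y * D y) := by
        rw [ofReal_integral_eq_lintegral_ofReal hint]
        refine (ae_restrict_iff' measurableSet_Ioc).2 (ae_of_all _ fun y hy => ?_)
        exact mul_nonneg (ha.trans hy.1).le (hD0 y (ha.trans hy.1))
    _ ≤ _ := by
        rw [hftc, ← hM]
        exact ENNReal.ofReal_le_ofReal h16

theorem lintegral_Ioi_grad_le (h : BellmanPair p q F G) :
    ENNReal.ofReal (bellmanE p / 2) * ∫⁻ y in Set.Ioi (0 : ℝ), ENNReal.ofReal y *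
        ∫⁻ x, ENNReal.ofReal (gradNorm F x y * gradNorm G x y) ≤
      ENNReal.ofReal (16 * (bellmanC p q * ((∫ t, ‖F t‖ ^ p) + ∫ t, ‖G t‖ ^ q))) := by
  have hU : Set.Ioi (0 : ℝ) = ⋃ n : ℕ, Set.Ioc ((n : ℝ) + 1)⁻¹ (n + 1) := by
    ext y
    simp only [Set.mem_Ioi, Set.mem_iUnion, Set.mem_Ioc]
    refine ⟨fun hy => ?_, fun ⟨n, hn, _⟩ => lt_trans (by positivity) hn⟩
    obtain ⟨n, hn⟩ := exists_nat_gt (max y y⁻¹)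
    refine ⟨n, ?_, ?_⟩
    · have : y⁻¹ < n + 1 := ((le_max_right _ _).trans_lt hn).trans (by linarith)
      exact (inv_lt_comm₀ hy (by positivity)).1 this
    · linarith [(le_max_left y y⁻¹).trans_lt hn]
  have hmono : Monotone fun n : ℕ => Set.Ioc ((n : ℝ) + 1)⁻¹ (n + 1) := fun m n hmn => by
    have : (m : ℝ) ≤ n := by exact_mod_cast hmn
    exact Set.Ioc_subset_Ioc (by gcongr) (by gcongr)
  rw [hU, setLIntegral_iUnion_of_directed _ (Monotone.directed_le hmono), ENNReal.mul_iSup]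
  refine iSup_le fun n => h.lintegral_Ioc_grad_le (by positivity) ?_
  have : (0 : ℝ) ≤ n := by positivity
  exact (inv_le_one_of_one_le₀ (by linarith)).trans (by linarith)

end BellmanPair

end Embedding

section EmbeddingNormed

variable {E E' : Type*} [NormedAddCommGroup E] [InnerProductSpace ℝ E] [CompleteSpace E]
  [NormedAddCommGroup E'] [InnerProductSpace ℝ E'] [CompleteSpace E']

/-- The function `(F, ‖F‖)`, whose Poisson extension has no cancellation. -/
noncomputable def augment (F : ℝ → E) (t : ℝ) : WithLp 2 (E × ℝ) := WithLp.toLp 2 (F t, ‖F t‖)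

theorem norm_augment {E : Type*} [NormedAddCommGroup E]
    (F : ℝ → E) (t : ℝ) : ‖augment F t‖ = √2 * ‖F t‖ := by
  rw [WithLp.prod_norm_eq_of_L2]
  change √(‖F t‖ ^ 2 + ‖‖F t‖‖ ^ 2) = _
  rw [norm_norm, ← two_mul, Real.sqrt_mul (by norm_num), Real.sqrt_sq (norm_nonneg _)]

theorem integrable_augment {E : Type*} [NormedAddCommGroup E]
    {F : ℝ → E} (hF : Integrable F) : Integrable (augment F) := by
  refine (hF.norm.const_mul √2).mono' ?_ (ae_of_all _ fun t => (norm_augment F t).le)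
  exact (WithLp.prod_continuous_toLp 2 E ℝ).comp_aestronglyMeasurable
    (hF.1.prodMk hF.1.norm)

theorem kernelExt_augment_fst {F : ℝ → E} (hF : Integrable F) {k : ℝ → ℝ → ℝ} {C y : ℝ}
    (hk : Measurable fun z => k z y) (hC : ∀ z, |k z y| ≤ C) (x : ℝ) :
    (kernelExt k (augment F) x y).fst = kernelExt k F x y := by
  unfold kernelExt
  rw [← WithLp.fstL_apply 2 ℝ E ℝ, ← ContinuousLinearMap.integral_comp_comm]
  · rfl
  · exact integrable_kernel_smul hk hC (integrable_augment hF) x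

theorem kernelExt_augment_snd {F : ℝ → E} (hF : Integrable F) {k : ℝ → ℝ → ℝ} {C y : ℝ}
    (hk : Measurable fun z => k z y) (hC : ∀ z, |k z y| ≤ C) (x : ℝ) :
    (kernelExt k (augment F) x y).snd = kernelExt k (fun t => ‖F t‖) x y := by
  unfold kernelExt
  rw [← WithLp.sndL_apply 2 ℝ E ℝ, ← ContinuousLinearMap.integral_comp_comm]
  · rfl
  · exact integrable_kernel_smul hk hC (integrable_augment hF) x

theorem norm_fst_le_L2 {E : Type*} [NormedAddCommGroup E]
    (z : WithLp 2 (E × ℝ)) : ‖z.fst‖ ≤ ‖z‖ := by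
  rw [WithLp.prod_norm_eq_of_L2]
  exact Real.le_sqrt_of_sq_le (by nlinarith [sq_nonneg ‖z.snd‖])

theorem norm_snd_le_L2 {E : Type*} [NormedAddCommGroup E]
    (z : WithLp 2 (E × ℝ)) : ‖z.snd‖ ≤ ‖z‖ := by
  rw [WithLp.prod_norm_eq_of_L2]
  exact Real.le_sqrt_of_sq_le (by nlinarith [sq_nonneg ‖z.fst‖])

theorem gradNorm_le_augment {F : ℝ → E} (hF : Integrable F) (x : ℝ) {y : ℝ} (hy : 0 < y) :
    gradNorm F x y ≤ gradNorm (augment F) x y := by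
  have h1 : ∀ z, |poissonKX z y| ≤ y⁻¹ * y⁻¹ := fun z => (abs_poissonKX_le z hy).trans
    (mul_le_mul_of_nonneg_left (poissonK_le z hy) (by positivity))
  have h2 : ∀ z, |poissonKY z y| ≤ y⁻¹ * y⁻¹ := fun z => (abs_poissonKY_le z hy).trans
    (mul_le_mul_of_nonneg_left (poissonK_le z hy) (by positivity))
  unfold gradNorm
  rw [← kernelExt_augment_fst hF (continuous_poissonKX hy).measurable h1,
    ← kernelExt_augment_fst hF (continuous_poissonKY hy).measurable h2]
  exact add_le_add (norm_fst_le_L2 _) (norm_fst_le_L2 _)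

theorem poisson_norm_le_augment {F : ℝ → E} (hF : Integrable F) (x : ℝ) {y : ℝ} (hy : 0 < y) :
    kernelExt poissonK (fun t => ‖augment F t‖) x y ≤
      2 * ‖kernelExt poissonK (augment F) x y‖ := by
  have h1 : ∀ z, |poissonK z y| ≤ y⁻¹ := fun z => by
    rw [abs_of_pos (poissonK_pos z hy)]; exact poissonK_le z hy
  have h2 : kernelExt poissonK (fun t => ‖augment F t‖) x y =
      √2 * kernelExt poissonK (fun t => ‖F t‖) x y := by
    simp only [kernelExt, norm_augment, smul_eq_mul]
    rw [← integral_const_mul]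
    congr 1 with t
    ring
  have h3 := norm_snd_le_L2 (kernelExt poissonK (augment F) x y)
  rw [kernelExt_augment_snd hF (continuous_poissonK hy).measurable h1] at h3
  have h4 := (le_abs_self _).trans h3
  have h5 := poisson_nonneg (φ := fun t => ‖F t‖) (fun t => norm_nonneg _) x hy
  have h6 : √2 ≤ 2 := by rw [Real.sqrt_le_left (by norm_num)]; norm_num
  rw [h2]
  exact (mul_le_mul_of_nonneg_right h6 h5).trans (mul_le_mul_of_nonneg_left h4 (by norm_num))

theorem integral_norm_augment_rpow {E : Type*} [NormedAddCommGroup E]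
    (F : ℝ → E) (p : ℝ) :
    (fun t => ‖augment F t‖ ^ p) = fun t => √2 ^ p * ‖F t‖ ^ p := by
  ext t
  rw [norm_augment, Real.mul_rpow (by positivity) (norm_nonneg _)]

theorem bellmanPair_augment {F : ℝ → E} {G : ℝ → E'} {p q : ℝ} (hp : 2 ≤ p)
    (hpq : p.HolderConjugate q) (hF : Integrable F) (hG : Integrable G)
    (hFp : Integrable fun t => ‖F t‖ ^ p) (hGq : Integrable fun t => ‖G t‖ ^ q)
    (hF0 : ¬ F =ᵐ[volume] 0) (hG0 : ¬ G =ᵐ[volume] 0) :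
    BellmanPair p q (augment F) (augment G) where
  two_le := hp
  conj := hpq
  intF := integrable_augment hF
  intG := integrable_augment hG
  powF := by rw [integral_norm_augment_rpow]; exact hFp.const_mul _
  powG := by rw [integral_norm_augment_rpow]; exact hGq.const_mul _
  neF := fun h => hF0 <| by
    filter_upwards [h] with t ht
    simpa [norm_augment] using ht
  neG := fun h => hG0 <| by
    filter_upwards [h] with t ht
    simpa [norm_augment] using ht
  cmpF := fun x y hy => poisson_norm_le_augment hF x hy
  cmpG := fun x y hy => poisson_norm_le_augment hG x hy

/-- The iterated integral controlled by the bilinear embedding. -/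
noncomputable def gradForm (F : ℝ → E) (G : ℝ → E') : ENNReal :=
  ∫⁻ y in Set.Ioi (0 : ℝ), ENNReal.ofReal y *
    ∫⁻ x, ENNReal.ofReal (gradNorm F x y * gradNorm G x y)

theorem gradForm_comm {E : Type*} [NormedAddCommGroup E] [InnerProductSpace ℝ E]
    {E' : Type*} [NormedAddCommGroup E'] [InnerProductSpace ℝ E']
    (F : ℝ → E) (G : ℝ → E') : gradForm F G = gradForm G F := by
  simp only [gradForm, mul_comm (gradNorm F _ _)]

theorem gradNorm_const_smul {E : Type*} [NormedAddCommGroup E] [InnerProductSpace ℝ E]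
    (c : ℝ) (F : ℝ → E) (x y : ℝ) :
    gradNorm (fun t => c • F t) x y = |c| * gradNorm F x y := by
  simp only [gradNorm, kernelExt]
  simp_rw [smul_comm _ c (F _)]
  rw [integral_smul, integral_smul, norm_smul, norm_smul, Real.norm_eq_abs]
  ring

theorem gradForm_const_smul {E : Type*} [NormedAddCommGroup E] [InnerProductSpace ℝ E]
    {E' : Type*} [NormedAddCommGroup E'] [InnerProductSpace ℝ E']
    (c d : ℝ) (F : ℝ → E) (G : ℝ → E') :
    gradForm (fun t => c • F t) (fun t => d • G t) = ENNReal.ofReal (|c| * |d|) * gradForm F G := by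
  simp only [gradForm, gradNorm_const_smul]
  rw [← lintegral_const_mul' _ _ ENNReal.ofReal_ne_top]
  refine lintegral_congr fun y => ?_
  rw [mul_left_comm]
  congr 1
  rw [← lintegral_const_mul' _ _ ENNReal.ofReal_ne_top]
  refine lintegral_congr fun x => ?_
  rw [← ENNReal.ofReal_mul (by positivity)]
  congr 1
  ring

theorem gradForm_eq_zero {E : Type*} [NormedAddCommGroup E] [InnerProductSpace ℝ E]
    {E' : Type*} [NormedAddCommGroup E'] [InnerProductSpace ℝ E']
    {F : ℝ → E} (G : ℝ → E') (hF : F =ᵐ[volume] 0) : gradForm F G = 0 := by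
  have h : ∀ x y, gradNorm F x y = 0 := fun x y => by
    have h1 : ∀ k : ℝ → ℝ → ℝ, kernelExt k F x y = 0 := fun k => by
      refine integral_eq_zero_of_ae ?_
      filter_upwards [hF] with t ht
      simp [ht]
    simp [gradNorm, h1]
  simp [gradForm, h]

/-- Unnormalized constant in the bilinear embedding. -/
noncomputable def embC₀ (p q : ℝ) : ℝ :=
  2 / bellmanE p * (16 * (bellmanC p q * (√2 ^ p + √2 ^ q)))

theorem gradForm_le_of_normalized {F : ℝ → E} {G : ℝ → E'} {p q : ℝ} (hp : 2 ≤ p)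
    (hpq : p.HolderConjugate q) (hF : Integrable F) (hG : Integrable G)
    (hFp : Integrable fun t => ‖F t‖ ^ p) (hGq : Integrable fun t => ‖G t‖ ^ q)
    (hF1 : ∫ t, ‖F t‖ ^ p = 1) (hG1 : ∫ t, ‖G t‖ ^ q = 1) :
    gradForm F G ≤ ENNReal.ofReal (embC₀ p q) := by
  have hE := bellmanE_pos p
  have hF0 : ¬ F =ᵐ[volume] 0 := fun h => by
    have : ∫ t, ‖F t‖ ^ p = 0 := integral_eq_zero_of_ae <| by
      filter_upwards [h] with t ht
      simp [ht, Real.zero_rpow (by linarith : p ≠ 0)]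
    linarith
  have hG0 : ¬ G =ᵐ[volume] 0 := fun h => by
    have : ∫ t, ‖G t‖ ^ q = 0 := integral_eq_zero_of_ae <| by
      filter_upwards [h] with t ht
      simp [ht, Real.zero_rpow hpq.symm.ne_zero]
    linarith
  have h := (bellmanPair_augment hp hpq hF hG hFp hGq hF0 hG0).lintegral_Ioi_grad_le
  rw [integral_norm_augment_rpow, integral_norm_augment_rpow, integral_const_mul,
    integral_const_mul, hF1, hG1, mul_one, mul_one] at h
  have h2 : gradForm F G ≤ gradForm (augment F) (augment G) := by
    refine setLIntegral_mono' measurableSet_Ioi fun y hy => ?_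
    have h3 := fun x => gradNorm_le_augment hF x hy
    have h4 := fun x => gradNorm_le_augment hG x hy
    refine mul_le_mul_right (lintegral_mono fun x => ENNReal.ofReal_le_ofReal ?_) _
    exact mul_le_mul (h3 x) (h4 x) (gradNorm_nonneg _ _ _) (gradNorm_nonneg _ _ _)
  refine h2.trans ?_
  have h5 : gradForm (augment F) (augment G) = ENNReal.ofReal (2 / bellmanE p) *
      (ENNReal.ofReal (bellmanE p / 2) * gradForm (augment F) (augment G)) := by
    rw [← mul_assoc, ← ENNReal.ofReal_mul (by positivity)]
    rw [show 2 / bellmanE p * (bellmanE p / 2) = 1 by field_simp]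
    simp
  rw [h5, embC₀, ENNReal.ofReal_mul (by positivity)]
  gcongr
  exact h

theorem exists_normalization {E : Type*} [NormedAddCommGroup E] [InnerProductSpace ℝ E]
    {F : ℝ → E} {p : ℝ} (hp : 0 < p) (hF : MemLp F (ENNReal.ofReal p))
    (hF0 : ¬ F =ᵐ[volume] 0) :
    ∃ a : ℝ, 0 < a ∧ a * (eLpNorm F (ENNReal.ofReal p) volume).toReal = 1 ∧
      Integrable (fun t => ‖a • F t‖ ^ p) ∧ ∫ t, ‖a • F t‖ ^ p = 1 := by
  have hp0 : ENNReal.ofReal p ≠ 0 := by simpa using hp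
  have hpt : ENNReal.ofReal p ≠ ⊤ := ENNReal.ofReal_ne_top
  have hN : 0 < (eLpNorm F (ENNReal.ofReal p) volume).toReal := by
    refine ENNReal.toReal_pos (fun h => hF0 ?_) hF.2.ne
    exact (eLpNorm_eq_zero_iff hF.1 hp0).1 h
  refine ⟨(eLpNorm F (ENNReal.ofReal p) volume).toReal⁻¹, inv_pos.2 hN, inv_mul_cancel₀ hN.ne', ?_⟩
  have hi := hF.integrable_norm_rpow hp0 hpt
  have he := hF.eLpNorm_eq_integral_rpow_norm hp0 hpt
  rw [ENNReal.toReal_ofReal hp.le] at hi he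
  obtain ⟨I, hI⟩ : ∃ I, I = ∫ t, ‖F t‖ ^ p := ⟨_, rfl⟩
  have hI0 : 0 ≤ I := hI ▸ integral_nonneg fun t => by positivity
  obtain ⟨N, hNN⟩ : ∃ N, N = (eLpNorm F (ENNReal.ofReal p) volume).toReal := ⟨_, rfl⟩
  rw [← hNN] at hN ⊢
  have hNp : N ^ p = I := by
    rw [hNN, he, ← hI, ENNReal.toReal_ofReal (by positivity), ← Real.rpow_mul hI0,
      inv_mul_cancel₀ hp.ne', Real.rpow_one]
  have hfun : (fun t => ‖N⁻¹ • F t‖ ^ p) = fun t => I⁻¹ * ‖F t‖ ^ p := by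
    ext t
    rw [norm_smul, Real.norm_of_nonneg (by positivity), Real.mul_rpow (by positivity) (norm_nonneg _),
      Real.inv_rpow hN.le, hNp]
  have : 0 < I := by rw [← hNp]; positivity
  refine ⟨by rw [hfun]; exact hi.const_mul _, ?_⟩
  rw [hfun, integral_const_mul, ← hI, inv_mul_cancel₀ this.ne']

theorem gradForm_le_of_two_le {F : ℝ → E} {G : ℝ → E'} {p q : ℝ} (hp : 2 ≤ p)
    (hpq : p.HolderConjugate q) (hF : Integrable F) (hG : Integrable G)
    (hFp : MemLp F (ENNReal.ofReal p)) (hGq : MemLp G (ENNReal.ofReal q)) :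
    gradForm F G ≤ ENNReal.ofReal (embC₀ p q * (eLpNorm F (ENNReal.ofReal p) volume).toReal *
      (eLpNorm G (ENNReal.ofReal q) volume).toReal) := by
  by_cases hF0 : F =ᵐ[volume] 0
  · rw [gradForm_eq_zero G hF0]; exact zero_le
  by_cases hG0 : G =ᵐ[volume] 0
  · rw [gradForm_comm, gradForm_eq_zero F hG0]; exact zero_le
  obtain ⟨a, ha, haN, hai, ha1⟩ := exists_normalization (by linarith) hFp hF0
  obtain ⟨b, hb, hbN, hbi, hb1⟩ := exists_normalization hpq.symm.pos hGq hG0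
  have h := gradForm_le_of_normalized hp hpq (hF.smul a) (hG.smul b) hai hbi ha1 hb1
  have e : gradForm (fun t => a • F t) (fun t => b • G t) =
    ENNReal.ofReal (|a| * |b|) * gradForm F G := gradForm_const_smul a b F G
  have e' : gradForm (a • F) (b • G) = gradForm (fun t => a • F t) (fun t => b • G t) := rfl
  rw [e', e, abs_of_pos ha, abs_of_pos hb] at h
  have hMN : (eLpNorm F (ENNReal.ofReal p) volume).toReal *
      (eLpNorm G (ENNReal.ofReal q) volume).toReal = (a * b)⁻¹ := by
    rw [eq_inv_of_mul_eq_one_right haN, eq_inv_of_mul_eq_one_right hbN, mul_inv]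
  rw [mul_assoc, hMN]
  calc gradForm F G = ENNReal.ofReal (a * b)⁻¹ * (ENNReal.ofReal (a * b) * gradForm F G) := by
        rw [← mul_assoc, ← ENNReal.ofReal_mul (by positivity),
          inv_mul_cancel₀ (mul_pos ha hb).ne']
        simp
    _ ≤ ENNReal.ofReal (a * b)⁻¹ * ENNReal.ofReal (embC₀ p q) := by gcongr
    _ = _ := by rw [← ENNReal.ofReal_mul (by positivity), mul_comm]

/-- The constant in the bilinear embedding theorem. -/
noncomputable def embC (p q : ℝ) : ℝ := |embC₀ p q| + |embC₀ q p|

theorem embC_nonneg (p q : ℝ) : 0 ≤ embC p q := by unfold embC; positivity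

/-- The bilinear embedding theorem for gradients of Poisson extensions. -/
theorem gradForm_le {F : ℝ → E} {G : ℝ → E'} {p q : ℝ}
    (hpq : p.HolderConjugate q) (hF : Integrable F) (hG : Integrable G)
    (hFp : MemLp F (ENNReal.ofReal p)) (hGq : MemLp G (ENNReal.ofReal q)) :
    gradForm F G ≤ ENNReal.ofReal (embC p q * (eLpNorm F (ENNReal.ofReal p) volume).toReal *
      (eLpNorm G (ENNReal.ofReal q) volume).toReal) := by
  rcases le_total 2 p with hp | hp
  · refine (gradForm_le_of_two_le hp hpq hF hG hFp hGq).trans (ENNReal.ofReal_le_ofReal ?_)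
    gcongr
    unfold embC
    linarith [le_abs_self (embC₀ p q), abs_nonneg (embC₀ q p)]
  · have hq : 2 ≤ q := by
      have h1 := hpq.inv_add_inv_eq_one
      have h2 : (2 : ℝ)⁻¹ ≤ p⁻¹ := inv_anti₀ hpq.pos hp
      have h3 : q⁻¹ ≤ 2⁻¹ := by linarith
      exact (inv_le_inv₀ hpq.symm.pos (by norm_num)).1 h3
    rw [gradForm_comm]
    refine (gradForm_le_of_two_le hq hpq.symm hG hF hGq hFp).trans (ENNReal.ofReal_le_ofReal ?_)
    rw [mul_right_comm]
    gcongr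
    unfold embC
    linarith [le_abs_self (embC₀ q p), abs_nonneg (embC₀ p q)]

end EmbeddingNormed

/-- Complex valued square integrable functions on the line. -/
noncomputable abbrev L2R := Lp ℂ 2 (volume : Measure ℝ)

section FourierLink

variable {a : ℝ → ℂ}

theorem continuous_fourier_of_integrable (ha : Integrable a) : Continuous (𝓕 a) :=
  VectorFourier.fourierIntegral_continuous Real.continuous_fourierChar
    continuous_inner ha

theorem integral_fourier_mul_eq {f g : ℝ → ℂ} (hf : Integrable f) (hg : Integrable g) :
    ∫ ξ, 𝓕 f ξ * g ξ = ∫ x, f x * 𝓕 g x := by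
  have := VectorFourier.integral_fourierIntegral_smul_eq_flip (μ := volume) (ν := volume)
    (L := innerₗ ℝ) Real.continuous_fourierChar continuous_inner hf hg
  rw [flip_innerₗ] at this
  exact this

theorem integral_fourierInv_mul_eq {f g : ℝ → ℂ} (hf : Integrable f) (hg : Integrable g) :
    ∫ ξ, 𝓕⁻ f ξ * g ξ = ∫ x, f x * 𝓕⁻ g x := by
  have h1 : (𝓕⁻ f : ℝ → ℂ) = 𝓕 fun x => f (-x) := Real.fourierInv_eq_fourier_comp_neg f
  rw [h1, integral_fourier_mul_eq hf.comp_neg hg, ← integral_neg_eq_self]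
  simp only [neg_neg, Real.fourierInv_eq_fourier_neg]

theorem locallyIntegrable_L2R (A : L2R) : LocallyIntegrable A :=
  (Lp.memLp A).locallyIntegrable (by norm_num)

/-- The `L²` Fourier transform agrees with the Fourier integral on `L¹ ∩ L²`. -/
theorem fourier_toLp_ae_eq (ha : Integrable a) (ha2 : MemLp a 2) :
    ((𝓕 (ha2.toLp a) : L2R) : ℝ → ℂ) =ᵐ[volume] 𝓕 a := by
  refine ae_eq_of_integral_contDiff_smul_eq (locallyIntegrable_L2R _)
    (continuous_fourier_of_integrable ha).locallyIntegrable fun g g1 g2 => ?_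
  have h1 : HasCompactSupport fun x => (g x : ℂ) := g2.comp_left (g := Complex.ofReal) rfl
  have h2 : ContDiff ℝ ((⊤ : ℕ∞) : WithTop ℕ∞) fun x => (g x : ℂ) :=
    Complex.ofRealCLM.contDiff.comp g1
  have hψ : ∀ x, (h1.toSchwartzMap h2) x = (g x : ℂ) := fun x => rfl
  have e := congrArg (fun T => T (h1.toSchwartzMap h2))
    (Lp.fourier_toTemperedDistribution_eq (ha2.toLp a))
  simp only [TemperedDistribution.fourier_apply, Lp.toTemperedDistribution_apply,
    smul_eq_mul, hψ] at e
  simp only [Complex.real_smul]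
  rw [← e]
  have e2 := integral_fourier_mul_eq (h1.toSchwartzMap h2).integrable ha
  simp only [hψ] at e2
  rw [← e2]
  refine integral_congr_ae ?_
  filter_upwards [ha2.coeFn_toLp] with x hx
  rw [hx, SchwartzMap.fourier_coe]

theorem fourierInv_toLp_ae_eq (ha : Integrable a) (ha2 : MemLp a 2) :
    ((𝓕⁻ (ha2.toLp a) : L2R) : ℝ → ℂ) =ᵐ[volume] 𝓕⁻ a := by
  have hc : Continuous (𝓕⁻ a) := by
    have h1 : (𝓕⁻ a : ℝ → ℂ) = 𝓕 fun x => a (-x) := Real.fourierInv_eq_fourier_comp_neg a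
    rw [h1]
    exact continuous_fourier_of_integrable ha.comp_neg
  refine ae_eq_of_integral_contDiff_smul_eq (locallyIntegrable_L2R _)
    hc.locallyIntegrable fun g g1 g2 => ?_
  have h1 : HasCompactSupport fun x => (g x : ℂ) := g2.comp_left (g := Complex.ofReal) rfl
  have h2 : ContDiff ℝ ((⊤ : ℕ∞) : WithTop ℕ∞) fun x => (g x : ℂ) :=
    Complex.ofRealCLM.contDiff.comp g1
  have hψ : ∀ x, (h1.toSchwartzMap h2) x = (g x : ℂ) := fun x => rfl
  have e := congrArg (fun T => T (h1.toSchwartzMap h2))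
    (Lp.fourierInv_toTemperedDistribution_eq (ha2.toLp a))
  simp only [TemperedDistribution.fourierInv_apply, Lp.toTemperedDistribution_apply,
    smul_eq_mul, hψ] at e
  simp only [Complex.real_smul]
  rw [← e]
  have e2 := integral_fourierInv_mul_eq (h1.toSchwartzMap h2).integrable ha
  simp only [hψ] at e2
  rw [← e2]
  refine integral_congr_ae ?_
  filter_upwards [ha2.coeFn_toLp] with x hx
  rw [hx, SchwartzMap.fourierInv_coe]

theorem memLp_fourier (ha : Integrable a) (ha2 : MemLp a 2) : MemLp (𝓕 a) 2 :=
  (memLp_congr_ae (fourier_toLp_ae_eq ha ha2)).1 (Lp.memLp _)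

theorem memLp_fourierInv (ha : Integrable a) (ha2 : MemLp a 2) : MemLp (𝓕⁻ a) 2 :=
  (memLp_congr_ae (fourierInv_toLp_ae_eq ha ha2)).1 (Lp.memLp _)

/-- Plancherel for the inverse Fourier integral on `L¹ ∩ L²`. -/
theorem integral_fourierInv_mul_conj {b : ℝ → ℂ} (ha : Integrable a) (ha2 : MemLp a 2)
    (hb : Integrable b) (hb2 : MemLp b 2) :
    ∫ x, 𝓕⁻ a x * (starRingEnd ℂ) (𝓕⁻ b x) = ∫ ξ, a ξ * (starRingEnd ℂ) (b ξ) := by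
  have h : inner ℂ (𝓕⁻ (hb2.toLp b) : L2R) (𝓕⁻ (ha2.toLp a)) =
      inner ℂ (hb2.toLp b) (ha2.toLp a) := by
    rw [← Lp.inner_fourier_eq, fourier_fourierInv_eq, fourier_fourierInv_eq]
  rw [L2.inner_def, L2.inner_def] at h
  have e1 : ∫ x, 𝓕⁻ a x * (starRingEnd ℂ) (𝓕⁻ b x) =
      ∫ x, inner ℂ ((𝓕⁻ (hb2.toLp b) : L2R) x) ((𝓕⁻ (ha2.toLp a) : L2R) x) := by
    refine integral_congr_ae ?_
    filter_upwards [fourierInv_toLp_ae_eq ha ha2, fourierInv_toLp_ae_eq hb hb2] with x h1 h2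
    rw [h1, h2, RCLike.inner_apply]
  have e2 : ∫ x, a x * (starRingEnd ℂ) (b x) =
      ∫ x, inner ℂ (hb2.toLp b x) (ha2.toLp a x) := by
    refine integral_congr_ae ?_
    filter_upwards [ha2.coeFn_toLp, hb2.coeFn_toLp] with x h1 h2
    rw [h1, h2, RCLike.inner_apply]
  rw [e1, e2, h]

end FourierLink

section CauchySymbol

/-- The Fourier symbol of the holomorphic derivative of the Poisson extension. -/
noncomputable def cauchySym (y ξ : ℝ) : ℂ :=
  (Set.Ioi (0 : ℝ)).indicator (fun ξ : ℝ => 2 * π * Complex.I * ξ * Real.exp (-(2 * π * y * ξ))) ξ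

theorem measurable_cauchySym : Measurable fun z : ℝ × ℝ => cauchySym z.1 z.2 := by
  have : (fun z : ℝ × ℝ => cauchySym z.1 z.2) = (Prod.snd ⁻¹' Set.Ioi (0 : ℝ)).indicator
      fun z : ℝ × ℝ => 2 * π * Complex.I * z.2 * Real.exp (-(2 * π * z.1 * z.2)) := by
    ext z
    simp only [cauchySym, Set.indicator, Set.mem_preimage]
  rw [this]
  refine Measurable.indicator ?_ (measurable_snd measurableSet_Ioi)
  fun_prop

theorem norm_cauchySym_sq (y ξ : ℝ) : ‖cauchySym y ξ‖ ^ 2 = (Set.Ioi (0 : ℝ)).indicator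
    (fun ξ => 4 * π ^ 2 * ξ ^ 2 * Real.exp (-(4 * π * y * ξ))) ξ := by
  by_cases h : ξ ∈ Set.Ioi (0 : ℝ)
  · simp only [cauchySym, Set.indicator_of_mem h]
    rw [norm_mul, norm_mul, norm_mul, norm_mul, Complex.norm_I, Complex.norm_real,
      Complex.norm_real, Complex.norm_real, Real.norm_of_nonneg (Real.exp_pos _).le,
      Real.norm_eq_abs, Real.norm_eq_abs, Complex.norm_ofNat, mul_pow, mul_pow, mul_pow, mul_pow,
      sq_abs, sq_abs, ← Real.exp_nat_mul]
    push_cast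
    ring_nf
  · simp [cauchySym, Set.indicator_of_notMem h]

theorem integrableOn_pow_mul_exp {c : ℝ} (hc : 0 < c) (n : ℕ) :
    IntegrableOn (fun ξ : ℝ => ξ ^ n * Real.exp (-(c * ξ))) (Set.Ioi 0) := by
  have := integrableOn_rpow_mul_exp_neg_mul_rpow (s := n) (p := 1) (b := c)
    (by linarith [(Nat.cast_nonneg n : (0 : ℝ) ≤ n)]) one_pos hc
  refine this.congr_fun (fun x hx => ?_) measurableSet_Ioi
  simp

theorem integrable_cauchySym {y : ℝ} (hy : 0 < y) : Integrable (cauchySym y) := by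
  refine (integrable_indicator_iff measurableSet_Ioi).2 ?_
  have h := integrableOn_pow_mul_exp (c := 2 * π * y) (by positivity) 1
  have h2 : IntegrableOn (fun ξ : ℝ => (2 * π * Complex.I : ℂ) *
      ((ξ ^ 1 * Real.exp (-(2 * π * y * ξ)) : ℝ) : ℂ)) (Set.Ioi 0) := (h.ofReal).const_mul _
  refine h2.congr_fun (fun x hx => ?_) measurableSet_Ioi
  push_cast
  ring

theorem memLp_cauchySym {y : ℝ} (hy : 0 < y) : MemLp (cauchySym y) 2 := by
  refine (memLp_two_iff_integrable_sq_norm (integrable_cauchySym hy).1).2 ?_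
  simp only [norm_cauchySym_sq]
  refine (integrable_indicator_iff measurableSet_Ioi).2 ?_
  have h : IntegrableOn (fun x => 4 * π ^ 2 * (x ^ 2 * Real.exp (-(4 * π * y * x))))
      (Set.Ioi (0 : ℝ)) :=
    (integrableOn_pow_mul_exp (c := 4 * π * y) (by positivity) 2).const_mul (4 * π ^ 2)
  refine h.congr_fun (fun x hx => ?_) measurableSet_Ioi
  ring

theorem integral_mul_cexp_Ioi {r : ℂ} (hr : 0 < r.re) :
    ∫ t in Set.Ioi (0 : ℝ), (t : ℂ) * Complex.exp (-r * t) = (r ^ 2)⁻¹ := by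
  have hr0 : r ≠ 0 := fun h => by simp [h] at hr
  have hn : ∀ t : ℝ, ‖Complex.exp (-r * t)‖ = Real.exp (-(r.re * t)) := fun t => by
    rw [Complex.norm_exp]; simp
  have hd : ∀ t : ℝ, HasDerivAt (fun t : ℝ => -((t : ℂ) / r + (r ^ 2)⁻¹) * Complex.exp (-r * t))
      ((t : ℂ) * Complex.exp (-r * t)) t := fun t => by
    have h1 : HasDerivAt (fun t : ℝ => (t : ℂ)) 1 t := Complex.ofRealCLM.hasDerivAt
    have h2 := (((h1.div_const r).add_const (r ^ 2)⁻¹).neg).mul (h1.const_mul (-r)).cexp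
    refine h2.congr_deriv ?_
    simp only [Pi.neg_apply]
    field_simp
    ring
  have hint : IntegrableOn (fun t : ℝ => (t : ℂ) * Complex.exp (-r * t)) (Set.Ioi 0) := by
    refine (integrableOn_pow_mul_exp hr 1).mono' (by fun_prop) ?_
    refine (ae_restrict_iff' measurableSet_Ioi).2 (ae_of_all _ fun t ht => ?_)
    rw [norm_mul, hn, Complex.norm_real, Real.norm_of_nonneg (Set.mem_Ioi.1 ht).le, pow_one]
  have h0 : Filter.Tendsto (fun t : ℝ => Real.exp (-(r.re * t))) Filter.atTop (nhds 0) :=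
    Real.tendsto_exp_neg_atTop_nhds_zero.comp (Filter.tendsto_id.const_mul_atTop hr)
  have h1 : Filter.Tendsto (fun t : ℝ => t * Real.exp (-(r.re * t))) Filter.atTop (nhds 0) := by
    have := (Real.tendsto_pow_mul_exp_neg_atTop_nhds_zero 1).comp
      (Filter.tendsto_id.const_mul_atTop hr)
    have := this.const_mul (r.re)⁻¹
    simp only [Function.comp_def, pow_one, id, mul_zero] at this
    refine this.congr fun t => ?_
    field_simp
  have ht : Filter.Tendsto (fun t : ℝ => -((t : ℂ) / r + (r ^ 2)⁻¹) * Complex.exp (-r * t))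
      Filter.atTop (nhds 0) := by
    have h3 : Filter.Tendsto (fun t : ℝ => (t : ℂ) * Complex.exp (-r * t)) Filter.atTop
        (nhds 0) := by
      refine tendsto_zero_iff_norm_tendsto_zero.2 (h1.congr' ?_)
      filter_upwards [Filter.eventually_ge_atTop 0] with t ht
      rw [norm_mul, hn, Complex.norm_real, Real.norm_of_nonneg ht]
    have h4 : Filter.Tendsto (fun t : ℝ => Complex.exp (-r * t)) Filter.atTop (nhds 0) :=
      tendsto_zero_iff_norm_tendsto_zero.2 (h0.congr fun t => (hn t).symm)
    have := ((h3.const_mul r⁻¹).add (h4.const_mul (r ^ 2)⁻¹)).neg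
    simp only [mul_zero, add_zero, neg_zero] at this
    refine this.congr fun t => ?_
    field_simp
  rw [integral_Ioi_of_hasDerivAt_of_tendsto' (fun t _ => hd t) hint ht]
  simp

theorem fourierInv_cauchySym {y : ℝ} (hy : 0 < y) (x : ℝ) :
    𝓕⁻ (cauchySym y) x = 2⁻¹ * ((poissonKX x y : ℂ) - Complex.I * poissonKY x y) := by
  have hr : (0 : ℝ) < ((2 * π * (y - x * Complex.I) : ℂ)).re := by
    simp [hy, Real.pi_pos]
  have h := integral_mul_cexp_Ioi hr
  have e1 : 𝓕⁻ (cauchySym y) x = 2 * π * Complex.I * ∫ t in Set.Ioi (0 : ℝ),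
      (t : ℂ) * Complex.exp (-(2 * π * (y - x * Complex.I)) * t) := by
    rw [Real.fourierInv_eq', ← integral_const_mul, ← integral_indicator measurableSet_Ioi]
    congr 1 with t
    by_cases ht : t ∈ Set.Ioi (0 : ℝ)
    · simp only [cauchySym, Set.indicator_of_mem ht]
      rw [smul_eq_mul]
      rw [Complex.ofReal_exp]
      rw [show -(2 * (π : ℂ) * (y - x * Complex.I)) * t = ((2 * π * inner ℝ t x : ℝ) : ℂ) * Complex.I +
        ((-(2 * π * y * t) : ℝ) : ℂ) by
          simp only [RCLike.inner_apply, conj_trivial]; push_cast; ring, Complex.exp_add]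
      ring
    · simp [cauchySym, Set.indicator_of_notMem ht]
  rw [e1, h]
  have hz : (y - x * Complex.I : ℂ) ≠ 0 := fun h0 => by
    have := congrArg Complex.re h0
    simp at this
    exact hy.ne' this
  have hz' : (y + x * Complex.I : ℂ) ≠ 0 := fun h0 => by
    have := congrArg Complex.re h0
    simp at this
    exact hy.ne' this
  have hzz : (x : ℂ) ^ 2 + y ^ 2 = (y - x * Complex.I) * (y + x * Complex.I) := by
    ring_nf; rw [Complex.I_sq]; ring
  have hpi : (π : ℂ) ≠ 0 := by exact_mod_cast Real.pi_ne_zero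
  unfold poissonKX poissonKY
  push_cast
  rw [hzz]
  have hnum : (y + x * Complex.I : ℂ) ^ 2 = y ^ 2 - x ^ 2 + 2 * y * x * Complex.I := by
    ring_nf; rw [Complex.I_sq]; ring
  generalize hw : (y - x * Complex.I : ℂ) = w at *
  generalize hw' : (y + x * Complex.I : ℂ) = w' at *
  field_simp
  rw [hnum]
  linear_combination 2 * (x : ℂ) * y * Complex.I_sq

/-- The holomorphic derivative of the Poisson extension. -/
noncomputable def dzExt (f : ℝ → ℂ) (x y : ℝ) : ℂ :=
  2⁻¹ * (kernelExt poissonKX f x y - Complex.I * kernelExt poissonKY f x y)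

theorem abs_poissonKX_le' {y : ℝ} (hy : 0 < y) (z : ℝ) : |poissonKX z y| ≤ y⁻¹ * y⁻¹ :=
  (abs_poissonKX_le z hy).trans (mul_le_mul_of_nonneg_left (poissonK_le z hy) (by positivity))

theorem abs_poissonKY_le' {y : ℝ} (hy : 0 < y) (z : ℝ) : |poissonKY z y| ≤ y⁻¹ * y⁻¹ :=
  (abs_poissonKY_le z hy).trans (mul_le_mul_of_nonneg_left (poissonK_le z hy) (by positivity))

theorem fourierInv_comp_sub_left (f : ℝ → ℂ) (x ξ : ℝ) :
    𝓕⁻ (fun s => f (x - s)) ξ = Complex.exp (((2 * π * (ξ * x) : ℝ) : ℂ) * Complex.I) * 𝓕 f ξ := by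
  rw [Real.fourierInv_eq', Real.fourier_eq', ← integral_const_mul,
    ← integral_sub_left_eq_self _ volume x]
  congr 1 with t
  simp only [RCLike.inner_apply, conj_trivial, smul_eq_mul, sub_sub_cancel]
  rw [← mul_assoc (Complex.exp _) (Complex.exp _), ← Complex.exp_add]
  congr 2
  push_cast
  ring

theorem dzExt_eq {f : ℝ → ℂ} (hf : Integrable f) {y : ℝ} (hy : 0 < y) (x : ℝ) :
    dzExt f x y = 𝓕⁻ (fun ξ => cauchySym y ξ * 𝓕 f ξ) x := by
  have iX := integrable_kernel_smul (continuous_poissonKX hy).measurable (abs_poissonKX_le' hy) hf x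
  have iY := integrable_kernel_smul (continuous_poissonKY hy).measurable (abs_poissonKY_le' hy) hf x
  have e1 : dzExt f x y = ∫ t, 𝓕⁻ (cauchySym y) (x - t) * f t := by
    unfold dzExt kernelExt
    rw [← integral_const_mul, ← integral_sub iX (iY.const_mul _), ← integral_const_mul]
    congr 1 with t
    rw [fourierInv_cauchySym hy, Complex.real_smul, Complex.real_smul]
    ring
  have e2 : ∫ t, 𝓕⁻ (cauchySym y) (x - t) * f t = ∫ s, 𝓕⁻ (cauchySym y) s * f (x - s) := by
    rw [← integral_sub_left_eq_self _ volume x]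
    simp only [sub_sub_cancel]
  rw [e1, e2, integral_fourierInv_mul_eq (integrable_cauchySym hy) (hf.comp_sub_left x),
    Real.fourierInv_eq']
  congr 1 with ξ
  rw [fourierInv_comp_sub_left]
  simp only [RCLike.inner_apply, conj_trivial, smul_eq_mul]
  rw [mul_comm x ξ]
  ring

theorem norm_fourier_le (f : ℝ → ℂ) (ξ : ℝ) : ‖𝓕 f ξ‖ ≤ ∫ x, ‖f x‖ :=
  VectorFourier.norm_fourierIntegral_le_integral_norm _ _ _ _ _

theorem integrable_cauchySym_mul {f : ℝ → ℂ} (hf : Integrable f) {y : ℝ} (hy : 0 < y) :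
    Integrable fun ξ => cauchySym y ξ * 𝓕 f ξ :=
  (integrable_cauchySym hy).mul_bdd (c := ∫ x, ‖f x‖)
    (continuous_fourier_of_integrable hf).aestronglyMeasurable
    (ae_of_all _ (norm_fourier_le f))

theorem memLp_cauchySym_mul {f : ℝ → ℂ} (hf : Integrable f) {y : ℝ} (hy : 0 < y) :
    MemLp (fun ξ => cauchySym y ξ * 𝓕 f ξ) 2 := by
  refine ((memLp_cauchySym hy).norm.mul_const (∫ x, ‖f x‖)).mono
    (integrable_cauchySym_mul hf hy).1 (ae_of_all _ fun ξ => ?_)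
  rw [norm_mul, norm_mul, norm_norm]
  exact mul_le_mul_of_nonneg_left ((norm_fourier_le f ξ).trans (le_abs_self _)) (norm_nonneg _)

theorem memLp_dzExt {f : ℝ → ℂ} (hf : Integrable f) {y : ℝ} (hy : 0 < y) :
    MemLp (fun x => dzExt f x y) 2 := by
  simp only [dzExt_eq hf hy]
  exact memLp_fourierInv (integrable_cauchySym_mul hf hy) (memLp_cauchySym_mul hf hy)

theorem integrable_mul_conj {a b : ℝ → ℂ} (ha : MemLp a 2) (hb : MemLp b 2) :
    Integrable fun x => a x * (starRingEnd ℂ) (b x) :=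
  ha.integrable_mul hb.star

theorem integral_dzExt_mul_conj {f g : ℝ → ℂ} (hf : Integrable f) (hg : Integrable g)
    {y : ℝ} (hy : 0 < y) :
    ∫ x, dzExt f x y * (starRingEnd ℂ) (dzExt g x y) =
      ∫ ξ, ((‖cauchySym y ξ‖ ^ 2 : ℝ) : ℂ) * (𝓕 f ξ * (starRingEnd ℂ) (𝓕 g ξ)) := by
  simp only [dzExt_eq hf hy, dzExt_eq hg hy]
  rw [integral_fourierInv_mul_conj (integrable_cauchySym_mul hf hy) (memLp_cauchySym_mul hf hy)
    (integrable_cauchySym_mul hg hy) (memLp_cauchySym_mul hg hy)]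
  congr 1 with ξ
  rw [map_mul, mul_mul_mul_comm, Complex.mul_conj, Complex.normSq_eq_norm_sq]

end CauchySymbol

section FormBound

variable {ι κ : Type} [Fintype ι] [Fintype κ]

/-- A finite family of functions, seen as one vector valued function. -/
noncomputable def vecFun (f : ι → ℝ → ℂ) (x : ℝ) : EuclideanSpace ℂ ι := WithLp.toLp 2 fun i => f i x

theorem vecFun_apply {ι : Type}
    (f : ι → ℝ → ℂ) (x : ℝ) (i : ι) : vecFun f x i = f i x := rfl

theorem integrable_vecFun {f : ι → ℝ → ℂ} (hf : ∀ i, Integrable (f i)) : Integrable (vecFun f) := by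
  have h : Integrable fun x i => f i x := Integrable.of_eval hf
  exact (PiLp.continuousLinearEquiv 2 ℂ (fun _ : ι => ℂ)).symm.toContinuousLinearMap.integrable_comp h

theorem kernelExt_vecFun {k : ℝ → ℝ → ℝ} {f : ι → ℝ → ℂ} (hf : ∀ i, Integrable (f i)) {y C : ℝ}
    (hk : Continuous fun x => k x y) (hC : ∀ z, |k z y| ≤ C) (x : ℝ) (i : ι) :
    kernelExt k (vecFun f) x y i = kernelExt k (f i) x y := by
  have h := (EuclideanSpace.proj (𝕜 := ℂ) i).integral_comp_comm
    (integrable_kernel_smul hk.measurable hC (integrable_vecFun hf) x)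
  exact h.symm

theorem norm_dzExt_vec_le {f : ι → ℝ → ℂ} (hf : ∀ i, Integrable (f i)) (x : ℝ) {y : ℝ}
    (hy : 0 < y) :
    ‖(WithLp.toLp 2 fun i => dzExt (f i) x y : EuclideanSpace ℂ ι)‖ ≤ gradNorm (vecFun f) x y := by
  have e : (WithLp.toLp 2 fun i => dzExt (f i) x y : EuclideanSpace ℂ ι) =
      (2⁻¹ : ℂ) • (kernelExt poissonKX (vecFun f) x y -
        Complex.I • kernelExt poissonKY (vecFun f) x y) := by
    ext i
    simp only [PiLp.smul_apply, PiLp.sub_apply, smul_eq_mul,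
      kernelExt_vecFun hf (continuous_poissonKX hy) (abs_poissonKX_le' hy),
      kernelExt_vecFun hf (continuous_poissonKY hy) (abs_poissonKY_le' hy)]
    rfl
  rw [e, norm_smul]
  have h := norm_sub_le (kernelExt poissonKX (vecFun f) x y)
    (Complex.I • kernelExt poissonKY (vecFun f) x y)
  rw [norm_smul, Complex.norm_I, one_mul] at h
  rw [norm_inv, Complex.norm_ofNat]
  have h0 := gradNorm_nonneg (vecFun f) x y
  unfold gradNorm at *
  linarith

/-- The Fourier symbol obtained by averaging squared Cauchy symbols against `y M(y) dy`. -/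
noncomputable def laplaceSym (M : ℝ → ℝ) (ξ : ℝ) : ℝ :=
  ∫ y in Set.Ioi (0 : ℝ), y * M y * ‖cauchySym y ξ‖ ^ 2

theorem integral_mul_exp_Ioi {c : ℝ} (hc : 0 < c) (n : ℕ) :
    ∫ y in Set.Ioi (0 : ℝ), y ^ n * Real.exp (-(c * y)) = n.factorial / c ^ (n + 1) := by
  have := integral_rpow_mul_exp_neg_mul_Ioi (a := n + 1) (by positivity) hc
  rw [Real.Gamma_nat_eq_factorial] at this
  simp only [add_sub_cancel_right, Real.rpow_natCast] at this
  rw [this, show (n : ℝ) + 1 = ((n + 1 : ℕ) : ℝ) by push_cast; rfl, Real.rpow_natCast]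
  rw [one_div, inv_pow]
  field_simp

theorem integrableOn_mul_cauchySym_sq (ξ : ℝ) :
    IntegrableOn (fun y => y * ‖cauchySym y ξ‖ ^ 2) (Set.Ioi 0) := by
  simp only [norm_cauchySym_sq]
  by_cases h : ξ ∈ Set.Ioi (0 : ℝ)
  · simp only [Set.indicator_of_mem h]
    have h1 : IntegrableOn (fun y => 4 * π ^ 2 * ξ ^ 2 * (y ^ 1 * Real.exp (-((4 * π * ξ) * y))))
        (Set.Ioi (0 : ℝ)) :=
      (integrableOn_pow_mul_exp (mul_pos (by positivity) h) 1).const_mul _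
    refine h1.congr_fun (fun y _ => ?_) measurableSet_Ioi
    simp only
    rw [show 4 * π * ξ * y = 4 * π * y * ξ by ring]
    ring
  · simp [Set.indicator_of_notMem h]

theorem integral_mul_cauchySym_sq (ξ : ℝ) :
    ∫ y in Set.Ioi (0 : ℝ), y * ‖cauchySym y ξ‖ ^ 2 = (Set.Ioi (0 : ℝ)).indicator (fun _ => 1 / 4) ξ := by
  simp only [norm_cauchySym_sq]
  by_cases h : ξ ∈ Set.Ioi (0 : ℝ)
  · simp only [Set.indicator_of_mem h]
    have h2 : (0 : ℝ) < ξ := h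
    have h1 := integral_mul_exp_Ioi (c := 4 * π * ξ) (mul_pos (by positivity) h) 1
    have h3 : ∀ y : ℝ, y * (4 * π ^ 2 * ξ ^ 2 * Real.exp (-(4 * π * y * ξ))) =
        4 * π ^ 2 * ξ ^ 2 * (y ^ 1 * Real.exp (-((4 * π * ξ) * y))) := fun y => by
      rw [show 4 * π * ξ * y = 4 * π * y * ξ by ring]
      ring
    simp only [h3]
    rw [integral_const_mul, h1]
    simp only [Nat.factorial_one, Nat.cast_one]
    field_simp
    norm_num
    ring
  · simp [Set.indicator_of_notMem h]

theorem memLp_fourier_mul_conj {f g : ℝ → ℂ} (hf : Integrable f) (hf2 : MemLp f 2)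
    (hg : Integrable g) (hg2 : MemLp g 2) :
    Integrable fun ξ => 𝓕 f ξ * (starRingEnd ℂ) (𝓕 g ξ) :=
  integrable_mul_conj (memLp_fourier hf hf2) (memLp_fourier hg hg2)

theorem integrable_laplace_kernel {a : ℝ → ℂ} (ha : Integrable a) {M : ℝ → ℝ} (hM : Measurable M)
    {D : ℝ} (hD : ∀ y, |M y| ≤ D) :
    Integrable (Function.uncurry fun y ξ : ℝ => ((y * M y * ‖cauchySym y ξ‖ ^ 2 : ℝ) : ℂ) * a ξ)
      ((volume.restrict (Set.Ioi 0)).prod volume) := by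
  have hm : AEStronglyMeasurable
      (Function.uncurry fun y ξ : ℝ => ((y * M y * ‖cauchySym y ξ‖ ^ 2 : ℝ) : ℂ) * a ξ)
      ((volume.restrict (Set.Ioi 0)).prod volume) := by
    refine AEStronglyMeasurable.mul ?_ (ha.1.comp_snd)
    refine Measurable.aestronglyMeasurable ?_
    exact Complex.measurable_ofReal.comp ((measurable_fst.mul (hM.comp measurable_fst)).mul
      (measurable_cauchySym.norm.pow_const 2))
  have hD0 : 0 ≤ D := (abs_nonneg _).trans (hD 0)
  have hb : ∀ ξ, ∀ y ∈ Set.Ioi (0 : ℝ), ‖((y * M y * ‖cauchySym y ξ‖ ^ 2 : ℝ) : ℂ) * a ξ‖ ≤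
      D * ‖a ξ‖ * (y * ‖cauchySym y ξ‖ ^ 2) := fun ξ y hy => by
    have hy0 : (0 : ℝ) < y := hy
    rw [norm_mul, Complex.norm_real, Real.norm_eq_abs, abs_mul, abs_mul, abs_of_pos hy0,
      abs_of_nonneg (sq_nonneg ‖cauchySym y ξ‖)]
    calc y * |M y| * ‖cauchySym y ξ‖ ^ 2 * ‖a ξ‖ ≤ y * D * ‖cauchySym y ξ‖ ^ 2 * ‖a ξ‖ := by
          gcongr; exact hD y
      _ = _ := by ring
  have hsec : ∀ ξ, IntegrableOn
      (fun y => ((y * M y * ‖cauchySym y ξ‖ ^ 2 : ℝ) : ℂ) * a ξ) (Set.Ioi 0) := fun ξ => by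
    refine ((integrableOn_mul_cauchySym_sq ξ).const_mul (D * ‖a ξ‖)).mono' ?_
      ((ae_restrict_iff' measurableSet_Ioi).2 (ae_of_all _ (hb ξ)))
    refine Measurable.aestronglyMeasurable (Measurable.mul_const ?_ _)
    exact Complex.measurable_ofReal.comp ((measurable_id.mul hM).mul
      ((measurable_cauchySym.comp (measurable_id.prodMk measurable_const)).norm.pow_const 2))
  refine (integrable_prod_iff' hm).2 ⟨ae_of_all _ hsec, ?_⟩
  refine (ha.norm.const_mul D).mono' hm.norm.prod_swap.integral_prod_right' (ae_of_all _ fun ξ => ?_)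
  rw [Real.norm_of_nonneg (integral_nonneg fun _ => norm_nonneg _)]
  calc ∫ y in Set.Ioi 0, ‖((y * M y * ‖cauchySym y ξ‖ ^ 2 : ℝ) : ℂ) * a ξ‖
      ≤ ∫ y in Set.Ioi 0, D * ‖a ξ‖ * (y * ‖cauchySym y ξ‖ ^ 2) :=
        setIntegral_mono_on (hsec ξ).norm ((integrableOn_mul_cauchySym_sq ξ).const_mul _)
          measurableSet_Ioi (hb ξ)
    _ = D * ‖a ξ‖ * (Set.Ioi (0 : ℝ)).indicator (fun _ => 1 / 4) ξ := by
        rw [integral_const_mul, integral_mul_cauchySym_sq]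
    _ ≤ D * ‖a ξ‖ * 1 := by
        gcongr
        by_cases h : ξ ∈ Set.Ioi (0 : ℝ)
        · rw [Set.indicator_of_mem h]; norm_num
        · rw [Set.indicator_of_notMem h]; norm_num
    _ = _ := mul_one _

theorem integral_laplaceSym_mul {a : ℝ → ℂ} (ha : Integrable a) {M : ℝ → ℝ} (hM : Measurable M)
    {D : ℝ} (hD : ∀ y, |M y| ≤ D) :
    ∫ ξ, (laplaceSym M ξ : ℂ) * a ξ =
      ∫ y in Set.Ioi (0 : ℝ), ((y * M y : ℝ) : ℂ) * ∫ ξ, ((‖cauchySym y ξ‖ ^ 2 : ℝ) : ℂ) * a ξ := by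
  have h := integral_integral_swap (integrable_laplace_kernel ha hM hD)
  calc ∫ ξ, (laplaceSym M ξ : ℂ) * a ξ
      = ∫ ξ, ∫ y in Set.Ioi (0 : ℝ), ((y * M y * ‖cauchySym y ξ‖ ^ 2 : ℝ) : ℂ) * a ξ := by
        congr 1 with ξ
        rw [integral_mul_const, integral_complex_ofReal]
        rfl
    _ = _ := by
        rw [← h]
        congr 1 with y
        rw [← integral_const_mul]
        congr 1 with ξ
        push_cast
        ring

theorem enorm_form_le {f : ι → ℝ → ℂ} {g : κ → ℝ → ℂ}
    (hf : ∀ i, Integrable (f i)) (hf2 : ∀ i, MemLp (f i) 2)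
    (hg : ∀ k, Integrable (g k)) (hg2 : ∀ k, MemLp (g k) 2)
    {M : ι → κ → ℝ → ℝ} (hM : ∀ i k, Measurable (M i k)) {D B : ℝ} (hD : ∀ i k y, |M i k y| ≤ D)
    (hB0 : 0 ≤ B) (hB : ∀ y, 0 < y → ∀ (a : EuclideanSpace ℂ ι) (b : EuclideanSpace ℂ κ),
      ‖∑ i, ∑ k, (M i k y : ℂ) * (a i * (starRingEnd ℂ) (b k))‖ ≤ B * ‖a‖ * ‖b‖) :
    ‖∑ i, ∑ k, ∫ ξ, (laplaceSym (M i k) ξ : ℂ) * (𝓕 (f i) ξ * (starRingEnd ℂ) (𝓕 (g k) ξ))‖ₑ ≤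
      ENNReal.ofReal B * gradForm (vecFun f) (vecFun g) := by
  have hI : ∀ i k, IntegrableOn (fun y => ((y * M i k y : ℝ) : ℂ) *
      ∫ x, dzExt (f i) x y * (starRingEnd ℂ) (dzExt (g k) x y)) (Set.Ioi 0) := fun i k => by
    have h := (integrable_laplace_kernel (memLp_fourier_mul_conj (hf i) (hf2 i) (hg k) (hg2 k))
      (hM i k) (hD i k)).integral_prod_left
    refine IntegrableOn.congr_fun h (fun y hy => ?_) measurableSet_Ioi
    simp only [Function.uncurry]
    rw [integral_dzExt_mul_conj (hf i) (hg k) hy, ← integral_const_mul]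
    congr 1 with ξ
    push_cast
    ring
  have h1 : ∑ i, ∑ k, ∫ ξ, (laplaceSym (M i k) ξ : ℂ) * (𝓕 (f i) ξ * (starRingEnd ℂ) (𝓕 (g k) ξ)) =
      ∫ y in Set.Ioi (0 : ℝ), (y : ℂ) * ∫ x, ∑ i, ∑ k, (M i k y : ℂ) *
        (dzExt (f i) x y * (starRingEnd ℂ) (dzExt (g k) x y)) := by
    calc _ = ∑ i, ∑ k, ∫ y in Set.Ioi (0 : ℝ), ((y * M i k y : ℝ) : ℂ) *
          ∫ x, dzExt (f i) x y * (starRingEnd ℂ) (dzExt (g k) x y) := by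
          refine Finset.sum_congr rfl fun i _ => Finset.sum_congr rfl fun k _ => ?_
          rw [integral_laplaceSym_mul (memLp_fourier_mul_conj (hf i) (hf2 i) (hg k) (hg2 k))
            (hM i k) (hD i k)]
          refine setIntegral_congr_fun measurableSet_Ioi fun y hy => ?_
          rw [integral_dzExt_mul_conj (hf i) (hg k) hy]
      _ = ∫ y in Set.Ioi (0 : ℝ), ∑ i, ∑ k, ((y * M i k y : ℝ) : ℂ) *
          ∫ x, dzExt (f i) x y * (starRingEnd ℂ) (dzExt (g k) x y) := by
          rw [integral_finsetSum _ fun i _ => integrable_finsetSum _ fun k _ => hI i k]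
          refine Finset.sum_congr rfl fun i _ => ?_
          rw [integral_finsetSum _ fun k _ => hI i k]
      _ = _ := by
          refine setIntegral_congr_fun measurableSet_Ioi fun y hy => ?_
          have hd : ∀ i k, Integrable fun x => (M i k y : ℂ) *
              (dzExt (f i) x y * (starRingEnd ℂ) (dzExt (g k) x y)) := fun i k =>
            (integrable_mul_conj (memLp_dzExt (hf i) hy) (memLp_dzExt (hg k) hy)).const_mul _
          rw [integral_finsetSum _ fun i _ => integrable_finsetSum _ fun k _ => hd i k,
            Finset.mul_sum]
          refine Finset.sum_congr rfl fun i _ => ?_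
          rw [integral_finsetSum _ fun k _ => hd i k, Finset.mul_sum]
          refine Finset.sum_congr rfl fun k _ => ?_
          rw [integral_const_mul]
          push_cast
          ring
  rw [h1, gradForm, ← lintegral_const_mul' _ _ ENNReal.ofReal_ne_top]
  refine (enorm_integral_le_lintegral_enorm _).trans (setLIntegral_mono' measurableSet_Ioi
    fun y hy => ?_)
  have hy0 : (0 : ℝ) < y := hy
  rw [enorm_mul, mul_left_comm, ← ofReal_norm, Complex.norm_real, Real.norm_of_nonneg hy0.le,
    ← lintegral_const_mul' _ _ ENNReal.ofReal_ne_top]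
  refine mul_le_mul_right ((enorm_integral_le_lintegral_enorm _).trans
    (lintegral_mono fun x => ?_)) _
  rw [← ENNReal.ofReal_mul hB0, ← ofReal_norm]
  refine ENNReal.ofReal_le_ofReal ((hB y hy0 (WithLp.toLp 2 fun i => dzExt (f i) x y)
    (WithLp.toLp 2 fun k => dzExt (g k) x y)).trans ?_)
  rw [mul_assoc]
  gcongr
  · exact gradNorm_nonneg _ _ _
  · exact norm_dzExt_vec_le hf x hy0
  · exact norm_dzExt_vec_le hg x hy0

theorem norm_form_le {p q : ℝ} (hpq : p.HolderConjugate q) {f : ι → ℝ → ℂ} {g : κ → ℝ → ℂ}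
    (hf : ∀ i, Integrable (f i)) (hf2 : ∀ i, MemLp (f i) 2)
    (hg : ∀ k, Integrable (g k)) (hg2 : ∀ k, MemLp (g k) 2)
    {M : ι → κ → ℝ → ℝ} (hM : ∀ i k, Measurable (M i k)) {D B : ℝ} (hD : ∀ i k y, |M i k y| ≤ D)
    (hB0 : 0 ≤ B) (hB : ∀ y, 0 < y → ∀ (a : EuclideanSpace ℂ ι) (b : EuclideanSpace ℂ κ),
      ‖∑ i, ∑ k, (M i k y : ℂ) * (a i * (starRingEnd ℂ) (b k))‖ ≤ B * ‖a‖ * ‖b‖)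
    (hFp : MemLp (vecFun f) (ENNReal.ofReal p)) (hGq : MemLp (vecFun g) (ENNReal.ofReal q)) :
    ‖∑ i, ∑ k, ∫ ξ, (laplaceSym (M i k) ξ : ℂ) * (𝓕 (f i) ξ * (starRingEnd ℂ) (𝓕 (g k) ξ))‖ ≤
      B * embC p q * (eLpNorm (vecFun f) (ENNReal.ofReal p) volume).toReal *
        (eLpNorm (vecFun g) (ENNReal.ofReal q) volume).toReal := by
  have h := (enorm_form_le hf hf2 hg hg2 hM hD hB0 hB).trans (mul_le_mul_right
    (gradForm_le hpq (integrable_vecFun hf) (integrable_vecFun hg) hFp hGq) _)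
  rw [← ENNReal.ofReal_mul hB0, ← ofReal_norm] at h
  have h0 := embC_nonneg p q
  rw [ENNReal.ofReal_le_ofReal_iff (by positivity)] at h
  calc _ ≤ _ := h
    _ = _ := by ring

end FormBound

section Duality

variable {ι κ : Type} [Fintype ι] [Fintype κ]

/-- A finite family of `L²` functions, seen as one vector valued function. -/
noncomputable abbrev vecLp (f : ι → L2R) : ℝ → EuclideanSpace ℂ ι := vecFun fun i => f i

theorem stronglyMeasurable_vecLp (f : ι → L2R) : StronglyMeasurable (vecLp f) := by
  have h : StronglyMeasurable fun x i => (f i : ℝ → ℂ) x :=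
    (measurable_pi_iff.2 fun i => (Lp.stronglyMeasurable (f i)).measurable).stronglyMeasurable
  exact (PiLp.continuousLinearEquiv 2 ℂ (fun _ : ι => ℂ)).symm.continuous.comp_stronglyMeasurable h

theorem norm_apply_le_norm_vecFun (f : ι → ℝ → ℂ) (i : ι) (x : ℝ) : ‖f i x‖ ≤ ‖vecFun f x‖ :=
  PiLp.norm_apply_le (vecFun f x) i

theorem norm_vecFun_sq (f : ι → ℝ → ℂ) (x : ℝ) : ‖vecFun f x‖ ^ 2 = ∑ i, ‖f i x‖ ^ 2 :=
  EuclideanSpace.norm_sq_eq _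

theorem vecFun_ae_congr {f g : ι → ℝ → ℂ} (h : ∀ i, f i =ᵐ[volume] g i) :
    vecFun f =ᵐ[volume] vecFun g := by
  filter_upwards [ae_all_iff.2 h] with x hx
  simp only [vecFun, hx]

/-- Duality for vector valued `L^p` norms, tested on square integrable functions. -/
theorem eLpNorm_vecLp_le_of_dual {p q : ℝ} (hpq : p.HolderConjugate q) {f : κ → L2R} {A : ENNReal}
    (h : ∀ g : κ → L2R, MemLp (vecLp g) (ENNReal.ofReal q) →
      ‖∑ k, inner ℂ (g k) (f k)‖ₑ ≤ A * eLpNorm (vecLp g) (ENNReal.ofReal q) volume) :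
    eLpNorm (vecLp f) (ENNReal.ofReal p) volume ≤ A := by
  have hp0 := hpq.pos
  have hq0 := hpq.symm.pos
  have hp1 := hpq.lt
  set N : ℝ → ℝ := fun x => ‖vecLp f x‖ with hN
  have hNm : Measurable N := (stronglyMeasurable_vecLp f).norm.measurable
  have hN0 : ∀ x, 0 ≤ N x := fun x => norm_nonneg _
  set S : ℕ → Set ℝ := fun n => Metric.closedBall 0 n ∩ {x | N x ≤ n} with hS
  have hSm : ∀ n, MeasurableSet (S n) := fun n =>
    measurableSet_closedBall.inter (measurableSet_le hNm measurable_const)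
  have hSmono : Monotone S := fun m n hmn x hx => by
    have : (m : ℝ) ≤ n := by exact_mod_cast hmn
    exact ⟨Metric.closedBall_subset_closedBall this hx.1, le_trans (hx.2 : N x ≤ m) this⟩
  have hSU : ⋃ n, S n = Set.univ := by
    refine Set.eq_univ_of_forall fun x => Set.mem_iUnion.2 ?_
    obtain ⟨n, hn⟩ := exists_nat_ge (max ‖x‖ (N x))
    exact ⟨n, by simpa using (le_max_left _ _).trans hn, (le_max_right _ _).trans hn⟩
  have hfin : ∀ n, volume (S n) < ⊤ := fun n =>
    (measure_mono Set.inter_subset_left).trans_lt measure_closedBall_lt_top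
  have key : ∀ n, ∫⁻ x in S n, ENNReal.ofReal (N x ^ p) ≤ A ^ p := fun n => by
    set u : κ → ℝ → ℂ := fun k => (S n).indicator fun x => ((N x ^ (p - 2) : ℝ) : ℂ) * f k x with hu
    have hum : ∀ k, StronglyMeasurable (u k) := fun k =>
      ((Complex.continuous_ofReal.comp_stronglyMeasurable
        (hNm.pow_const _).stronglyMeasurable).mul (Lp.stronglyMeasurable (f k))).indicator (hSm n)
    have hvu : ∀ x, ‖vecFun u x‖ = (S n).indicator (fun x => N x ^ (p - 1)) x := fun x => by
      by_cases hx : x ∈ S n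
      · have e : vecFun u x = ((N x ^ (p - 2) : ℝ) : ℂ) • vecLp f x := by
          ext k
          simp only [vecFun_apply, PiLp.smul_apply, hu, Set.indicator_of_mem hx, smul_eq_mul]
        rw [e, norm_smul, Complex.norm_real, Real.norm_of_nonneg (Real.rpow_nonneg (hN0 x) _),
          Set.indicator_of_mem hx]
        change N x ^ (p - 2) * N x = _
        rcases (hN0 x).eq_or_lt with h0 | h0
        · rw [← h0, mul_zero, Real.zero_rpow (by linarith)]
        · rw [← Real.rpow_add_one h0.ne']
          congr 1; ring
      · have e : vecFun u x = 0 := by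
          ext k
          simp only [vecFun_apply, hu, Set.indicator_of_notMem hx, PiLp.zero_apply]
        rw [e, norm_zero, Set.indicator_of_notMem hx]
    have hub : ∀ x, ‖vecFun u x‖ ≤ (S n).indicator (fun _ => (n : ℝ) ^ (p - 1)) x := fun x => by
      rw [hvu]
      by_cases hx : x ∈ S n
      · rw [Set.indicator_of_mem hx, Set.indicator_of_mem hx]
        exact Real.rpow_le_rpow (hN0 x) hx.2 (by linarith)
      · rw [Set.indicator_of_notMem hx, Set.indicator_of_notMem hx]
    have hmem : ∀ (r : ENNReal) k, MemLp (u k) r := fun r k => by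
      refine (memLp_indicator_const r (hSm n) ((n : ℝ) ^ (p - 1)) (Or.inr (hfin n).ne)).mono
        (hum k).aestronglyMeasurable (ae_of_all _ fun x => ?_)
      exact (norm_apply_le_norm_vecFun u k x).trans ((hub x).trans (le_abs_self _))
    set g : κ → L2R := fun k => (hmem 2 k).toLp (u k) with hg
    have hgu : vecLp g =ᵐ[volume] vecFun u := vecFun_ae_congr fun k => (hmem 2 k).coeFn_toLp
    have hpow : ∀ x, ENNReal.ofReal ‖vecFun u x‖ ^ q =
        (S n).indicator (fun x => ENNReal.ofReal (N x ^ p)) x := fun x => by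
      rw [hvu]
      by_cases hx : x ∈ S n
      · rw [Set.indicator_of_mem hx, Set.indicator_of_mem hx,
          ENNReal.ofReal_rpow_of_nonneg (Real.rpow_nonneg (hN0 x) _) hq0.le, ← Real.rpow_mul (hN0 x)]
        rw [hpq.sub_one_mul_conj]
      · rw [Set.indicator_of_notMem hx, Set.indicator_of_notMem hx, ENNReal.ofReal_zero,
          ENNReal.zero_rpow_of_pos hq0]
    set I := ∫⁻ x in S n, ENNReal.ofReal (N x ^ p) with hI
    have hgn : eLpNorm (vecLp g) (ENNReal.ofReal q) volume = I ^ (1 / q) := by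
      rw [eLpNorm_congr_ae hgu, eLpNorm_eq_lintegral_rpow_enorm_toReal (by simpa using hq0)
        ENNReal.ofReal_ne_top, ENNReal.toReal_ofReal hq0.le, hI, ← lintegral_indicator (hSm n)]
      simp only [← ofReal_norm, hpow]
    have hIfin : I ≠ ⊤ := by
      refine ne_top_of_le_ne_top (b := ∫⁻ x in S n, ENNReal.ofReal ((n : ℝ) ^ p)) ?_ ?_
      · rw [setLIntegral_const]
        exact ENNReal.mul_ne_top ENNReal.ofReal_ne_top (hfin n).ne
      · refine setLIntegral_mono' (hSm n) fun x hx => ENNReal.ofReal_le_ofReal ?_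
        exact Real.rpow_le_rpow (hN0 x) hx.2 hp0.le
    have hgm : MemLp (vecLp g) (ENNReal.ofReal q) := by
      refine ⟨(stronglyMeasurable_vecLp g).aestronglyMeasurable, ?_⟩
      rw [hgn]
      exact ENNReal.rpow_lt_top_of_nonneg (by positivity) hIfin
    have hsum : ∑ k, inner ℂ (g k) (f k) = ((∫ x in S n, N x ^ p : ℝ) : ℂ) := by
      have hint : ∀ k, Integrable fun x => inner ℂ ((g k : ℝ → ℂ) x) ((f k : ℝ → ℂ) x) := fun k =>
        L2.integrable_inner (𝕜 := ℂ) (g k) (f k)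
      simp only [L2.inner_def]
      rw [← integral_finsetSum _ fun k _ => hint k, ← integral_complex_ofReal,
        ← integral_indicator (hSm n)]
      refine integral_congr_ae ?_
      filter_upwards [ae_all_iff.2 fun k => (hmem 2 k).coeFn_toLp] with x hx
      simp only [hg, hx]
      by_cases hxS : x ∈ S n
      · simp only [hu, Set.indicator_of_mem hxS, RCLike.inner_apply, map_mul, Complex.conj_ofReal]
        have e : ∀ k, (f k : ℝ → ℂ) x * (((N x ^ (p - 2) : ℝ) : ℂ) *
            (starRingEnd ℂ) ((f k : ℝ → ℂ) x)) =
            ((N x ^ (p - 2) * ‖(f k : ℝ → ℂ) x‖ ^ 2 : ℝ) : ℂ) := fun k => by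
          rw [mul_left_comm, Complex.mul_conj, Complex.normSq_eq_norm_sq]
          push_cast; rfl
        simp only [e]
        rw [← Complex.ofReal_sum, ← Finset.mul_sum, ← norm_vecFun_sq]
        congr 1
        change N x ^ (p - 2) * N x ^ 2 = _
        rcases (hN0 x).eq_or_lt with h0 | h0
        · rw [← h0, Real.zero_rpow hp0.ne']; simp
        · rw [← Real.rpow_natCast, ← Real.rpow_add h0]
          congr 1; norm_num
      · simp [hu, Set.indicator_of_notMem hxS]
    have hIeq : ‖∑ k, inner ℂ (g k) (f k)‖ₑ = I := by
      rw [hsum, ← ofReal_norm, Complex.norm_real, Real.norm_of_nonneg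
        (integral_nonneg fun x => Real.rpow_nonneg (hN0 x) _), hI,
        integral_eq_lintegral_of_nonneg_ae (ae_of_all _ fun x => Real.rpow_nonneg (hN0 x) _)
          (hNm.pow_const _).aestronglyMeasurable, ENNReal.ofReal_toReal hIfin]
    have hfinal := h g hgm
    rw [hIeq, hgn] at hfinal
    rcases eq_or_ne I 0 with h0 | h0
    · rw [h0]; exact zero_le
    have h1 : I = I ^ (1 / p) * I ^ (1 / q) := by
      rw [← ENNReal.rpow_add _ _ h0 hIfin, one_div, one_div, hpq.inv_add_inv_eq_one,
        ENNReal.rpow_one]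
    have h2 : I ^ (1 / p) ≤ A := by
      have h3 : I ^ (1 / p) * I ^ (1 / q) ≤ A * I ^ (1 / q) := h1 ▸ hfinal
      refine (ENNReal.mul_le_mul_iff_left ?_ ?_).1 h3
      · exact (ENNReal.rpow_pos (pos_iff_ne_zero.2 h0) hIfin).ne'
      · exact ENNReal.rpow_ne_top_of_nonneg (by positivity) hIfin
    calc I = (I ^ (1 / p)) ^ p := by
          rw [← ENNReal.rpow_mul, one_div, inv_mul_cancel₀ hp0.ne', ENNReal.rpow_one]
      _ ≤ A ^ p := ENNReal.rpow_le_rpow h2 hp0.le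
  have htot : ∫⁻ x, ENNReal.ofReal (N x ^ p) ≤ A ^ p := by
    rw [← setLIntegral_univ, ← hSU, setLIntegral_iUnion_of_directed _ hSmono.directed_le]
    exact iSup_le key
  rw [eLpNorm_eq_lintegral_rpow_enorm_toReal (by simpa using hp0) ENNReal.ofReal_ne_top,
    ENNReal.toReal_ofReal hp0.le]
  have e : ∀ x, ‖vecLp f x‖ₑ ^ p = ENNReal.ofReal (N x ^ p) := fun x => by
    rw [← ofReal_norm, ENNReal.ofReal_rpow_of_nonneg (norm_nonneg _) hp0.le]
  simp only [e]
  calc _ ≤ (A ^ p) ^ (1 / p) := ENNReal.rpow_le_rpow htot (by positivity)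
    _ = A := by rw [← ENNReal.rpow_mul, one_div, mul_inv_cancel₀ hp0.ne', ENNReal.rpow_one]

end Duality

section Multiplier

/-- Bounded measurable real Fourier symbols. -/
structure BddSym (w : ℝ → ℝ) : Prop where
  meas : Measurable w
  bdd : ∃ C, ∀ ξ, |w ξ| ≤ C

theorem BddSym.mul {w v : ℝ → ℝ} (hw : BddSym w) (hv : BddSym v) :
    BddSym fun ξ => w ξ * v ξ := by
  obtain ⟨C, hC⟩ := hw.bdd
  obtain ⟨D, hD⟩ := hv.bdd
  refine ⟨hw.meas.mul hv.meas, C * D, fun ξ => ?_⟩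
  rw [abs_mul]
  exact mul_le_mul (hC ξ) (hD ξ) (abs_nonneg _) ((abs_nonneg _).trans (hC ξ))

theorem BddSym.add {w v : ℝ → ℝ} (hw : BddSym w) (hv : BddSym v) :
    BddSym fun ξ => w ξ + v ξ := by
  obtain ⟨C, hC⟩ := hw.bdd
  obtain ⟨D, hD⟩ := hv.bdd
  exact ⟨hw.meas.add hv.meas, C + D, fun ξ => (abs_add_le _ _).trans (add_le_add (hC ξ) (hD ξ))⟩

theorem BddSym.sub {w v : ℝ → ℝ} (hw : BddSym w) (hv : BddSym v) :
    BddSym fun ξ => w ξ - v ξ := by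
  obtain ⟨C, hC⟩ := hw.bdd
  obtain ⟨D, hD⟩ := hv.bdd
  exact ⟨hw.meas.sub hv.meas, C + D, fun ξ => (abs_sub _ _).trans (add_le_add (hC ξ) (hD ξ))⟩

theorem BddSym.const_mul {w : ℝ → ℝ} (hw : BddSym w) (c : ℝ) : BddSym fun ξ => c * w ξ :=
  BddSym.mul ⟨measurable_const, |c|, fun _ => le_rfl⟩ hw

theorem bddSym_zero : BddSym fun _ => 0 := ⟨measurable_const, 0, by simp⟩

theorem bddSym_indicator {s : Set ℝ} (hs : MeasurableSet s) : BddSym (s.indicator fun _ => 1) :=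
  ⟨measurable_const.indicator hs, 1, fun ξ => by
    by_cases h : ξ ∈ s
    · simp [h]
    · simp [h]⟩

theorem BddSym.memLp {w : ℝ → ℝ} (hw : BddSym w) {a : ℝ → ℂ} {r : ENNReal} (ha : MemLp a r) :
    MemLp (fun ξ => (w ξ : ℂ) * a ξ) r := by
  obtain ⟨C, hC⟩ := hw.bdd
  refine MemLp.of_le_mul (c := C) ha ?_ (ae_of_all _ fun ξ => ?_)
  · exact (Complex.measurable_ofReal.comp hw.meas).aestronglyMeasurable.mul ha.1
  · rw [norm_mul, Complex.norm_real]
    exact mul_le_mul_of_nonneg_right (hC ξ) (norm_nonneg _)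

open Classical in
/-- Pointwise multiplication of an `L²` function by a symbol. -/
noncomputable def symMul (w : ℝ → ℝ) (A : L2R) : L2R :=
  if h : MemLp (fun ξ => (w ξ : ℂ) * A ξ) 2 volume then h.toLp _ else 0

theorem coeFn_symMul {w : ℝ → ℝ} (hw : BddSym w) (A : L2R) :
    symMul w A =ᵐ[volume] fun ξ => (w ξ : ℂ) * A ξ := by
  have h := hw.memLp (Lp.memLp A)
  unfold symMul
  rw [dif_pos h]
  exact h.coeFn_toLp

theorem ae_eq_symMul {w : ℝ → ℝ} (hw : BddSym w) {A : L2R} {a : ℝ → ℂ}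
    (h : a =ᵐ[volume] fun ξ => (w ξ : ℂ) * A ξ) (B : L2R) (hB : B =ᵐ[volume] a) :
    B = symMul w A :=
  Lp.ext (hB.trans (h.trans (coeFn_symMul hw A).symm))

/-- The Fourier multiplier operator on `L²` with real symbol `w`. -/
noncomputable def mulT (w : ℝ → ℝ) (f : L2R) : L2R := 𝓕⁻ (symMul w (𝓕 f : L2R))

theorem fourier_mulT (w : ℝ → ℝ) (f : L2R) : (𝓕 (mulT w f) : L2R) = symMul w (𝓕 f : L2R) := by
  unfold mulT
  rw [fourier_fourierInv_eq]

variable {w v : ℝ → ℝ}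

theorem ext_of_fourier {f g : L2R} (h : ((𝓕 f : L2R) : ℝ → ℂ) =ᵐ[volume] (𝓕 g : L2R)) : f = g := by
  have h1 : (𝓕 f : L2R) = 𝓕 g := Lp.ext h
  rw [← fourierInv_fourier_eq (F := L2R) f, h1, fourierInv_fourier_eq]

theorem coeFn_fourier_mulT (hw : BddSym w) (f : L2R) :
    ((𝓕 (mulT w f) : L2R) : ℝ → ℂ) =ᵐ[volume] fun ξ => (w ξ : ℂ) * (𝓕 f : L2R) ξ := by
  rw [fourier_mulT]; exact coeFn_symMul hw _

theorem eq_mulT_of_fourier (hw : BddSym w) {f g : L2R}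
    (h : ((𝓕 g : L2R) : ℝ → ℂ) =ᵐ[volume] fun ξ => (w ξ : ℂ) * (𝓕 f : L2R) ξ) : g = mulT w f :=
  ext_of_fourier (h.trans (coeFn_fourier_mulT hw f).symm)

theorem mulT_mulT (hw : BddSym w) (hv : BddSym v) (f : L2R) :
    mulT w (mulT v f) = mulT (fun ξ => w ξ * v ξ) f := by
  refine eq_mulT_of_fourier (hw.mul hv) ?_
  filter_upwards [coeFn_fourier_mulT hw (mulT v f), coeFn_fourier_mulT hv f] with ξ h1 h2
  rw [h1, h2]; push_cast; ring

theorem mulT_congr (hw : BddSym w) (hv : BddSym v) (h : w =ᵐ[volume] v) (f : L2R) :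
    mulT w f = mulT v f := by
  refine eq_mulT_of_fourier hv ?_
  filter_upwards [coeFn_fourier_mulT hw f, h] with ξ h1 h2
  rw [h1, h2]

theorem mulT_eq_zero (h : w =ᵐ[volume] fun _ => 0) (hw : BddSym w) (f : L2R) : mulT w f = 0 := by
  refine ext_of_fourier ?_
  rw [FourierTransform.fourier_zero]
  filter_upwards [coeFn_fourier_mulT hw f, h, Lp.coeFn_zero ℂ 2 (volume : Measure ℝ)] with ξ h1 h2 h3
  rw [h1, h2, h3]
  simp

theorem mulT_sym_add (hw : BddSym w) (hv : BddSym v) (f : L2R) :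
    mulT (fun ξ => w ξ + v ξ) f = mulT w f + mulT v f := by
  refine (eq_mulT_of_fourier (hw.add hv) ?_).symm
  rw [FourierTransform.fourier_add]
  filter_upwards [coeFn_fourier_mulT hw f, coeFn_fourier_mulT hv f,
    Lp.coeFn_add (𝓕 (mulT w f) : L2R) (𝓕 (mulT v f))] with ξ h1 h2 h3
  rw [h3, Pi.add_apply, h1, h2]; push_cast; ring

theorem mulT_sym_sub (hw : BddSym w) (hv : BddSym v) (f : L2R) :
    mulT (fun ξ => w ξ - v ξ) f = mulT w f - mulT v f := by
  have h := mulT_sym_add (hw.sub hv) hv f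
  simp only [sub_add_cancel] at h
  rw [h, add_sub_cancel_right]

theorem mulT_add (hw : BddSym w) (f g : L2R) : mulT w (f + g) = mulT w f + mulT w g := by
  refine (eq_mulT_of_fourier hw ?_).symm
  rw [FourierTransform.fourier_add, FourierTransform.fourier_add]
  filter_upwards [coeFn_fourier_mulT hw f, coeFn_fourier_mulT hw g,
    Lp.coeFn_add (𝓕 (mulT w f) : L2R) (𝓕 (mulT w g)), Lp.coeFn_add (𝓕 f : L2R) (𝓕 g)]
    with ξ h1 h2 h3 h4
  rw [h3, h4, Pi.add_apply, Pi.add_apply, h1, h2]; ring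

theorem mulT_zero (hw : BddSym w) : mulT w 0 = 0 := by
  have := mulT_add hw 0 0
  simpa using this

theorem mulT_sum {α : Type*} {s : Finset α} (hw : BddSym w) (f : α → L2R) :
    mulT w (∑ a ∈ s, f a) = ∑ a ∈ s, mulT w (f a) := by
  classical
  induction s using Finset.induction_on with
  | empty => simpa using mulT_zero hw
  | insert a s ha ih => rw [Finset.sum_insert ha, Finset.sum_insert ha, mulT_add hw, ih]

theorem inner_mulT (hw : BddSym w) (f g : L2R) : inner ℂ g (mulT w f) =
    ∫ ξ, (w ξ : ℂ) * ((𝓕 f : L2R) ξ * (starRingEnd ℂ) ((𝓕 g : L2R) ξ)) := by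
  rw [← Lp.inner_fourier_eq, L2.inner_def]
  refine integral_congr_ae ?_
  filter_upwards [coeFn_fourier_mulT hw f] with ξ h1
  rw [h1, RCLike.inner_apply, mul_assoc]

theorem inner_mulT_left (hw : BddSym w) (f g : L2R) :
    inner ℂ (mulT w g) f = inner ℂ g (mulT w f) := by
  rw [inner_mulT hw, ← Lp.inner_fourier_eq, L2.inner_def]
  refine integral_congr_ae ?_
  filter_upwards [coeFn_fourier_mulT hw g] with ξ h1
  rw [h1, RCLike.inner_apply, map_mul, Complex.conj_ofReal]
  ring

theorem exists_norm_mulT_le (hw : BddSym w) : ∃ C, ∀ f : L2R, ‖mulT w f‖ ≤ C * ‖f‖ := by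
  obtain ⟨C, hC⟩ := hw.bdd
  refine ⟨C, fun f => ?_⟩
  rw [← Lp.norm_fourier_eq, ← Lp.norm_fourier_eq f]
  refine Lp.norm_le_mul_norm_of_ae_le_mul ?_
  filter_upwards [coeFn_fourier_mulT hw f] with ξ h1
  rw [h1, norm_mul, Complex.norm_real]
  exact mul_le_mul_of_nonneg_right (hC ξ) (norm_nonneg _)

theorem mulT_neg (hw : BddSym w) (f : L2R) : mulT w (-f) = -mulT w f := by
  have := mulT_add hw f (-f)
  rw [add_neg_cancel, mulT_zero hw] at this
  exact (neg_eq_of_add_eq_zero_right this.symm).symm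

theorem mulT_sub (hw : BddSym w) (f g : L2R) : mulT w (f - g) = mulT w f - mulT w g := by
  rw [sub_eq_add_neg, mulT_add hw, mulT_neg hw, sub_eq_add_neg]

theorem continuous_mulT (hw : BddSym w) : Continuous (mulT w) := by
  obtain ⟨C, hC⟩ := exists_norm_mulT_le hw
  refine LipschitzWith.continuous (K := C.toNNReal) (LipschitzWith.of_dist_le_mul fun f g => ?_)
  rw [dist_eq_norm, dist_eq_norm, ← mulT_sub hw]
  exact (hC _).trans (mul_le_mul_of_nonneg_right (Real.le_coe_toNNReal C) (norm_nonneg _))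

end Multiplier

section Extension

/-- Truncation of an `L²` function to a bounded interval. -/
noncomputable def truncL (n : ℕ) (f : L2R) : L2R :=
  ((Lp.memLp f).indicator (measurableSet_closedBall (x := (0 : ℝ)) (ε := (n : ℝ)))).toLp _

theorem coeFn_truncL (n : ℕ) (f : L2R) :
    truncL n f =ᵐ[volume] (Metric.closedBall (0 : ℝ) n).indicator f := MemLp.coeFn_toLp _

theorem tendsto_truncL (f : L2R) : Filter.Tendsto (fun n => truncL n f) Filter.atTop (nhds f) := by
  have hf := Lp.memLp f
  have h0 : Filter.Tendsto (fun n : ℕ => ∫⁻ x, ‖(Metric.closedBall (0 : ℝ) n)ᶜ.indicator f x‖ₑ ^ (2 : ℝ))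
      Filter.atTop (nhds (∫⁻ x : ℝ, 0)) := by
    refine tendsto_lintegral_of_dominated_convergence' (fun x => ‖f x‖ₑ ^ (2 : ℝ)) (fun n => ?_)
      (fun n => ae_of_all _ fun x => ?_) ?_ (ae_of_all _ fun x => ?_)
    · exact ((hf.1.indicator measurableSet_closedBall.compl).enorm.pow_const _)
    · exact ENNReal.rpow_le_rpow (enorm_indicator_le_enorm_self _ _) (by norm_num)
    · have := lintegral_rpow_enorm_lt_top_of_eLpNorm_lt_top (p := 2) (by norm_num) (by norm_num) hf.2
      simpa using this.ne
    · obtain ⟨N, hN⟩ := exists_nat_ge ‖x‖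
      refine tendsto_const_nhds.congr' ?_
      filter_upwards [Filter.eventually_ge_atTop N] with n hn
      rw [Set.indicator_of_notMem]
      · simp
      · simp only [Set.mem_compl_iff, not_not, mem_closedBall_zero_iff]
        exact hN.trans (by exact_mod_cast hn)
  rw [tendsto_iff_norm_sub_tendsto_zero]
  have h1 : ∀ n, ‖truncL n f - f‖ₑ = (∫⁻ x, ‖(Metric.closedBall (0 : ℝ) n)ᶜ.indicator f x‖ₑ ^ (2 : ℝ)) ^ (1 / (2 : ℝ)) := by
    intro n
    rw [Lp.enorm_def, eLpNorm_eq_lintegral_rpow_enorm_toReal (by norm_num) (by norm_num)]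
    simp only [ENNReal.toReal_ofNat]
    congr 1
    refine lintegral_congr_ae ?_
    filter_upwards [Lp.coeFn_sub (truncL n f) f, coeFn_truncL n f] with x h1 h2
    rw [h1, Pi.sub_apply, h2]
    by_cases hx : x ∈ Metric.closedBall (0 : ℝ) n
    · simp [Set.indicator_of_mem hx, Set.indicator_of_notMem (Set.notMem_compl_iff.2 hx)]
    · simp [Set.indicator_of_notMem hx, Set.indicator_of_mem (Set.mem_compl hx)]
  have h2 : Filter.Tendsto (fun n => ‖truncL n f - f‖ₑ) Filter.atTop (nhds 0) := by
    simp only [h1]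
    have := h0.ennrpow_const (1 / (2 : ℝ))
    simpa using this
  have h3 := (ENNReal.tendsto_toReal ENNReal.zero_ne_top).comp h2
  simpa [Function.comp_def] using h3

theorem memLp_trunc_two (n : ℕ) (f : L2R) : MemLp ((Metric.closedBall (0 : ℝ) n).indicator f) 2 :=
  (Lp.memLp f).indicator measurableSet_closedBall

theorem integrable_trunc (n : ℕ) (f : L2R) :
    Integrable ((Metric.closedBall (0 : ℝ) n).indicator f) := by
  refine (integrable_indicator_iff measurableSet_closedBall).2 ?_
  have : IsFiniteMeasure (volume.restrict (Metric.closedBall (0 : ℝ) n)) :=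
    ⟨by rw [Measure.restrict_apply_univ]; exact measure_closedBall_lt_top⟩
  exact ((Lp.memLp f).restrict _).integrable (by norm_num)

variable {ι κ : Type} [Fintype ι] [Fintype κ]

theorem vecFun_indicator {ι : Type}
    (s : Set ℝ) (f : ι → ℝ → ℂ) :
    (vecFun fun i => s.indicator (f i)) = s.indicator (vecFun f) := by
  ext x i
  by_cases hx : x ∈ s
  · simp [vecFun_apply, hx]
  · simp [vecFun_apply, hx]

/-- A matrix of symbols defines a bounded bilinear form on `L^p(ℓ²) × L^q(ℓ²)`. -/
def FormBd (w : ι → κ → ℝ → ℝ) (p q : ℝ) (C : ENNReal) : Prop :=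
  ∀ (f : ι → L2R) (g : κ → L2R), MemLp (vecLp f) (ENNReal.ofReal p) →
    MemLp (vecLp g) (ENNReal.ofReal q) →
    ‖∑ i, ∑ k, inner ℂ (g k) (mulT (w i k) (f i))‖ₑ ≤
      C * eLpNorm (vecLp f) (ENNReal.ofReal p) volume * eLpNorm (vecLp g) (ENNReal.ofReal q) volume

/-- A matrix of symbols defines a bounded operator on `L^p(ℓ²)`. -/
def OpBd (w : ι → κ → ℝ → ℝ) (p : ℝ) (C : ENNReal) : Prop :=
  ∀ f : ι → L2R, MemLp (vecLp f) (ENNReal.ofReal p) →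
    eLpNorm (vecLp fun k => ∑ i, mulT (w i k) (f i)) (ENNReal.ofReal p) volume ≤
      C * eLpNorm (vecLp f) (ENNReal.ofReal p) volume

theorem FormBd.opBd {w : ι → κ → ℝ → ℝ} {p q : ℝ} {C : ENNReal} (h : FormBd w p q C)
    (hpq : p.HolderConjugate q) : OpBd w p C := fun f hf => by
  refine eLpNorm_vecLp_le_of_dual hpq fun g hg => ?_
  have := h f g hf hg
  rw [Finset.sum_comm] at this
  simpa only [inner_sum] using this

theorem formBd_of_integrable {w : ι → κ → ℝ → ℝ} (hw : ∀ i k, BddSym (w i k)) {p q : ℝ}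
    {C : ENNReal}
    (h : ∀ (f : ι → ℝ → ℂ) (g : κ → ℝ → ℂ), (∀ i, Integrable (f i)) → (∀ i, MemLp (f i) 2) →
      (∀ k, Integrable (g k)) → (∀ k, MemLp (g k) 2) → MemLp (vecFun f) (ENNReal.ofReal p) →
      MemLp (vecFun g) (ENNReal.ofReal q) →
      ‖∑ i, ∑ k, ∫ ξ, (w i k ξ : ℂ) * (𝓕 (f i) ξ * (starRingEnd ℂ) (𝓕 (g k) ξ))‖ₑ ≤
        C * eLpNorm (vecFun f) (ENNReal.ofReal p) volume *
          eLpNorm (vecFun g) (ENNReal.ofReal q) volume) :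
    FormBd w p q C := fun f g hf hg => by
  have hlim : Filter.Tendsto
      (fun n => ‖∑ i, ∑ k, inner ℂ (truncL n (g k)) (mulT (w i k) (truncL n (f i)))‖ₑ)
      Filter.atTop (nhds ‖∑ i, ∑ k, inner ℂ (g k) (mulT (w i k) (f i))‖ₑ) := by
    refine (continuous_enorm.tendsto _).comp ?_
    refine tendsto_finsetSum _ fun i _ => tendsto_finsetSum _ fun k _ => ?_
    exact (tendsto_truncL (g k)).inner
      (((continuous_mulT (hw i k)).tendsto _).comp (tendsto_truncL (f i)))
  refine le_of_tendsto' hlim fun n => ?_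
  set s := Metric.closedBall (0 : ℝ) n
  have hs : MeasurableSet s := measurableSet_closedBall
  have e1 := vecFun_indicator s fun i => (f i : ℝ → ℂ)
  have e2 := vecFun_indicator s fun k => (g k : ℝ → ℂ)
  have := h (fun i => s.indicator (f i)) (fun k => s.indicator (g k))
    (fun i => integrable_trunc n (f i)) (fun i => memLp_trunc_two n (f i))
    (fun i => integrable_trunc n (g i)) (fun i => memLp_trunc_two n (g i))
    (e1 ▸ hf.indicator hs) (e2 ▸ hg.indicator hs)
  rw [e1, e2] at this
  have e3 : ∀ i k, inner ℂ (truncL n (g k)) (mulT (w i k) (truncL n (f i))) =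
      ∫ ξ, (w i k ξ : ℂ) * (𝓕 (s.indicator (f i)) ξ *
        (starRingEnd ℂ) (𝓕 (s.indicator (g k)) ξ)) := fun i k => by
    rw [inner_mulT (hw i k)]
    refine integral_congr_ae ?_
    filter_upwards [fourier_toLp_ae_eq (integrable_trunc n (f i)) (memLp_trunc_two n (f i)),
      fourier_toLp_ae_eq (integrable_trunc n (g k)) (memLp_trunc_two n (g k))] with ξ h1 h2
    unfold truncL
    rw [h1, h2]
  simp only [e3]
  refine this.trans ?_
  gcongr
  · exact eLpNorm_indicator_le _
  · exact eLpNorm_indicator_le _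

end Extension

section FormCalculus

variable {ι κ : Type} [Fintype ι] [Fintype κ] {p q : ℝ} {C D : ENNReal}

theorem FormBd.add {w v : ι → κ → ℝ → ℝ} (hw : ∀ i k, BddSym (w i k)) (hv : ∀ i k, BddSym (v i k))
    (h1 : FormBd w p q C) (h2 : FormBd v p q D) :
    FormBd (fun i k ξ => w i k ξ + v i k ξ) p q (C + D) := fun f g hf hg => by
  simp only [mulT_sym_add (hw _ _) (hv _ _), inner_add_right, Finset.sum_add_distrib]
  refine (enorm_add_le _ _).trans ((add_le_add (h1 f g hf hg) (h2 f g hf hg)).trans_eq ?_)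
  ring

theorem FormBd.sub {w v : ι → κ → ℝ → ℝ} (hw : ∀ i k, BddSym (w i k)) (hv : ∀ i k, BddSym (v i k))
    (h1 : FormBd w p q C) (h2 : FormBd v p q D) :
    FormBd (fun i k ξ => w i k ξ - v i k ξ) p q (C + D) := fun f g hf hg => by
  simp only [mulT_sym_sub (hw _ _) (hv _ _), inner_sub_right, Finset.sum_sub_distrib]
  refine enorm_sub_le.trans ((add_le_add (h1 f g hf hg) (h2 f g hf hg)).trans_eq ?_)
  ring

theorem FormBd.congr {w v : ι → κ → ℝ → ℝ} (hw : ∀ i k, BddSym (w i k))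
    (hv : ∀ i k, BddSym (v i k)) (h : ∀ i k, w i k =ᵐ[volume] v i k) (h1 : FormBd w p q C) :
    FormBd v p q C := fun f g hf hg => by
  have e : ∀ i k, mulT (v i k) (f i) = mulT (w i k) (f i) := fun i k =>
    (mulT_congr (hw i k) (hv i k) (h i k) _).symm
  simp only [e]
  exact h1 f g hf hg

theorem integrable_fourier_mul_conj (f g : L2R) :
    Integrable fun ξ => (𝓕 f : L2R) ξ * (starRingEnd ℂ) ((𝓕 g : L2R) ξ) :=
  integrable_mul_conj (Lp.memLp _) (Lp.memLp _)

/-- Averages of uniformly bounded families of forms are bounded. -/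
theorem FormBd.integral {W : ℝ → ι → κ → ℝ → ℝ} {m : Measure ℝ} [SFinite m] {ν : ℝ → ℝ}
    (hν : Integrable ν m) (hWm : ∀ i k, Measurable fun z : ℝ × ℝ => W z.1 i k z.2)
    (hW1 : ∀ t i k ξ, |W t i k ξ| ≤ 1) (hW : ∀ t, FormBd (W t) p q C) :
    FormBd (fun i k ξ => ∫ t, ν t * W t i k ξ ∂m) p q ((∫⁻ t, ‖ν t‖ₑ ∂m) * C) := fun f g hf hg => by
  have hWb : ∀ t i k, BddSym (W t i k) := fun t i k =>
    ⟨(hWm i k).comp (measurable_const.prodMk measurable_id), 1, hW1 t i k⟩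
  have hwb : ∀ i k, BddSym fun ξ => ∫ t, ν t * W t i k ξ ∂m := fun i k => by
    refine ⟨?_, ∫ t, |ν t| ∂m, fun ξ => ?_⟩
    · have h1 : StronglyMeasurable (Function.uncurry fun ξ t => hν.1.mk ν t * W t i k ξ) :=
        (hν.1.stronglyMeasurable_mk.comp_measurable measurable_snd).mul
          ((hWm i k).comp (measurable_snd.prodMk measurable_fst)).stronglyMeasurable
      have h2 : (fun ξ => ∫ t, ν t * W t i k ξ ∂m) = fun ξ => ∫ t, hν.1.mk ν t * W t i k ξ ∂m := by
        ext ξ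
        refine integral_congr_ae ?_
        filter_upwards [hν.1.ae_eq_mk] with t ht
        rw [ht]
      rw [h2]
      exact h1.integral_prod_right.measurable
    · refine abs_integral_le_integral_abs.trans (integral_mono_of_nonneg
        (ae_of_all _ fun _ => abs_nonneg _) hν.abs (ae_of_all _ fun t => ?_))
      simp only [abs_mul]
      exact mul_le_of_le_one_right (abs_nonneg _) (hW1 t i k ξ)
  have hprod : ∀ i k, Integrable (Function.uncurry fun t ξ : ℝ => ((ν t * W t i k ξ : ℝ) : ℂ) *
      ((𝓕 (f i) : L2R) ξ * (starRingEnd ℂ) ((𝓕 (g k) : L2R) ξ))) (m.prod volume) := fun i k => by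
    have h1 := hν.ofReal (𝕜 := ℂ) |>.mul_prod (integrable_fourier_mul_conj (f i) (g k))
    have h2 := h1.bdd_mul (c := 1) (f := fun z : ℝ × ℝ => ((W z.1 i k z.2 : ℝ) : ℂ))
      (Complex.measurable_ofReal.comp (hWm i k)).aestronglyMeasurable
      (ae_of_all _ fun z => by rw [Complex.norm_real]; exact hW1 _ _ _ _)
    refine h2.congr (ae_of_all _ fun z => ?_)
    simp only [Function.uncurry, Complex.ofReal_mul, RCLike.ofReal_eq_complex_ofReal]
    ring
  have e : ∑ i, ∑ k, inner ℂ (g k) (mulT (fun ξ => ∫ t, ν t * W t i k ξ ∂m) (f i)) =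
      ∫ t, (ν t : ℂ) * ∑ i, ∑ k, inner ℂ (g k) (mulT (W t i k) (f i)) ∂m := by
    have e1 : ∀ i k, inner ℂ (g k) (mulT (fun ξ => ∫ t, ν t * W t i k ξ ∂m) (f i)) =
        ∫ t, (ν t : ℂ) * inner ℂ (g k) (mulT (W t i k) (f i)) ∂m := fun i k => by
      rw [inner_mulT (hwb i k)]
      have h := integral_integral_swap (hprod i k)
      calc _ = ∫ ξ, ∫ t, ((ν t * W t i k ξ : ℝ) : ℂ) *
            ((𝓕 (f i) : L2R) ξ * (starRingEnd ℂ) ((𝓕 (g k) : L2R) ξ)) ∂m := by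
            congr 1 with ξ
            rw [integral_mul_const, integral_complex_ofReal]
        _ = _ := by
            rw [← h]
            congr 1 with t
            rw [inner_mulT (hWb t i k), ← integral_const_mul]
            congr 1 with ξ
            push_cast
            ring
    have hI : ∀ i k, Integrable
        (fun t => (ν t : ℂ) * inner ℂ (g k) (mulT (W t i k) (f i))) m := fun i k => by
      refine (hprod i k).integral_prod_left.congr (ae_of_all _ fun t => ?_)
      simp only [Function.uncurry]
      rw [inner_mulT (hWb t i k), ← integral_const_mul]
      congr 1 with ξ
      push_cast
      ring
    simp only [e1, Finset.mul_sum]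
    rw [integral_finsetSum _ fun i _ => integrable_finsetSum _ fun k _ => hI i k]
    refine Finset.sum_congr rfl fun i _ => ?_
    rw [integral_finsetSum _ fun k _ => hI i k]
  rw [e]
  refine (enorm_integral_le_lintegral_enorm _).trans ?_
  calc ∫⁻ t, ‖(ν t : ℂ) * ∑ i, ∑ k, inner ℂ (g k) (mulT (W t i k) (f i))‖ₑ ∂m
      ≤ ∫⁻ t, ‖ν t‖ₑ * (C * eLpNorm (vecLp f) (ENNReal.ofReal p) volume *
          eLpNorm (vecLp g) (ENNReal.ofReal q) volume) ∂m := by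
        refine lintegral_mono fun t => ?_
        rw [enorm_mul]
        have h1 : ‖(ν t : ℂ)‖ₑ = ‖ν t‖ₑ := by
          rw [← ofReal_norm, ← ofReal_norm, Complex.norm_real]
        rw [h1]
        exact mul_le_mul_right (hW t f g hf hg) _
    _ = _ := by
        rw [lintegral_mul_const'' _ hν.1.enorm]
        ring

open Classical in
/-- The diagonal matrix of symbols. -/
noncomputable def diagSym (w : ι → ℝ → ℝ) (i k : ι) (ξ : ℝ) : ℝ := if i = k then w i ξ else 0

theorem bddSym_diagSym {ι : Type}
    {w : ι → ℝ → ℝ} (hw : ∀ i, BddSym (w i)) (i k : ι) :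
    BddSym (diagSym w i k) := by
  unfold diagSym
  by_cases h : i = k
  · simpa [h] using hw k
  · simpa [h] using bddSym_zero

theorem mulT_diagSym_sum (w : ι → ℝ → ℝ) (f : ι → L2R) (k : ι) :
    ∑ i, mulT (diagSym w i k) (f i) = mulT (w k) (f k) := by
  classical
  rw [Finset.sum_eq_single k]
  · congr 1
    ext ξ
    simp [diagSym]
  · intro i _ hi
    refine mulT_eq_zero (ae_of_all _ fun ξ => ?_) ?_ _
    · simp [diagSym, hi]
    · have : diagSym w i k = fun _ => 0 := by ext ξ; simp [diagSym, hi]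
      rw [this]; exact bddSym_zero
  · simp

/-- A family of symbols acts boundedly, componentwise, on `L^p(ℓ²)`. -/
def DiagBd (w : ι → ℝ → ℝ) (p : ℝ) (C : ENNReal) : Prop :=
  ∀ f : ι → L2R, MemLp (vecLp f) (ENNReal.ofReal p) →
    eLpNorm (vecLp fun k => mulT (w k) (f k)) (ENNReal.ofReal p) volume ≤
      C * eLpNorm (vecLp f) (ENNReal.ofReal p) volume

theorem FormBd.diagBd {w : ι → ℝ → ℝ} (h : FormBd (diagSym w) p q C) (hpq : p.HolderConjugate q) :
    DiagBd w p C := fun f hf => by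
  have := h.opBd hpq f hf
  simpa only [mulT_diagSym_sum] using this

/-- The square function attached to a family of symbols is bounded on `L^p`. -/
def ColBd (w : κ → ℝ → ℝ) (p : ℝ) (C : ENNReal) : Prop :=
  ∀ f : L2R, MemLp f (ENNReal.ofReal p) →
    eLpNorm (vecLp fun k => mulT (w k) f) (ENNReal.ofReal p) volume ≤
      C * eLpNorm f (ENNReal.ofReal p) volume

theorem norm_vecFun_unit (f : ℝ → ℂ) (x : ℝ) : ‖vecFun (fun _ : Unit => f) x‖ = ‖f x‖ := by
  have := norm_vecFun_sq (fun _ : Unit => f) x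
  simp only [Finset.univ_unique, Finset.sum_const, Finset.card_singleton, one_smul] at this
  exact (pow_left_inj₀ (norm_nonneg _) (norm_nonneg _) two_ne_zero).1 this

theorem eLpNorm_vecFun_unit (f : ℝ → ℂ) (r : ENNReal) :
    eLpNorm (vecFun fun _ : Unit => f) r volume = eLpNorm f r volume :=
  eLpNorm_congr_norm_ae (ae_of_all _ (norm_vecFun_unit f))

theorem memLp_vecLp_unit {f : L2R} {r : ENNReal} (hf : MemLp f r) :
    MemLp (vecLp fun _ : Unit => f) r :=
  ⟨(stronglyMeasurable_vecLp _).aestronglyMeasurable, by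
    rw [vecLp, eLpNorm_vecFun_unit]; exact hf.2⟩

theorem FormBd.colBd {w : κ → ℝ → ℝ} (h : FormBd (fun _ : Unit => w) p q C)
    (hpq : p.HolderConjugate q) : ColBd w p C := fun f hf => by
  have := h.opBd hpq (fun _ => f) (memLp_vecLp_unit hf)
  simpa [vecLp, eLpNorm_vecFun_unit] using this

end FormCalculus

section HalfLines

/-- Modulation of a function. -/
noncomputable def modulate (a : ℝ) (f : ℝ → ℂ) (x : ℝ) : ℂ :=
  Complex.exp (((-2 * π * (x * a) : ℝ) : ℂ) * Complex.I) * f x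

theorem norm_modulate (a : ℝ) (f : ℝ → ℂ) (x : ℝ) : ‖modulate a f x‖ = ‖f x‖ := by
  rw [modulate, norm_mul, Complex.norm_exp_ofReal_mul_I, one_mul]

theorem aestronglyMeasurable_modulate (a : ℝ) {f : ℝ → ℂ} (hf : AEStronglyMeasurable f) :
    AEStronglyMeasurable (modulate a f) := by
  refine AEStronglyMeasurable.mul ?_ hf
  exact Continuous.aestronglyMeasurable (by fun_prop)

theorem integrable_modulate (a : ℝ) {f : ℝ → ℂ} (hf : Integrable f) : Integrable (modulate a f) :=
  hf.congr' (aestronglyMeasurable_modulate a hf.1) (ae_of_all _ fun x => (norm_modulate a f x).symm)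

theorem memLp_modulate (a : ℝ) {f : ℝ → ℂ} {r : ENNReal} (hf : MemLp f r) :
    MemLp (modulate a f) r :=
  hf.congr_norm (aestronglyMeasurable_modulate a hf.1)
    (ae_of_all _ fun x => (norm_modulate a f x).symm)

theorem fourier_modulate (a : ℝ) (f : ℝ → ℂ) (ξ : ℝ) : 𝓕 (modulate a f) ξ = 𝓕 f (ξ + a) := by
  rw [Real.fourier_real_eq_integral_exp_smul, Real.fourier_real_eq_integral_exp_smul]
  congr 1 with x
  rw [modulate, smul_eq_mul, smul_eq_mul, ← mul_assoc, ← Complex.exp_add]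
  congr 2
  push_cast
  ring

variable {ι : Type} [Fintype ι] {p q : ℝ}

theorem norm_vecFun_modulate (a : ι → ℝ) (f : ι → ℝ → ℂ) (x : ℝ) :
    ‖vecFun (fun i => modulate (a i) (f i)) x‖ = ‖vecFun f x‖ := by
  refine (pow_left_inj₀ (norm_nonneg _) (norm_nonneg _) two_ne_zero).1 ?_
  simp only [norm_vecFun_sq, norm_modulate]

theorem aestronglyMeasurable_vecFun {f : ι → ℝ → ℂ} (hf : ∀ i, AEStronglyMeasurable (f i)) :
    AEStronglyMeasurable (vecFun f) := by
  have h : AEMeasurable fun x => fun i => f i x := aemeasurable_pi_lambda _ fun i => (hf i).aemeasurable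
  exact ((PiLp.continuous_toLp 2 _).measurable.comp_aemeasurable h).aestronglyMeasurable

theorem memLp_vecFun_modulate (a : ι → ℝ) {f : ι → ℝ → ℂ} {r : ENNReal}
    (hf : ∀ i, Integrable (f i)) (h : MemLp (vecFun f) r) :
    MemLp (vecFun fun i => modulate (a i) (f i)) r :=
  h.congr_norm (aestronglyMeasurable_vecFun fun i => (integrable_modulate (a i) (hf i)).1)
    (ae_of_all _ fun x => (norm_vecFun_modulate a f x).symm)

theorem eLpNorm_vecFun_modulate (a : ι → ℝ) (f : ι → ℝ → ℂ) (r : ENNReal) :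
    eLpNorm (vecFun fun i => modulate (a i) (f i)) r volume = eLpNorm (vecFun f) r volume :=
  eLpNorm_congr_norm_ae (ae_of_all _ (norm_vecFun_modulate a f))

theorem laplaceSym_zero (ξ : ℝ) : laplaceSym (fun _ => 0) ξ = 0 := by simp [laplaceSym]

theorem laplaceSym_const (c ξ : ℝ) :
    laplaceSym (fun _ => c) ξ = c * (Set.Ioi (0 : ℝ)).indicator (fun _ => 1 / 4) ξ := by
  rw [← integral_mul_cauchySym_sq, laplaceSym, ← integral_const_mul]
  congr 1 with y
  ring

/-- The half-line multipliers, with varying end points, act boundedly on `L^p(ℓ²)`. -/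
theorem formBd_halfLine (hpq : p.HolderConjugate q) (a : ι → ℝ) :
    FormBd (diagSym fun i => (Set.Ioi (a i)).indicator fun _ => 1) p q
      (ENNReal.ofReal (4 * embC p q)) := by
  classical
  refine formBd_of_integrable (bddSym_diagSym fun i => bddSym_indicator measurableSet_Ioi) ?_
  intro f g hf hf2 hg hg2 hfp hgq
  have key := norm_form_le (B := 4) (D := 4) hpq
    (M := fun i k _ => if i = k then 4 else 0)
    (fun i => integrable_modulate (a i) (hf i)) (fun i => memLp_modulate (a i) (hf2 i))
    (fun i => integrable_modulate (a i) (hg i)) (fun i => memLp_modulate (a i) (hg2 i))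
    (fun i k => measurable_const) (fun i k y => by split_ifs <;> norm_num) (by norm_num)
    (fun y _ u v => by
      have h1 : ∑ i, ∑ k, (((if i = k then 4 else 0 : ℝ)) : ℂ) * (u i * (starRingEnd ℂ) (v k)) =
          4 * inner ℂ v u := by
        rw [PiLp.inner_apply, Finset.mul_sum]
        refine Finset.sum_congr rfl fun i _ => ?_
        rw [Finset.sum_eq_single i]
        · simp
        · intro k _ hk
          simp [hk.symm]
        · simp
      rw [h1, norm_mul]
      have := norm_inner_le_norm (𝕜 := ℂ) v u
      norm_num
      nlinarith)
    (memLp_vecFun_modulate a hf hfp) (memLp_vecFun_modulate a hg hgq)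
  rw [eLpNorm_vecFun_modulate, eLpNorm_vecFun_modulate] at key
  have e : ∀ i k, ∫ ξ, (diagSym (fun i => (Set.Ioi (a i)).indicator fun _ => 1) i k ξ : ℂ) *
      (𝓕 (f i) ξ * (starRingEnd ℂ) (𝓕 (g k) ξ)) =
      ∫ ξ, (laplaceSym (fun _ => if i = k then 4 else 0) ξ : ℂ) *
        (𝓕 (modulate (a i) (f i)) ξ * (starRingEnd ℂ) (𝓕 (modulate (a k) (g k)) ξ)) := by
    intro i k
    by_cases h : i = k
    · subst h
      rw [← integral_add_right_eq_self _ (a i)]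
      congr 1 with ξ
      rw [fourier_modulate, fourier_modulate]
      congr 2
      simp only [if_true, laplaceSym_const, diagSym]
      by_cases h0 : 0 < ξ
      · simp [h0]
      · simp [h0]
    · simp [diagSym, h, laplaceSym_zero]
  simp only [e]
  rw [← ofReal_norm]
  refine (ENNReal.ofReal_le_ofReal key).trans_eq ?_
  have h0 := embC_nonneg p q
  rw [ENNReal.ofReal_mul (by positivity), ENNReal.ofReal_mul (by positivity),
    ENNReal.ofReal_toReal hfp.2.ne, ENNReal.ofReal_toReal hgq.2.ne]

/-- Symmetric interval multipliers, with varying lengths, act boundedly on `L^p(ℓ²)`. -/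
theorem formBd_interval (hpq : p.HolderConjugate q) (t : ι → ℝ) :
    FormBd (diagSym fun i => (Set.Icc (-t i) (t i)).indicator fun _ => 1) p q
      (ENNReal.ofReal (8 * embC p q)) := by
  have hb := fun a : ι → ℝ => bddSym_diagSym (w := fun i => (Set.Ioi (a i)).indicator fun _ => (1 : ℝ))
    fun i => bddSym_indicator measurableSet_Ioi
  have h0 := embC_nonneg p q
  have h1 := FormBd.sub (hb _) (hb _) (formBd_halfLine hpq fun i => -max (t i) 0)
    (formBd_halfLine hpq fun i => max (t i) 0)
  rw [← ENNReal.ofReal_add (by positivity) (by positivity)] at h1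
  have h2 : 4 * embC p q + 4 * embC p q = 8 * embC p q := by ring
  rw [h2] at h1
  refine h1.congr (fun i k => (hb _ i k).sub (hb _ i k))
    (bddSym_diagSym fun i => bddSym_indicator measurableSet_Icc) fun i k => ?_
  by_cases hik : i = k
  · have hne : ∀ᵐ ξ : ℝ, ξ ≠ -max (t i) 0 :=
      compl_mem_ae_iff.2 (measure_singleton _)
    filter_upwards [hne] with ξ hξ
    simp only [diagSym, hik, if_true]
    rw [hik] at hξ
    simp only [Set.indicator_apply, Set.mem_Ioi, Set.mem_Icc]
    rcases le_total (t k) 0 with ht | ht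
    · simp only [max_eq_right ht] at hξ ⊢
      rw [neg_zero, sub_self, if_neg]
      rintro ⟨h3, h4⟩
      exact hξ (by linarith)
    · simp only [max_eq_left ht] at hξ ⊢
      have h5 : -t k < ξ ↔ -t k ≤ ξ := ⟨le_of_lt, fun h => lt_of_le_of_ne h hξ.symm⟩
      by_cases h3 : -t k ≤ ξ
      · by_cases h4 : ξ ≤ t k
        · simp [h5, h3, h4, h4.not_gt]
        · simp [h5, h3, h4, not_le.1 h4]
      · have h4 : ¬ t k < ξ := by intro h; apply h3; linarith
        simp [h5, h3, h4]
  · refine ae_of_all _ fun ξ => ?_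
    simp [diagSym, hik]

end HalfLines

section Column

variable {ι κ : Type} [Fintype ι] [Fintype κ] {p q : ℝ}

theorem formBd_laplaceSym (hpq : p.HolderConjugate q) {M : ι → κ → ℝ → ℝ}
    (hw : ∀ i k, BddSym (laplaceSym (M i k)))
    (hM : ∀ i k, Measurable (M i k)) {D B : ℝ} (hD : ∀ i k y, |M i k y| ≤ D)
    (hB0 : 0 ≤ B) (hB : ∀ y, 0 < y → ∀ (a : EuclideanSpace ℂ ι) (b : EuclideanSpace ℂ κ),
      ‖∑ i, ∑ k, (M i k y : ℂ) * (a i * (starRingEnd ℂ) (b k))‖ ≤ B * ‖a‖ * ‖b‖) :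
    FormBd (fun i k => laplaceSym (M i k)) p q (ENNReal.ofReal (B * embC p q)) := by
  refine formBd_of_integrable hw fun f g hf hf2 hg hg2 hfp hgq => ?_
  have key := norm_form_le hpq hf hf2 hg hg2 hM hD hB0 hB hfp hgq
  rw [← ofReal_norm]
  refine (ENNReal.ofReal_le_ofReal key).trans_eq ?_
  have h0 := embC_nonneg p q
  rw [ENNReal.ofReal_mul (by positivity), ENNReal.ofReal_mul (by positivity),
    ENNReal.ofReal_toReal hfp.2.ne, ENNReal.ofReal_toReal hgq.2.ne]

theorem fourier_comp_neg (f : ℝ → ℂ) (ξ : ℝ) : 𝓕 (fun x => f (-x)) ξ = 𝓕 f (-ξ) := by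
  rw [← Real.fourierInv_eq_fourier_comp_neg, Real.fourierInv_eq_fourier_neg]

theorem eLpNorm_comp_neg' {E : Type*} [NormedAddCommGroup E] {f : ℝ → E} {r : ENNReal}
    (hf : AEStronglyMeasurable f) : eLpNorm (fun x => f (-x)) r volume = eLpNorm f r volume :=
  eLpNorm_comp_measurePreserving hf (Measure.measurePreserving_neg volume)

theorem memLp_comp_neg {E : Type*} [NormedAddCommGroup E] {f : ℝ → E} {r : ENNReal}
    (hf : MemLp f r) : MemLp (fun x => f (-x)) r :=
  hf.comp_measurePreserving (Measure.measurePreserving_neg volume)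

theorem formBd_laplaceSym_neg (hpq : p.HolderConjugate q) {M : ι → κ → ℝ → ℝ}
    (hw : ∀ i k, BddSym (laplaceSym (M i k)))
    (hM : ∀ i k, Measurable (M i k)) {D B : ℝ} (hD : ∀ i k y, |M i k y| ≤ D)
    (hB0 : 0 ≤ B) (hB : ∀ y, 0 < y → ∀ (a : EuclideanSpace ℂ ι) (b : EuclideanSpace ℂ κ),
      ‖∑ i, ∑ k, (M i k y : ℂ) * (a i * (starRingEnd ℂ) (b k))‖ ≤ B * ‖a‖ * ‖b‖) :
    FormBd (fun i k ξ => laplaceSym (M i k) (-ξ)) p q (ENNReal.ofReal (B * embC p q)) := by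
  refine formBd_of_integrable (fun i k => ⟨(hw i k).meas.comp measurable_neg, ?_⟩)
    fun f g hf hf2 hg hg2 hfp hgq => ?_
  · obtain ⟨C, hC⟩ := (hw i k).bdd
    exact ⟨C, fun ξ => hC _⟩
  have a1 : vecFun (fun i x => f i (-x)) = fun x => vecFun f (-x) := rfl
  have a2 : vecFun (fun i x => g i (-x)) = fun x => vecFun g (-x) := rfl
  have m1 : MemLp (vecFun fun i x => f i (-x)) (ENNReal.ofReal p) := by
    rw [a1]; exact memLp_comp_neg hfp
  have m2 : MemLp (vecFun fun i x => g i (-x)) (ENNReal.ofReal q) := by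
    rw [a2]; exact memLp_comp_neg hgq
  have key := norm_form_le hpq (f := fun i x => f i (-x)) (g := fun i x => g i (-x))
    (fun i => (hf i).comp_neg) (fun i => memLp_comp_neg (hf2 i))
    (fun i => (hg i).comp_neg) (fun i => memLp_comp_neg (hg2 i)) hM hD hB0 hB m1 m2
  rw [a1, a2, eLpNorm_comp_neg' hfp.1, eLpNorm_comp_neg' hgq.1] at key
  have e : ∀ i k, ∫ ξ, (laplaceSym (M i k) (-ξ) : ℂ) *
      (𝓕 (f i) ξ * (starRingEnd ℂ) (𝓕 (g k) ξ)) =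
      ∫ ξ, (laplaceSym (M i k) ξ : ℂ) *
        (𝓕 (fun x => f i (-x)) ξ * (starRingEnd ℂ) (𝓕 (fun x => g k (-x)) ξ)) := fun i k => by
    rw [← integral_neg_eq_self]
    simp only [fourier_comp_neg, neg_neg]
  simp only [Function.comp_apply, e]
  rw [← ofReal_norm]
  refine (ENNReal.ofReal_le_ofReal key).trans_eq ?_
  have h0 := embC_nonneg p q
  rw [ENNReal.ofReal_mul (by positivity), ENNReal.ofReal_mul (by positivity),
    ENNReal.ofReal_toReal hfp.2.ne, ENNReal.ofReal_toReal hgq.2.ne]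

theorem sum_sub_le_one {Φ : ℤ → ℝ} (h0 : ∀ k, 0 ≤ Φ k) (h1 : ∀ k, Φ k ≤ 1) (hΦ : Antitone Φ)
    (s : Finset ℤ) : ∑ k ∈ s, (Φ k - Φ (k + 1)) ≤ 1 := by
  obtain ⟨a, ha⟩ := s.bddBelow
  obtain ⟨b, hb⟩ := s.bddAbove
  have hs : s ⊆ (Finset.range (b + 1 - a).toNat).image fun n : ℕ => a + (n : ℤ) := fun k hk => by
    have h2 := ha hk
    have h3 := hb hk
    refine Finset.mem_image.2 ⟨(k - a).toNat, Finset.mem_range.2 (by omega), by omega⟩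
  calc _ ≤ ∑ k ∈ (Finset.range (b + 1 - a).toNat).image fun n : ℕ => a + (n : ℤ),
        (Φ k - Φ (k + 1)) :=
        Finset.sum_le_sum_of_subset_of_nonneg hs fun k _ _ =>
          sub_nonneg.2 (hΦ (by omega))
    _ = ∑ n ∈ Finset.range (b + 1 - a).toNat, (Φ (a + n) - Φ (a + (n + 1 : ℕ))) := by
        rw [Finset.sum_image fun x _ y _ h => by simpa using h]
        refine Finset.sum_congr rfl fun n _ => ?_
        congr 2
        push_cast
        ring
    _ = Φ (a + (0 : ℕ)) - Φ (a + ((b + 1 - a).toNat : ℕ)) :=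
        Finset.sum_range_sub' (fun n : ℕ => Φ (a + n)) _
    _ ≤ 1 := by linarith [h1 (a + (0 : ℕ)), h0 (a + ((b + 1 - a).toNat : ℕ))]

theorem four_mul_sq_mul_exp_le {v : ℝ} (hv : 0 ≤ v) :
    (2 * v * Real.exp (-v)) ^ 2 ≤ 64 / 3 * (v ^ 2 / (1 + v ^ 2) - (v / 2) ^ 2 / (1 + (v / 2) ^ 2)) := by
  have h1 : v ^ 2 / (1 + v ^ 2) - (v / 2) ^ 2 / (1 + (v / 2) ^ 2) =
      3 * v ^ 2 / ((1 + v ^ 2) * (4 + v ^ 2)) := by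
    field_simp
    ring
  have h2 := Real.quadratic_le_exp_of_nonneg hv
  have h3 : (4 + 5 * v ^ 2 + v ^ 4) ≤ 16 * Real.exp v ^ 2 := by
    have h4 : (1 + v + v ^ 2 / 2) ^ 2 ≤ Real.exp v ^ 2 := by gcongr
    nlinarith [pow_nonneg hv 2, pow_nonneg hv 3, pow_nonneg hv 4]
  rw [h1, Real.exp_neg]
  have h5 := Real.exp_pos v
  have h6 : (2 * v * (Real.exp v)⁻¹) ^ 2 = 4 * v ^ 2 / Real.exp v ^ 2 := by
    field_simp
    ring
  rw [h6, mul_div_assoc', div_le_div_iff₀ (by positivity) (by positivity)]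
  nlinarith [mul_le_mul_of_nonneg_left h3 (sq_nonneg v)]

/-- The symbol of the smooth square function at scale `t`. -/
noncomputable def chiSym (t ξ : ℝ) : ℝ := ξ ^ 2 * t / (t + |ξ|) ^ 3

/-- The weight whose Laplace symbol is `chiSym` on the positive half-line. -/
noncomputable def chiWeight (t y : ℝ) : ℝ := 2 * (4 * π * t * |y|) * Real.exp (-(4 * π * t * |y|))

theorem measurable_chiWeight (t : ℝ) : Measurable (chiWeight t) := by
  unfold chiWeight
  exact Continuous.measurable (by fun_prop)

theorem abs_chiWeight_le {t : ℝ} (ht : 0 < t) (y : ℝ) : |chiWeight t y| ≤ 2 := by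
  unfold chiWeight
  have hv : 0 ≤ 4 * π * t * |y| := by positivity
  set v := 4 * π * t * |y|
  rw [abs_of_nonneg (by positivity), Real.exp_neg, ← div_eq_mul_inv,
    div_le_iff₀ (Real.exp_pos v)]
  linarith [Real.add_one_le_exp v]

theorem laplaceSym_chiWeight {t : ℝ} (ht : 0 < t) (ξ : ℝ) :
    laplaceSym (chiWeight t) ξ = (Set.Ioi (0 : ℝ)).indicator (fun ξ => chiSym t ξ) ξ := by
  unfold laplaceSym
  by_cases h : 0 < ξ
  · have h1 : ∀ y ∈ Set.Ioi (0 : ℝ), y * chiWeight t y * ‖cauchySym y ξ‖ ^ 2 =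
        (32 * π ^ 3 * t * ξ ^ 2) * (y ^ 2 * Real.exp (-((4 * π * (t + ξ)) * y))) := fun y hy => by
      have hy0 : (0 : ℝ) < y := hy
      rw [norm_cauchySym_sq, Set.indicator_of_mem (Set.mem_Ioi.2 h), chiWeight, abs_of_pos hy0]
      have : Real.exp (-((4 * π * (t + ξ)) * y)) =
          Real.exp (-(4 * π * t * y)) * Real.exp (-(4 * π * y * ξ)) := by
        rw [← Real.exp_add]; congr 1; ring
      rw [this]
      ring
    rw [setIntegral_congr_fun measurableSet_Ioi h1, integral_const_mul,
      integral_mul_exp_Ioi (by positivity) 2, Set.indicator_of_mem (Set.mem_Ioi.2 h), chiSym,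
      abs_of_pos h]
    have hπ := Real.pi_pos
    have : t + ξ ≠ 0 := by positivity
    field_simp
    norm_num [Nat.factorial]
    ring
  · simp [norm_cauchySym_sq, h]

theorem chiSym_nonneg {t : ℝ} (ht : 0 < t) (ξ : ℝ) : 0 ≤ chiSym t ξ := by
  unfold chiSym; positivity

theorem chiSym_le_one {t : ℝ} (ht : 0 < t) (ξ : ℝ) : chiSym t ξ ≤ 1 := by
  unfold chiSym
  have h := abs_nonneg ξ
  rw [div_le_one (by positivity), ← sq_abs]
  nlinarith [pow_pos ht 3, pow_pos ht 2, pow_nonneg h 3, mul_nonneg h (sq_nonneg t),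
    mul_nonneg ht.le (sq_nonneg |ξ|)]

theorem bddSym_chiSym {t : ℝ} (ht : 0 < t) : BddSym (chiSym t) :=
  ⟨by unfold chiSym; exact Measurable.div (by fun_prop) (by fun_prop), 1, fun ξ => by
    rw [abs_of_nonneg (chiSym_nonneg ht ξ)]; exact chiSym_le_one ht ξ⟩

theorem bddSym_laplaceSym_chiWeight {t : ℝ} (ht : 0 < t) : BddSym (laplaceSym (chiWeight t)) := by
  have : laplaceSym (chiWeight t) = fun ξ =>
      (Set.Ioi (0 : ℝ)).indicator (fun _ => 1) ξ * chiSym t ξ := by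
    ext ξ
    rw [laplaceSym_chiWeight ht]
    by_cases h : 0 < ξ
    · simp [h]
    · simp [h]
  rw [this]
  exact (bddSym_indicator measurableSet_Ioi).mul (bddSym_chiSym ht)

theorem sum_chiWeight_sq_le {e : κ → ℤ} (he : Function.Injective e) (y : ℝ) :
    ∑ k, chiWeight ((2 : ℝ) ^ (-e k)) y ^ 2 ≤ 25 := by
  classical
  let V : ℤ → ℝ := fun k => 4 * π * (2 : ℝ) ^ (-k) * |y|
  have hV0 : ∀ k, 0 ≤ V k := fun k => by positivity
  let Φ : ℤ → ℝ := fun k => V k ^ 2 / (1 + V k ^ 2)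
  have hV : ∀ k, V (k + 1) = V k / 2 := fun k => by
    simp only [V]
    rw [neg_add, zpow_add₀ two_ne_zero]
    simp only [zpow_neg, zpow_one]
    ring
  have hΦ0 : ∀ k, 0 ≤ Φ k := fun k => by positivity
  have hΦ1 : ∀ k, Φ k ≤ 1 := fun k => by
    simp only [Φ]
    rw [div_le_one (by positivity)]
    linarith
  have hΦ : Antitone Φ := antitone_int_of_succ_le fun k => by
    simp only [Φ]
    rw [hV, div_le_div_iff₀ (by positivity) (by positivity)]
    nlinarith [sq_nonneg (V k)]
  have h1 := sum_sub_le_one hΦ0 hΦ1 hΦ (Finset.univ.image e)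
  rw [Finset.sum_image fun x _ y _ h => he h] at h1
  calc ∑ k, chiWeight ((2 : ℝ) ^ (-e k)) y ^ 2 ≤ ∑ k, 64 / 3 * (Φ (e k) - Φ (e k + 1)) := by
        refine Finset.sum_le_sum fun k _ => ?_
        have := four_mul_sq_mul_exp_le (hV0 (e k))
        simp only [Φ, hV]
        exact this
    _ ≤ 25 := by rw [← Finset.mul_sum]; linarith

/-- The smooth dyadic square function is bounded on `L^p`. -/
theorem formBd_chiSym (hpq : p.HolderConjugate q) {e : κ → ℤ} (he : Function.Injective e) :
    FormBd (fun (_ : Unit) k => chiSym ((2 : ℝ) ^ (-e k))) p q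
      (ENNReal.ofReal (10 * embC p q)) := by
  have ht : ∀ k, (0 : ℝ) < (2 : ℝ) ^ (-e k) := fun k => by positivity
  have hB : ∀ y : ℝ, 0 < y → ∀ (a : EuclideanSpace ℂ Unit) (b : EuclideanSpace ℂ κ),
      ‖∑ i, ∑ k, (chiWeight ((2 : ℝ) ^ (-e k)) y : ℂ) * (a i * (starRingEnd ℂ) (b k))‖ ≤
        5 * ‖a‖ * ‖b‖ := fun y _ a b => by
    have ha : ‖a ()‖ = ‖a‖ := by
      rw [EuclideanSpace.norm_eq]
      simp
    simp only [Finset.univ_unique, Finset.sum_singleton]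
    have h1 : ∑ k, ‖(chiWeight ((2 : ℝ) ^ (-e k)) y : ℂ) *
        (a () * (starRingEnd ℂ) (b k))‖ = ‖a‖ * ∑ k, |chiWeight ((2 : ℝ) ^ (-e k)) y| * ‖b k‖ := by
      rw [Finset.mul_sum]
      refine Finset.sum_congr rfl fun k _ => ?_
      rw [norm_mul, norm_mul, ha, RCLike.norm_conj, Complex.norm_real, Real.norm_eq_abs]
      ring
    have h2 : ∑ k, |chiWeight ((2 : ℝ) ^ (-e k)) y| * ‖b k‖ ≤ 5 * ‖b‖ := by
      refine abs_le_of_sq_le_sq' ?_ (by positivity) |>.2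
      refine (Finset.sum_mul_sq_le_sq_mul_sq _ _ _).trans ?_
      simp only [sq_abs]
      rw [mul_pow, EuclideanSpace.norm_sq_eq]
      have := sum_chiWeight_sq_le he y
      gcongr
      linarith
    refine (norm_sum_le _ _).trans ?_
    rw [show (default : Unit) = () from rfl, h1]
    calc _ ≤ ‖a‖ * (5 * ‖b‖) := by gcongr
      _ = _ := by ring
  have hw : ∀ (_ : Unit) k, BddSym (laplaceSym (chiWeight ((2 : ℝ) ^ (-e k)))) := fun _ k =>
    bddSym_laplaceSym_chiWeight (ht k)
  have h1 := formBd_laplaceSym hpq (M := fun _ k => chiWeight ((2 : ℝ) ^ (-e k))) hw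
    (fun _ k => measurable_chiWeight _) (fun _ k y => abs_chiWeight_le (ht k) y) (by norm_num) hB
  have h2 := formBd_laplaceSym_neg hpq (M := fun _ k => chiWeight ((2 : ℝ) ^ (-e k))) hw
    (fun _ k => measurable_chiWeight _) (fun _ k y => abs_chiWeight_le (ht k) y) (by norm_num) hB
  have hw' : ∀ (_ : Unit) k, BddSym fun ξ => laplaceSym (chiWeight ((2 : ℝ) ^ (-e k))) (-ξ) :=
    fun i k => ⟨(hw i k).meas.comp measurable_neg, by
      obtain ⟨C, hC⟩ := (hw i k).bdd
      exact ⟨C, fun ξ => hC _⟩⟩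
  have h3 := h1.add hw hw' h2
  have h0 := embC_nonneg p q
  rw [← ENNReal.ofReal_add (by positivity) (by positivity),
    show 5 * embC p q + 5 * embC p q = 10 * embC p q by ring] at h3
  refine h3.congr (fun i k => (hw i k).add (hw' i k)) (fun _ k => bddSym_chiSym (ht k))
    fun _ k => ae_of_all _ fun ξ => ?_
  beta_reduce
  rw [laplaceSym_chiWeight (ht k), laplaceSym_chiWeight (ht k)]
  rcases lt_trichotomy 0 ξ with h | h | h
  · simp [h, h.not_gt]
  · simp [← h, chiSym]
  · simp [h, h.not_gt, chiSym]

end Column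

section LittlewoodPaley

variable {ι κ : Type} [Fintype ι] [Fintype κ] {p q : ℝ}

theorem FormBd.const_mul {w : ι → κ → ℝ → ℝ} {C : ENNReal} (hw : ∀ i k, BddSym (w i k))
    (hw1 : ∀ i k ξ, |w i k ξ| ≤ 1) (h : FormBd w p q C) (c : ℝ) :
    FormBd (fun i k ξ => c * w i k ξ) p q (‖c‖ₑ * C) := by
  have := FormBd.integral (W := fun _ => w) (m := Measure.dirac (0 : ℝ)) (ν := fun _ => c)
    (integrable_const _) (fun i k => (hw i k).meas.comp measurable_snd) (fun _ => hw1) fun _ => h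
  simpa using this

theorem abs_indicator_one_le (s : Set ℝ) (ξ : ℝ) : |s.indicator (fun _ => (1 : ℝ)) ξ| ≤ 1 := by
  by_cases h : ξ ∈ s <;> simp [h]

theorem abs_diagSym_le {ι : Type}
    {w : ι → ℝ → ℝ} (hw : ∀ i ξ, |w i ξ| ≤ 1) (i k : ι) (ξ : ℝ) :
    |diagSym w i k ξ| ≤ 1 := by
  unfold diagSym
  split_ifs
  · exact hw _ _
  · simp

/-- The rough band cut off at scale `t`, weighted by a function of `|ξ| / t`. -/
noncomputable def bandWeight (h : ℝ → ℝ) (t ξ : ℝ) : ℝ :=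
  (Set.Ioc (1 / 2) 1).indicator h (|ξ| / t)

theorem bandWeight_eq {h h' : ℝ → ℝ} (hd : ∀ s ∈ Set.Icc (1 / 2 : ℝ) 1, HasDerivAt h (h' s) s)
    (hc : ContinuousOn h' (Set.Icc (1 / 2) 1)) {t : ℝ} (ht : 0 < t) (ξ : ℝ) :
    bandWeight h t ξ = h 1 * (Set.Icc (-(1 * t)) (1 * t)).indicator (fun _ => 1) ξ +
      -h (1 / 2) * (Set.Icc (-(1 / 2 * t)) (1 / 2 * t)).indicator (fun _ => 1) ξ +
      ∫ s in Set.Ioc (1 / 2) 1, -h' s * (Set.Icc (-(s * t)) (s * t)).indicator (fun _ => 1) ξ := by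
  have hmem : ∀ s : ℝ, ξ ∈ Set.Icc (-(s * t)) (s * t) ↔ |ξ| / t ≤ s := fun s => by
    rw [Set.mem_Icc, ← abs_le, div_le_iff₀ ht]
  have hind : ∀ s : ℝ, (Set.Icc (-(s * t)) (s * t)).indicator (fun _ => (1 : ℝ)) ξ =
      (Set.Ici (|ξ| / t)).indicator (fun _ => 1) s := fun s => by
    by_cases h0 : |ξ| / t ≤ s
    · rw [Set.indicator_of_mem ((hmem s).2 h0), Set.indicator_of_mem (Set.mem_Ici.2 h0)]
    · rw [Set.indicator_of_notMem fun h1 => h0 ((hmem s).1 h1),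
        Set.indicator_of_notMem (s := Set.Ici (|ξ| / t)) fun h1 => h0 h1]
  simp only [hind, bandWeight]
  set r := |ξ| / t
  have hftc : ∀ a, 1 / 2 ≤ a → a ≤ 1 → ∫ s in Set.Ioc a 1, h' s = h 1 - h a := fun a ha1 ha2 => by
    rw [← intervalIntegral.integral_of_le ha2]
    refine intervalIntegral.integral_eq_sub_of_hasDerivAt (fun s hs => hd s ?_) ?_
    · rw [Set.uIcc_of_le ha2] at hs
      exact ⟨ha1.trans hs.1, hs.2⟩
    · exact (hc.mono (by rw [Set.uIcc_of_le ha2]; exact Set.Icc_subset_Icc_left ha1)).intervalIntegrable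
  have hint : ∫ s in Set.Ioc (1 / 2) 1, -h' s * (Set.Ici r).indicator (fun _ => 1) s =
      -∫ s in Set.Ioc (1 / 2) 1 ∩ Set.Ici r, h' s := by
    rw [← setIntegral_indicator measurableSet_Ici, ← integral_neg]
    congr 1 with s
    by_cases hs : s ∈ Set.Ici r <;> simp [hs]
  rw [hint]
  rcases le_or_gt r (1 / 2) with h1 | h1
  · have e : Set.Ioc (1 / 2) 1 ∩ Set.Ici r = Set.Ioc (1 / 2) 1 :=
      Set.inter_eq_left.2 fun s hs => h1.trans hs.1.le
    rw [e, hftc _ le_rfl (by norm_num)]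
    have h2 : r ∉ Set.Ioc (1 / 2 : ℝ) 1 := fun hh => absurd hh.1 (not_lt.2 h1)
    have h3 : r ≤ 1 := h1.trans (by norm_num)
    rw [Set.indicator_of_notMem h2, Set.indicator_of_mem (Set.mem_Ici.2 h3),
      Set.indicator_of_mem (Set.mem_Ici.2 h1)]
    ring
  · have h2 : (1 / 2 : ℝ) ∉ Set.Ici r := fun hh => absurd h1 (not_lt.2 hh)
    rw [Set.indicator_of_notMem h2]
    rcases le_or_gt r 1 with h3 | h3
    · have e : Set.Ioc (1 / 2) 1 ∩ Set.Ici r = Set.Icc r 1 := by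
        ext s
        simp only [Set.mem_inter_iff, Set.mem_Ioc, Set.mem_Ici, Set.mem_Icc]
        exact ⟨fun hh => ⟨hh.2, hh.1.2⟩, fun hh => ⟨⟨h1.trans_le hh.1, hh.2⟩, hh.1⟩⟩
      rw [e, integral_Icc_eq_integral_Ioc, hftc r h1.le h3,
        Set.indicator_of_mem (Set.mem_Ioc.2 ⟨h1, h3⟩), Set.indicator_of_mem (Set.mem_Ici.2 h3)]
      ring
    · have e : Set.Ioc (1 / 2) 1 ∩ Set.Ici r = ∅ := by
        ext s
        simp only [Set.mem_inter_iff, Set.mem_Ioc, Set.mem_Ici, Set.mem_empty_iff_false, iff_false]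
        exact fun hh => absurd (hh.2.trans hh.1.2) (not_le.2 h3)
      have h4 : r ∉ Set.Ioc (1 / 2 : ℝ) 1 := fun hh => absurd hh.2 (not_le.2 h3)
      have h5 : (1 : ℝ) ∉ Set.Ici r := fun hh => absurd h3 (not_lt.2 hh)
      rw [e, Set.indicator_of_notMem h4, Set.indicator_of_notMem h5]
      simp

/-- Multipliers of bounded variation supported on bands act boundedly on `L^p(ℓ²)`. -/
theorem exists_formBd_bandWeight (hpq : p.HolderConjugate q) {h h' : ℝ → ℝ}
    (hd : ∀ s ∈ Set.Icc (1 / 2 : ℝ) 1, HasDerivAt h (h' s) s)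
    (hc : ContinuousOn h' (Set.Icc (1 / 2) 1)) :
    ∃ C : ENNReal, C ≠ ⊤ ∧ ∀ (ι : Type) [Fintype ι] (t : ι → ℝ), (∀ i, 0 < t i) →
      (∀ i, BddSym (bandWeight h (t i))) ∧ FormBd (diagSym fun i => bandWeight h (t i)) p q C := by
  set A := ENNReal.ofReal (8 * embC p q)
  have hint : Integrable (fun s => -h' s) (volume.restrict (Set.Ioc (1 / 2) 1)) :=
    ((hc.integrableOn_Icc).mono_set Set.Ioc_subset_Icc_self).neg
  refine ⟨‖h 1‖ₑ * A + ‖-h (1 / 2)‖ₑ * A + (∫⁻ s in Set.Ioc (1 / 2) 1, ‖-h' s‖ₑ) * A, ?_, ?_⟩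
  · refine ENNReal.add_ne_top.2 ⟨ENNReal.add_ne_top.2 ⟨?_, ?_⟩, ?_⟩
    · exact ENNReal.mul_ne_top enorm_ne_top ENNReal.ofReal_ne_top
    · exact ENNReal.mul_ne_top enorm_ne_top ENNReal.ofReal_ne_top
    · exact ENNReal.mul_ne_top hint.2.ne ENNReal.ofReal_ne_top
  intro ι _ t ht
  have hb : ∀ s : ℝ, ∀ i k, BddSym
      (diagSym (fun i => (Set.Icc (-(s * t i)) (s * t i)).indicator fun _ => 1) i k) := fun s =>
    bddSym_diagSym fun i => bddSym_indicator measurableSet_Icc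
  have hb1 := fun s : ℝ => abs_diagSym_le (w := fun i =>
    (Set.Icc (-(s * t i)) (s * t i)).indicator fun _ => (1 : ℝ)) fun i ξ => abs_indicator_one_le _ ξ
  have f1 := fun s : ℝ => formBd_interval hpq fun i => s * t i
  have hm : ∀ i k, Measurable fun z : ℝ × ℝ => diagSym (fun i =>
      (Set.Icc (-(z.1 * t i)) (z.1 * t i)).indicator fun _ => (1 : ℝ)) i k z.2 := fun i k => by
    unfold diagSym
    split_ifs
    · have hset : MeasurableSet {z : ℝ × ℝ | -(z.1 * t i) ≤ z.2 ∧ z.2 ≤ z.1 * t i} :=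
        (measurableSet_le (f := fun z : ℝ × ℝ => -(z.1 * t i)) (g := fun z => z.2)
          (by fun_prop) (by fun_prop)).inter
          (measurableSet_le (f := fun z : ℝ × ℝ => z.2) (g := fun z => z.1 * t i)
            (by fun_prop) (by fun_prop))
      exact (measurable_const (a := (1 : ℝ))).indicator hset
    · exact measurable_const
  have g1 := (f1 1).const_mul (hb 1) (hb1 1) (h 1)
  have g2 := (f1 (1 / 2)).const_mul (hb (1 / 2)) (hb1 (1 / 2)) (-h (1 / 2))
  have g3 := FormBd.integral hint hm hb1 f1
  have hbw : ∀ i, BddSym (bandWeight h (t i)) := fun i => by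
    have hcont : ContinuousOn h (Set.Icc (1 / 2) 1) := fun s hs =>
      (hd s hs).continuousAt.continuousWithinAt
    obtain ⟨D, hD⟩ := isCompact_Icc.exists_bound_of_continuousOn hcont
    refine ⟨?_, max D 0, fun ξ => ?_⟩
    · have h1 : Measurable ((Set.Ioc (1 / 2) 1).indicator h) := by
        classical
        rw [← Set.piecewise_eq_indicator]
        exact (hcont.mono Set.Ioc_subset_Icc_self).measurable_piecewise continuousOn_const
          measurableSet_Ioc
      exact h1.comp (by fun_prop)
    · unfold bandWeight
      by_cases hs : |ξ| / t i ∈ Set.Ioc (1 / 2 : ℝ) 1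
      · rw [Set.indicator_of_mem hs]
        exact (hD _ ⟨hs.1.le, hs.2⟩).trans (le_max_left _ _)
      · rw [Set.indicator_of_notMem hs, abs_zero]
        exact le_max_right _ _
  refine ⟨hbw, ?_⟩
  have hk : ∀ i k ξ, diagSym (fun i => bandWeight h (t i)) i k ξ =
      h 1 * diagSym (fun i => (Set.Icc (-(1 * t i)) (1 * t i)).indicator fun _ => 1) i k ξ +
      -h (1 / 2) * diagSym (fun i =>
        (Set.Icc (-(1 / 2 * t i)) (1 / 2 * t i)).indicator fun _ => 1) i k ξ +
      ∫ s in Set.Ioc (1 / 2) 1, -h' s *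
        diagSym (fun i => (Set.Icc (-(s * t i)) (s * t i)).indicator fun _ => 1) i k ξ := by
    intro i k ξ
    by_cases hik : i = k
    · simp only [diagSym, hik, if_true]
      exact bandWeight_eq hd hc (ht k) ξ
    · simp [diagSym, hik]
  have b1 := fun i k => (hb 1 i k).const_mul (h 1)
  have b2 := fun i k => (hb (1 / 2) i k).const_mul (-h (1 / 2))
  have b12 := fun i k => (b1 i k).add (b2 i k)
  have b3 : ∀ i k, BddSym fun ξ => ∫ s in Set.Ioc (1 / 2) 1, -h' s *
      diagSym (fun i => (Set.Icc (-(s * t i)) (s * t i)).indicator fun _ => 1) i k ξ := fun i k => by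
    have := (bddSym_diagSym hbw i k).sub (b12 i k)
    refine cast (congrArg BddSym (funext fun ξ => ?_)) this
    rw [hk]
    ring
  exact ((g1.add b1 b2 g2).add b12 b3 g3).congr (fun i k => (b12 i k).add (b3 i k))
    (bddSym_diagSym hbw) fun i k => ae_of_all _ fun ξ => (hk i k ξ).symm

end LittlewoodPaley

section SquareFunctions

variable {ι κ : Type} [Fintype ι] [Fintype κ] {p q : ℝ}

theorem memLp_vecLp_of_le {f : ι → L2R} {r B : ENNReal} (h : eLpNorm (vecLp f) r volume ≤ B)
    (hB : B ≠ ⊤) : MemLp (vecLp f) r :=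
  ⟨(stronglyMeasurable_vecLp f).aestronglyMeasurable, h.trans_lt hB.lt_top⟩

theorem DiagBd.comp_colBd {w v : ι → ℝ → ℝ} {C D : ENNReal} (hw : DiagBd w p C) (hv : ColBd v p D)
    (hbw : ∀ i, BddSym (w i)) (hbv : ∀ i, BddSym (v i)) (hD : D ≠ ⊤) :
    ColBd (fun i ξ => w i ξ * v i ξ) p (C * D) := fun f hf => by
  have h1 := hv f hf
  have h2 := hw _ (memLp_vecLp_of_le h1 (ENNReal.mul_ne_top hD hf.2.ne))
  simp only [mulT_mulT (hbw _) (hbv _)] at h2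
  refine h2.trans ?_
  rw [mul_assoc]
  gcongr

theorem exists_colBd_bandWeight (hpq : p.HolderConjugate q) {h h' : ℝ → ℝ}
    (hd : ∀ s ∈ Set.Icc (1 / 2 : ℝ) 1, HasDerivAt h (h' s) s)
    (hc : ContinuousOn h' (Set.Icc (1 / 2) 1)) :
    ∃ C : ENNReal, C ≠ ⊤ ∧ ∀ (κ : Type) [Fintype κ] (e : κ → ℤ), Function.Injective e →
      (∀ k, BddSym (bandWeight h ((2 : ℝ) ^ (-e k)))) ∧
        ColBd (fun k => bandWeight h ((2 : ℝ) ^ (-e k))) p C := by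
  have hg : ∀ s ∈ Set.Icc (1 / 2 : ℝ) 1, HasDerivAt (fun s : ℝ => (1 + s) ^ 3 / s ^ 2)
      ((3 * (1 + s) ^ 2 * s ^ 2 - (1 + s) ^ 3 * (2 * s)) / (s ^ 2) ^ 2) s := fun s hs => by
    have hs0 : s ≠ 0 := by linarith [hs.1]
    have h1 : HasDerivAt (fun s : ℝ => (1 + s) ^ 3) (3 * (1 + s) ^ 2) s := by
      have h := ((hasDerivAt_id' s).const_add 1).fun_pow 3
      simpa using h
    have h2 : HasDerivAt (fun s : ℝ => s ^ 2) (2 * s) s := by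
      have h := (hasDerivAt_id' s).fun_pow 2
      simpa using h
    exact h1.div h2 (pow_ne_zero 2 hs0)
  have hgc : ContinuousOn (fun s : ℝ => (1 + s) ^ 3 / s ^ 2) (Set.Icc (1 / 2) 1) := fun s hs =>
    (hg s hs).continuousAt.continuousWithinAt
  have hhc : ContinuousOn h (Set.Icc (1 / 2) 1) := fun s hs =>
    (hd s hs).continuousAt.continuousWithinAt
  have hg'c : ContinuousOn (fun s : ℝ => (3 * (1 + s) ^ 2 * s ^ 2 - (1 + s) ^ 3 * (2 * s)) /
      (s ^ 2) ^ 2) (Set.Icc (1 / 2) 1) := by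
    refine ContinuousOn.div (by fun_prop) (by fun_prop) fun s hs => ?_
    have hs0 : s ≠ 0 := by linarith [hs.1]
    positivity
  obtain ⟨C, hC, H⟩ := exists_formBd_bandWeight hpq (fun s hs => (hd s hs).mul (hg s hs))
    ((hc.mul hgc).add (hhc.mul hg'c))
  obtain ⟨C', hC', H'⟩ := exists_formBd_bandWeight hpq hd hc
  refine ⟨C * ENNReal.ofReal (10 * embC p q), ENNReal.mul_ne_top hC ENNReal.ofReal_ne_top, ?_⟩
  intro κ _ e he
  have ht : ∀ k, (0 : ℝ) < 2 ^ (-e k) := fun k => by positivity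
  obtain ⟨b1, F1⟩ := H κ (fun k => (2 : ℝ) ^ (-e k)) ht
  obtain ⟨b2, -⟩ := H' κ (fun k => (2 : ℝ) ^ (-e k)) ht
  refine ⟨b2, ?_⟩
  have key := (F1.diagBd hpq).comp_colBd ((formBd_chiSym hpq he).colBd hpq) b1
    (fun k => bddSym_chiSym (ht k)) ENNReal.ofReal_ne_top
  refine cast (congrArg (fun w => ColBd w p _) (funext fun k => funext fun ξ => ?_)) key
  unfold bandWeight
  by_cases hs : |ξ| / (2 : ℝ) ^ (-e k) ∈ Set.Ioc (1 / 2 : ℝ) 1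
  · rw [Set.indicator_of_mem hs, Set.indicator_of_mem hs, Pi.mul_apply, chiSym, ← sq_abs ξ]
    have h0 := ht k
    set t := (2 : ℝ) ^ (-e k)
    have h1 : 0 < |ξ| / t := lt_trans (by norm_num) hs.1
    have h2 : 0 < |ξ| := by
      have := mul_pos h1 h0
      rwa [div_mul_cancel₀ _ h0.ne'] at this
    field_simp
  · rw [Set.indicator_of_notMem hs, Set.indicator_of_notMem hs, zero_mul]

/-- The symbol of the rough band `2^{-j-1} ≤ |ξ| ≤ 2^{-j}`. -/
noncomputable def bandSym (j : ℤ) : ℝ → ℝ :=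
  {ξ : ℝ | (2 : ℝ) ^ (-j - 1) ≤ |ξ| ∧ |ξ| ≤ (2 : ℝ) ^ (-j)}.indicator fun _ => 1

/-- The symbol of the rough low-frequency cutoff `|ξ| ≤ 2^{-j}`. -/
noncomputable def lowSym (j : ℤ) : ℝ → ℝ :=
  (Set.Icc (-(2 : ℝ) ^ (-j)) ((2 : ℝ) ^ (-j))).indicator fun _ => 1

theorem bandSym_eq_one {j : ℤ} {ξ : ℝ} (h : (2 : ℝ) ^ (-j - 1) ≤ |ξ| ∧ |ξ| ≤ (2 : ℝ) ^ (-j)) :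
    bandSym j ξ = 1 :=
  Set.indicator_of_mem (s := {ξ : ℝ | (2 : ℝ) ^ (-j - 1) ≤ |ξ| ∧ |ξ| ≤ (2 : ℝ) ^ (-j)}) h _

theorem bandSym_eq_zero {j : ℤ} {ξ : ℝ}
    (h : ¬((2 : ℝ) ^ (-j - 1) ≤ |ξ| ∧ |ξ| ≤ (2 : ℝ) ^ (-j))) : bandSym j ξ = 0 :=
  Set.indicator_of_notMem (s := {ξ : ℝ | (2 : ℝ) ^ (-j - 1) ≤ |ξ| ∧ |ξ| ≤ (2 : ℝ) ^ (-j)}) h _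

theorem bddSym_bandSym (j : ℤ) : BddSym (bandSym j) :=
  bddSym_indicator ((measurableSet_le measurable_const measurable_norm).inter
    (measurableSet_le measurable_norm measurable_const))

theorem bddSym_lowSym (j : ℤ) : BddSym (lowSym j) := bddSym_indicator measurableSet_Icc

theorem ae_abs_ne (c : ℝ) : ∀ᵐ ξ : ℝ, |ξ| ≠ c := by
  have h1 : ∀ᵐ ξ : ℝ, ξ ≠ c := compl_mem_ae_iff.2 (measure_singleton _)
  have h2 : ∀ᵐ ξ : ℝ, ξ ≠ -c := compl_mem_ae_iff.2 (measure_singleton _)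
  filter_upwards [h1, h2] with ξ h1 h2 h
  rcases abs_choice ξ with h3 | h3
  · exact h1 (h3 ▸ h)
  · exact h2 (by rw [← h, h3, neg_neg])

theorem bandSym_ae_eq (j : ℤ) : bandSym j =ᵐ[volume] bandWeight (fun _ => 1) ((2 : ℝ) ^ (-j)) := by
  filter_upwards [ae_abs_ne ((2 : ℝ) ^ (-j - 1))] with ξ h
  have ht : (0 : ℝ) < 2 ^ (-j) := by positivity
  have h1 : (2 : ℝ) ^ (-j - 1) = 1 / 2 * 2 ^ (-j) := by
    rw [zpow_sub_one₀ two_ne_zero]; ring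
  unfold bandWeight
  have h2 : |ξ| / 2 ^ (-j) ∈ Set.Ioc (1 / 2 : ℝ) 1 ↔
      (2 : ℝ) ^ (-j - 1) ≤ |ξ| ∧ |ξ| ≤ (2 : ℝ) ^ (-j) := by
    rw [Set.mem_Ioc, lt_div_iff₀ ht, div_le_one ht, ← h1]
    exact ⟨fun h3 => ⟨h3.1.le, h3.2⟩, fun h3 => ⟨lt_of_le_of_ne h3.1 h.symm, h3.2⟩⟩
  by_cases h3 : (2 : ℝ) ^ (-j - 1) ≤ |ξ| ∧ |ξ| ≤ (2 : ℝ) ^ (-j)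
  · rw [Set.indicator_of_mem (h2.2 h3), bandSym_eq_one h3]
  · rw [Set.indicator_of_notMem fun h4 => h3 (h2.1 h4), bandSym_eq_zero h3]

theorem ColBd.congr {w v : κ → ℝ → ℝ} {C : ENNReal} (h1 : ColBd w p C) (hw : ∀ k, BddSym (w k))
    (hv : ∀ k, BddSym (v k)) (h : ∀ k, w k =ᵐ[volume] v k) : ColBd v p C := fun f hf => by
  have e : ∀ k, mulT (v k) f = mulT (w k) f := fun k => (mulT_congr (hw k) (hv k) (h k) f).symm
  simp only [e]
  exact h1 f hf

/-- The rough Littlewood–Paley square function is bounded on `L^p`. -/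
theorem exists_colBd_bandSym (hpq : p.HolderConjugate q) :
    ∃ C : ENNReal, C ≠ ⊤ ∧ ∀ (κ : Type) [Fintype κ] (e : κ → ℤ), Function.Injective e →
      ColBd (fun k => bandSym (e k)) p C := by
  obtain ⟨C, hC, H⟩ := exists_colBd_bandWeight hpq (h := fun _ => 1) (h' := fun _ => 0)
    (fun s _ => hasDerivAt_const s 1) continuousOn_const
  refine ⟨C, hC, fun κ _ e he => ?_⟩
  obtain ⟨b, h⟩ := H κ e he
  exact h.congr b (fun k => bddSym_bandSym _) fun k => (bandSym_ae_eq _).symm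

end SquareFunctions

section Maximal

/-- The superlevel set of the Hardy–Littlewood maximal function. -/
def maximalSet (F : ℝ → ENNReal) (t : ENNReal) : Set ℝ :=
  {x | ∃ r : ℝ, 0 < r ∧ t * ENNReal.ofReal (2 * r) < ∫⁻ y in Metric.closedBall x r, F y}

/-- The weak type `(1, 1)` inequality. -/
theorem volume_maximalSet_le (F : ℝ → ENNReal) {t : ℝ} (ht : 0 < t) :
    volume (maximalSet F (ENNReal.ofReal t)) ≤ ENNReal.ofReal (5 / t) * ∫⁻ y, F y := by
  by_cases hI : ∫⁻ y, F y = ⊤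
  · rw [hI, ENNReal.mul_top (by simpa using by positivity)]
    exact le_top
  set S := maximalSet F (ENNReal.ofReal t)
  have hS : ∀ x : ℝ, ∃ r : ℝ, x ∈ S → 0 < r ∧
      ENNReal.ofReal t * ENNReal.ofReal (2 * r) < ∫⁻ y in Metric.closedBall x r, F y := fun x => by
    by_cases hx : x ∈ S
    · obtain ⟨r, hr⟩ := hx
      exact ⟨r, fun _ => hr⟩
    · exact ⟨0, fun h => absurd h hx⟩
  choose r hr using hS
  have hR : ∀ a ∈ S, r a ≤ (∫⁻ y, F y).toReal / (2 * t) := fun a ha => by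
    have h1 := (hr a ha).2.trans_le (setLIntegral_le_lintegral _ _)
    rw [← ENNReal.ofReal_mul ht.le, ENNReal.ofReal_lt_iff_lt_toReal
      (by have := (hr a ha).1; positivity) hI] at h1
    rw [le_div_iff₀ (by positivity)]
    linarith
  obtain ⟨u, huS, hdisj, hcov⟩ := Vitali.exists_disjoint_subfamily_covering_enlargement_closedBall
    S (fun x => x) r _ hR 5 (by norm_num)
  have hcount : u.Countable := hdisj.countable_of_nonempty_interior fun a ha => by
    rw [interior_closedBall _ (hr a (huS ha)).1.ne']
    exact Metric.nonempty_ball.2 (hr a (huS ha)).1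
  have hsub : S ⊆ ⋃ b ∈ u, Metric.closedBall b (5 * r b) := fun a ha => by
    obtain ⟨b, hb, hab⟩ := hcov a ha
    exact Set.mem_biUnion hb (hab (Metric.mem_closedBall_self (hr a ha).1.le))
  calc volume S ≤ volume (⋃ b ∈ u, Metric.closedBall b (5 * r b)) := measure_mono hsub
    _ ≤ ∑' b : u, volume (Metric.closedBall (b : ℝ) (5 * r b)) := measure_biUnion_le _ hcount _
    _ ≤ ∑' b : u, ENNReal.ofReal (5 / t) * ∫⁻ y in Metric.closedBall (b : ℝ) (r b), F y := by
        refine ENNReal.tsum_le_tsum fun b => ?_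
        have h1 := (hr b (huS b.2)).2.le
        have h0 := (hr b (huS b.2)).1
        calc volume (Metric.closedBall (b : ℝ) (5 * r b))
            = ENNReal.ofReal (5 / t) * (ENNReal.ofReal t * ENNReal.ofReal (2 * r b)) := by
              rw [Real.volume_closedBall, ← ENNReal.ofReal_mul ht.le,
                ← ENNReal.ofReal_mul (by positivity)]
              congr 1
              field_simp
          _ ≤ _ := by gcongr
    _ = ENNReal.ofReal (5 / t) * ∫⁻ y in ⋃ b ∈ u, Metric.closedBall b (r b), F y := by
        rw [ENNReal.tsum_mul_left, lintegral_biUnion hcount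
          (fun b _ => measurableSet_closedBall) hdisj]
    _ ≤ _ := by gcongr; exact Measure.restrict_le_self

/-- An approximate identity with quadratic decay. -/
noncomputable def bumpAvg (r : ℝ) (F : ℝ → ENNReal) (x : ℝ) : ENNReal :=
  ∫⁻ y, ENNReal.ofReal (r * (1 + ((x - y) / r) ^ 2))⁻¹ * F y

theorem bumpAvg_le {F : ℝ → ENNReal} (hF : Measurable F) {x : ℝ} {m : ENNReal}
    (h : ∀ r : ℝ, 0 < r → ∫⁻ y in Metric.closedBall x r, F y ≤ m * ENNReal.ofReal (2 * r))
    {r : ℝ} (hr : 0 < r) : bumpAvg r F x ≤ 16 * m := by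
  have hpt : ∀ y, ENNReal.ofReal (r * (1 + ((x - y) / r) ^ 2))⁻¹ * F y ≤
      ∑' n : ℕ, ENNReal.ofReal (4 * (4⁻¹) ^ n / r) *
        (Metric.closedBall x (2 ^ n * r)).indicator F y := fun y => by
    obtain ⟨n, hn1, hn2⟩ : ∃ n : ℕ, |x - y| / r ≤ 2 ^ n ∧
        (1 + ((x - y) / r) ^ 2)⁻¹ ≤ 4 * (4⁻¹ : ℝ) ^ n := by
      rw [← sq_abs, abs_div, abs_of_pos hr]
      have hv0 : 0 ≤ |x - y| / r := by positivity
      generalize |x - y| / r = v at hv0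
      rcases le_total v 1 with hv | hv
      · refine ⟨0, by simpa using hv, ?_⟩
        rw [pow_zero, mul_one]
        exact (inv_le_one_of_one_le₀ (by nlinarith [sq_nonneg v])).trans (by norm_num)
      · obtain ⟨n, h1, h2⟩ := exists_nat_pow_near hv (one_lt_two : (1 : ℝ) < 2)
        refine ⟨n + 1, h2.le, ?_⟩
        have e : 4 * (4⁻¹ : ℝ) ^ (n + 1) = (4 ^ n)⁻¹ := by rw [pow_succ, inv_pow]; ring
        rw [e]
        refine inv_anti₀ (by positivity) ?_
        have h3 : (2 ^ n : ℝ) ^ 2 ≤ v ^ 2 := by gcongr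
        have h4 : (2 ^ n : ℝ) ^ 2 = 4 ^ n := by
          rw [← pow_mul, mul_comm, pow_mul]; norm_num
        linarith
    have hmem : y ∈ Metric.closedBall x (2 ^ n * r) := by
      rw [Metric.mem_closedBall, dist_comm, Real.dist_eq]
      rwa [div_le_iff₀ hr] at hn1
    refine le_trans ?_ (ENNReal.le_tsum n)
    rw [Set.indicator_of_mem hmem]
    gcongr
    rw [mul_inv, div_eq_mul_inv, mul_comm]
    exact mul_le_mul_of_nonneg_right hn2 (inv_nonneg.2 hr.le)
  calc bumpAvg r F x ≤ ∫⁻ y, ∑' n : ℕ, ENNReal.ofReal (4 * (4⁻¹) ^ n / r) *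
        (Metric.closedBall x (2 ^ n * r)).indicator F y := lintegral_mono hpt
    _ = ∑' n : ℕ, ENNReal.ofReal (4 * (4⁻¹) ^ n / r) *
        ∫⁻ y in Metric.closedBall x (2 ^ n * r), F y := by
        rw [lintegral_tsum fun n =>
          ((hF.indicator measurableSet_closedBall).const_mul _).aemeasurable]
        congr 1 with n
        rw [lintegral_const_mul _ (hF.indicator measurableSet_closedBall),
          lintegral_indicator measurableSet_closedBall]
    _ ≤ ∑' n : ℕ, m * 8 * 2⁻¹ ^ n := by
        refine ENNReal.tsum_le_tsum fun n => ?_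
        refine (mul_le_mul_right (h (2 ^ n * r) (by positivity)) _).trans_eq ?_
        rw [mul_left_comm, ← ENNReal.ofReal_mul (by positivity), mul_assoc]
        congr 1
        have h1 : 4 * (4⁻¹ : ℝ) ^ n / r * (2 * (2 ^ n * r)) = 8 * (2⁻¹ : ℝ) ^ n := by
          have : (4 : ℝ) ^ n = 2 ^ n * 2 ^ n := by rw [← mul_pow]; norm_num
          rw [inv_pow, inv_pow, this]
          field_simp
          norm_num
        rw [h1, ENNReal.ofReal_mul (by norm_num), ENNReal.ofReal_pow (by norm_num),
          ENNReal.ofReal_inv_of_pos (by norm_num)]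
        norm_num
    _ = 16 * m := by
        rw [ENNReal.tsum_mul_left, ENNReal.tsum_geometric]
        rw [ENNReal.one_sub_inv_two, inv_inv, mul_assoc, mul_comm]
        norm_num

end Maximal

section MaximalStrong

/-- Marcinkiewicz interpolation for operators of restricted weak type `(1, 1)` and bounded on
`L^∞`. -/
theorem lintegral_rpow_le_of_weak {φ : ℝ → ℝ} (hφ : Measurable φ) (h0 : ∀ x, 0 ≤ φ x)
    {T : ℝ → ENNReal} (hT : Measurable T) {A B p : ℝ} (hA : 0 ≤ A) (hB : 0 < B) (hp : 1 < p)
    (hw : ∀ t : ℝ, 0 < t → volume {x | ENNReal.ofReal t < T x} ≤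
      ENNReal.ofReal (A / t) * ∫⁻ y in {y | t < B * φ y}, ENNReal.ofReal (φ y)) :
    ∫⁻ x, ENNReal.ofReal ((T x).toReal ^ p) ≤
      ENNReal.ofReal (p * A * B ^ (p - 1) / (p - 1)) * ∫⁻ x, ENNReal.ofReal (φ x ^ p) := by
  have hp0 : 0 < p := by linarith
  have hp1 : 0 < p - 1 := by linarith
  rw [lintegral_rpow_eq_lintegral_meas_lt_mul volume (ae_of_all _ fun x => ENNReal.toReal_nonneg)
    hT.ennreal_toReal.aemeasurable hp0]
  have hset : MeasurableSet {z : ℝ × ℝ | z.1 < B * φ z.2} :=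
    measurableSet_lt measurable_fst ((hφ.comp measurable_snd).const_mul B)
  set K : ℝ → ℝ → ENNReal := fun t y =>
    {z : ℝ × ℝ | z.1 < B * φ z.2}.indicator
      (fun z => ENNReal.ofReal (A * z.1 ^ (p - 2)) * ENNReal.ofReal (φ z.2)) (t, y) with hK
  have hKm : Measurable (Function.uncurry K) := by
    refine Measurable.indicator ?_ hset
    exact (((measurable_fst.pow_const _).const_mul A).ennreal_ofReal).mul
      (hφ.comp measurable_snd).ennreal_ofReal
  have h1 : ∀ t ∈ Set.Ioi (0 : ℝ),
      volume {x | t < (T x).toReal} * ENNReal.ofReal (t ^ (p - 1)) ≤ ∫⁻ y, K t y := by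
    intro t ht
    have ht : 0 < t := ht
    have h2 : volume {x | t < (T x).toReal} ≤ volume {x | ENNReal.ofReal t < T x} :=
      measure_mono fun x hx => by
        have hx : t < (T x).toReal := hx
        exact (ENNReal.ofReal_lt_iff_lt_toReal ht.le
          fun h => by simp [h] at hx; linarith).2 hx
    calc _ ≤ ENNReal.ofReal (A / t) * (∫⁻ y in {y | t < B * φ y}, ENNReal.ofReal (φ y)) *
          ENNReal.ofReal (t ^ (p - 1)) := by gcongr; exact h2.trans (hw t ht)
      _ = ENNReal.ofReal (A * t ^ (p - 2)) * ∫⁻ y in {y | t < B * φ y}, ENNReal.ofReal (φ y) := by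
          rw [mul_right_comm, ← ENNReal.ofReal_mul (by positivity)]
          congr 2
          rw [show p - 1 = p - 2 + 1 by ring, rpow_add_one ht.ne']
          field_simp
      _ = ∫⁻ y, K t y := by
          have hm : MeasurableSet {y | t < B * φ y} :=
            measurableSet_lt measurable_const (hφ.const_mul B)
          rw [← lintegral_indicator hm, ← lintegral_const_mul _ (hφ.ennreal_ofReal.indicator hm)]
          refine lintegral_congr fun y => ?_
          by_cases hy : t < B * φ y
          · simp [hK, hy]
          · simp [hK, hy]
  have h3 : ∀ y, ∫⁻ t in Set.Ioi (0 : ℝ), K t y ≤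
      ENNReal.ofReal (A * B ^ (p - 1) / (p - 1)) * ENNReal.ofReal (φ y ^ p) := by
    intro y
    have hb : 0 ≤ B * φ y := mul_nonneg hB.le (h0 y)
    have hint : IntegrableOn (fun t : ℝ => A * t ^ (p - 2)) (Set.Ioc 0 (B * φ y)) := by
      have := (intervalIntegral.intervalIntegrable_rpow' (a := 0) (b := B * φ y)
        (by linarith : -1 < p - 2)).const_mul A
      rwa [intervalIntegrable_iff_integrableOn_Ioc_of_le hb] at this
    calc _ ≤ ∫⁻ t in Set.Ioc 0 (B * φ y),
          ENNReal.ofReal (A * t ^ (p - 2)) * ENNReal.ofReal (φ y) := by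
          rw [← lintegral_indicator measurableSet_Ioi, ← lintegral_indicator measurableSet_Ioc]
          refine lintegral_mono fun t => ?_
          by_cases h4 : 0 < t
          · by_cases h5 : t < B * φ y
            · simp [hK, h4, h5, h5.le]
            · have h6 : K t y = 0 := Set.indicator_of_notMem
                (s := {z : ℝ × ℝ | z.1 < B * φ z.2}) h5 _
              rw [Set.indicator_of_mem (Set.mem_Ioi.2 h4), h6]
              exact zero_le
          · simp [h4]
      _ = _ := by
          rw [lintegral_mul_const _ (by fun_prop), ← ofReal_integral_eq_lintegral_ofReal hint ?_,
            ← intervalIntegral.integral_of_le hb, intervalIntegral.integral_const_mul,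
            integral_rpow (Or.inl (by linarith)), ← ENNReal.ofReal_mul ?_,
            ← ENNReal.ofReal_mul (by positivity)]
          · congr 1
            rw [show p - 2 + 1 = p - 1 by ring, zero_rpow hp1.ne', sub_zero,
              mul_rpow hB.le (h0 y)]
            rcases (h0 y).eq_or_lt with h6 | h6
            · rw [← h6, zero_rpow hp0.ne']; ring
            · have : φ y ^ p = φ y ^ (p - 1) * φ y := by
                rw [← rpow_add_one h6.ne']; congr 1; ring
              rw [this]; ring
          · rw [show p - 2 + 1 = p - 1 by ring, zero_rpow hp1.ne', sub_zero]
            positivity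
          · filter_upwards [ae_restrict_mem measurableSet_Ioc] with t ht
            have := ht.1
            positivity
  calc _ ≤ ENNReal.ofReal p * ∫⁻ t in Set.Ioi (0 : ℝ), ∫⁻ y, K t y := by
        gcongr 1
        exact setLIntegral_mono' measurableSet_Ioi h1
    _ = ENNReal.ofReal p * ∫⁻ y, ∫⁻ t in Set.Ioi (0 : ℝ), K t y := by
        rw [lintegral_lintegral_swap hKm.aemeasurable]
    _ ≤ ENNReal.ofReal p *
        ∫⁻ y, ENNReal.ofReal (A * B ^ (p - 1) / (p - 1)) * ENNReal.ofReal (φ y ^ p) := by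
        gcongr 1
        exact lintegral_mono h3
    _ = _ := by
        rw [lintegral_const_mul _ (by fun_prop), ← mul_assoc, ← ENNReal.ofReal_mul hp0.le]
        congr 2
        ring

theorem ae_lt_top_of_weak {φ : ℝ → ℝ} (hφ : Measurable φ) (h0 : ∀ x, 0 ≤ φ x)
    {T : ℝ → ENNReal} {A B p : ℝ} (hB : 0 < B) (hp : 1 < p)
    (hw : ∀ t : ℝ, 0 < t → volume {x | ENNReal.ofReal t < T x} ≤
      ENNReal.ofReal (A / t) * ∫⁻ y in {y | t < B * φ y}, ENNReal.ofReal (φ y))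
    (hfin : ∫⁻ x, ENNReal.ofReal (φ x ^ p) ≠ ⊤) : ∀ᵐ x, T x < ⊤ := by
  have hp1 : 0 < p - 1 := by linarith
  set I := ∫⁻ x, ENNReal.ofReal (φ x ^ p)
  have hbd : ∀ t : ℝ, 1 ≤ t → volume {x | T x = ⊤} ≤ ENNReal.ofReal (A / t) *
      (ENNReal.ofReal (B ^ (p - 1)) * I) := by
    intro t ht
    have ht0 : 0 < t := by linarith
    refine (measure_mono fun x (hx : T x = ⊤) => ?_).trans ((hw t ht0).trans ?_)
    · simp [hx]
    · gcongr
      have hm : MeasurableSet {y | t < B * φ y} :=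
        measurableSet_lt measurable_const (hφ.const_mul B)
      rw [← lintegral_const_mul _ (by fun_prop), ← lintegral_indicator hm]
      refine lintegral_mono fun y => ?_
      by_cases hy : t < B * φ y
      · simp only [Set.mem_ofPred_eq, hy, Set.indicator_of_mem]
        rw [← ENNReal.ofReal_mul (by positivity)]
        apply ENNReal.ofReal_le_ofReal
        have hy0 : 0 < φ y := by
          by_contra h
          have : φ y = 0 := le_antisymm (not_lt.1 h) (h0 y)
          rw [this] at hy; linarith
        have h1 : 1 ≤ (B * φ y) ^ (p - 1) := one_le_rpow (by linarith) hp1.le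
        rw [mul_rpow hB.le (h0 y)] at h1
        have : φ y ^ p = φ y ^ (p - 1) * φ y := by
          rw [← rpow_add_one hy0.ne']; congr 1; ring
        rw [this, ← mul_assoc]
        nlinarith
      · simp [hy]
  have hlim : Filter.Tendsto (fun t : ℝ => ENNReal.ofReal (A / t) *
      (ENNReal.ofReal (B ^ (p - 1)) * I)) Filter.atTop (nhds 0) := by
    have h1 : Filter.Tendsto (fun t : ℝ => ENNReal.ofReal (A / t)) Filter.atTop (nhds 0) := by
      have := ENNReal.tendsto_ofReal
        ((tendsto_const_nhds (x := A)).div_atTop (Filter.tendsto_id (α := ℝ) (x := Filter.atTop)))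
      simpa using this
    have := ENNReal.Tendsto.mul_const (b := ENNReal.ofReal (B ^ (p - 1)) * I) h1
      (Or.inr (ENNReal.mul_ne_top ENNReal.ofReal_ne_top hfin))
    simpa using this
  have h0' : volume {x | T x = ⊤} ≤ 0 :=
    ge_of_tendsto hlim (by filter_upwards [Filter.eventually_ge_atTop 1] with t ht using hbd t ht)
  have := le_antisymm h0' (zero_le)
  filter_upwards [measure_eq_zero_iff_ae_notMem.1 this] with x hx
  exact lt_top_iff_ne_top.2 hx



theorem measurable_bumpAvg (r : ℝ) {F : ℝ → ENNReal} (hF : Measurable F) :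
    Measurable (bumpAvg r F) := by
  unfold bumpAvg
  refine Measurable.lintegral_prod_right' (f := fun z : ℝ × ℝ =>
    ENNReal.ofReal (r * (1 + ((z.1 - z.2) / r) ^ 2))⁻¹ * F z.2) ?_
  exact Measurable.mul (by fun_prop) (hF.comp measurable_snd)

theorem volume_iSup_bumpAvg_le {ι : Type} {φ : ℝ → ℝ} (hφ : Measurable φ) {r : ι → ℝ} (hr : ∀ i, 0 < r i)
    {t : ℝ} (ht : 0 < t) :
    volume {x | ENNReal.ofReal t < ⨆ i, bumpAvg (r i) (fun y => ENNReal.ofReal (φ y)) x} ≤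
      ENNReal.ofReal (160 / t) * ∫⁻ y in {y | t < 32 * φ y}, ENNReal.ofReal (φ y) := by
  have hs : 0 < t / 32 := by positivity
  have hm : MeasurableSet {y | t < 32 * φ y} :=
    measurableSet_lt measurable_const (hφ.const_mul 32)
  set G : ℝ → ENNReal := {y | t < 32 * φ y}.indicator fun y => ENNReal.ofReal (φ y) with hG
  have hsub : {x | ENNReal.ofReal t < ⨆ i, bumpAvg (r i) (fun y => ENNReal.ofReal (φ y)) x} ⊆
      maximalSet G (ENNReal.ofReal (t / 32)) := fun x hx => by
    by_contra hcon
    have hx : ENNReal.ofReal t < ⨆ i, bumpAvg (r i) (fun y => ENNReal.ofReal (φ y)) x := hx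
    refine absurd hx (not_lt.2 (iSup_le fun i => ?_))
    refine (bumpAvg_le hφ.ennreal_ofReal (m := 2 * ENNReal.ofReal (t / 32)) (fun ρ hρ => ?_)
      (hr i)).trans_eq ?_
    · have h1 : ∫⁻ y in Metric.closedBall x ρ, G y ≤
          ENNReal.ofReal (t / 32) * ENNReal.ofReal (2 * ρ) := by
        by_contra h2
        exact hcon ⟨ρ, hρ, not_le.1 h2⟩
      calc _ ≤ ∫⁻ y in Metric.closedBall x ρ, (G y + ENNReal.ofReal (t / 32)) := by
            refine lintegral_mono fun y => ?_
            by_cases hy : t < 32 * φ y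
            · simp [hG, hy]
            · refine le_add_left (ENNReal.ofReal_le_ofReal ?_)
              linarith
        _ = (∫⁻ y in Metric.closedBall x ρ, G y) +
            ENNReal.ofReal (t / 32) * ENNReal.ofReal (2 * ρ) := by
            rw [lintegral_add_right _ measurable_const, setLIntegral_const,
              Real.volume_closedBall]
        _ ≤ _ := by
            rw [mul_assoc, two_mul (ENNReal.ofReal (t / 32) * _)]
            gcongr
    · rw [← ENNReal.ofReal_ofNat 2, ← ENNReal.ofReal_ofNat 16,
        ← ENNReal.ofReal_mul (by norm_num), ← ENNReal.ofReal_mul (by norm_num)]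
      congr 1
      ring
  refine (measure_mono hsub).trans ((volume_maximalSet_le G hs).trans_eq ?_)
  rw [hG, lintegral_indicator hm]
  congr 2
  field_simp
  norm_num

/-- Finite maximal functions are bounded on `L^p`, uniformly in the number of scales. -/
theorem exists_iSup_bumpAvg {p : ℝ} (hp : 1 < p) : ∃ C : ENNReal, C ≠ ⊤ ∧
    ∀ (ι : Type) [Fintype ι] (r : ι → ℝ), (∀ i, 0 < r i) → ∀ f : ℝ → ℂ, StronglyMeasurable f →
      MemLp f (ENNReal.ofReal p) →
      (∀ᵐ x, ⨆ i, bumpAvg (r i) (fun y => ‖f y‖ₑ) x < ⊤) ∧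
      eLpNorm (fun x => (⨆ i, bumpAvg (r i) (fun y => ‖f y‖ₑ) x).toReal) (ENNReal.ofReal p) volume ≤
        C * eLpNorm f (ENNReal.ofReal p) volume := by
  have hp0 : 0 < p := by linarith
  refine ⟨ENNReal.ofReal (p * 160 * 32 ^ (p - 1) / (p - 1)) ^ (1 / p),
    ENNReal.rpow_ne_top_of_nonneg (by positivity) ENNReal.ofReal_ne_top, ?_⟩
  intro ι _ r hr f hfm hf
  have hφ : Measurable fun y => ‖f y‖ := hfm.measurable.norm
  have e : ∀ y, ‖f y‖ₑ = ENNReal.ofReal ‖f y‖ := fun y => (ofReal_norm _).symm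
  have ep : ∀ y, ENNReal.ofReal (‖f y‖ ^ p) = ‖f y‖ₑ ^ p := fun y => by
    rw [e, ENNReal.ofReal_rpow_of_nonneg (norm_nonneg _) hp0.le]
  have hT : Measurable fun x => ⨆ i, bumpAvg (r i) (fun y => ‖f y‖ₑ) x :=
    Measurable.iSup fun i => measurable_bumpAvg _ hfm.measurable.enorm
  have hpn : ENNReal.ofReal p ≠ 0 := by simpa using hp0
  have hw : ∀ t : ℝ, 0 < t →
      volume {x | ENNReal.ofReal t < ⨆ i, bumpAvg (r i) (fun y => ‖f y‖ₑ) x} ≤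
      ENNReal.ofReal (160 / t) * ∫⁻ y in {y | t < 32 * ‖f y‖}, ENNReal.ofReal ‖f y‖ := fun t ht => by
    simp only [e]
    exact volume_iSup_bumpAvg_le hφ hr ht
  have hfin : ∫⁻ x, ENNReal.ofReal (‖f x‖ ^ p) ≠ ⊤ := by
    simp only [ep]
    have := lintegral_rpow_enorm_lt_top_of_eLpNorm_lt_top hpn ENNReal.ofReal_ne_top hf.2
    rw [ENNReal.toReal_ofReal hp0.le] at this
    exact this.ne
  refine ⟨ae_lt_top_of_weak hφ (fun _ => norm_nonneg _) (by norm_num) hp hw hfin, ?_⟩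
  have h1 := lintegral_rpow_le_of_weak hφ (fun _ => norm_nonneg _) hT (by norm_num)
    (by norm_num) hp hw
  rw [eLpNorm_eq_lintegral_rpow_enorm_toReal hpn ENNReal.ofReal_ne_top,
    eLpNorm_eq_lintegral_rpow_enorm_toReal hpn ENNReal.ofReal_ne_top, ENNReal.toReal_ofReal hp0.le,
    ← ENNReal.mul_rpow_of_nonneg _ _ (by positivity)]
  refine ENNReal.rpow_le_rpow ?_ (by positivity)
  simp only [ep] at h1
  refine le_trans (lintegral_mono fun x => ?_) h1
  rw [← ENNReal.ofReal_rpow_of_nonneg ENNReal.toReal_nonneg hp0.le,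
    ← ofReal_norm, Real.norm_of_nonneg ENNReal.toReal_nonneg]

end MaximalStrong

section SmoothCutoff

theorem conj_fourierInv (a : ℝ → ℂ) (x : ℝ) :
    (starRingEnd ℂ) (𝓕⁻ a x) = 𝓕 (fun ξ => (starRingEnd ℂ) (a ξ)) x := by
  rw [Real.fourierInv_eq', Real.fourier_eq', ← integral_conj]
  refine integral_congr_ae (ae_of_all _ fun ξ => ?_)
  simp only [smul_eq_mul, map_mul, ← Complex.exp_conj, Complex.conj_I, Complex.conj_ofReal]
  push_cast
  ring_nf

/-- A multiplier with integrable symbol is a convolution. -/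
theorem enorm_mulT_le_lintegral {η : ℝ → ℝ} (hη : BddSym η) (h1 : Integrable fun ξ => (η ξ : ℂ))
    (h2 : MemLp (fun ξ => (η ξ : ℂ)) 2) (f : L2R) :
    ∀ᵐ x, ‖mulT η f x‖ₑ ≤ ∫⁻ y, ‖𝓕⁻ (fun ξ => (η ξ : ℂ)) (x - y)‖ₑ * ‖f y‖ₑ := by
  set a : ℝ → ℂ := fun ξ => (η ξ : ℂ) * (𝓕 f : L2R) ξ
  have ha : Integrable a := h2.integrable_mul (Lp.memLp _)
  have ha2 : MemLp a 2 := hη.memLp (Lp.memLp _)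
  have e1 : mulT η f = 𝓕⁻ (ha2.toLp a) := by
    rw [mulT]
    congr 1
    exact (ae_eq_symMul hη (a := a) Filter.EventuallyEq.rfl _ ha2.coeFn_toLp).symm
  rw [e1]
  filter_upwards [fourierInv_toLp_ae_eq ha ha2] with x hx
  rw [hx]
  set b : ℝ → ℂ := fun ξ => Complex.exp (-((2 * π * (ξ * x) : ℝ) : ℂ) * Complex.I) * η ξ with hb
  have hm : AEStronglyMeasurable
      (fun ξ : ℝ => Complex.exp (-((2 * π * (ξ * x) : ℝ) : ℂ) * Complex.I)) volume := by fun_prop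
  have hn : ∀ ξ : ℝ, ‖Complex.exp (-((2 * π * (ξ * x) : ℝ) : ℂ) * Complex.I)‖ = 1 := fun ξ => by
    rw [← Complex.ofReal_neg, Complex.norm_exp_ofReal_mul_I]
  have hb1 : Integrable b := h1.bdd_mul hm (ae_of_all _ fun ξ => (hn ξ).le)
  have hb2 : MemLp b 2 := by
    refine h2.mono hb1.1 (ae_of_all _ fun ξ => ?_)
    rw [hb, norm_mul, hn, one_mul]
  have e2 : 𝓕⁻ a x = inner ℂ (𝓕⁻ (hb2.toLp b) : L2R) f := by
    rw [← Lp.inner_fourier_eq, fourier_fourierInv_eq, L2.inner_def, Real.fourierInv_eq']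
    refine integral_congr_ae ?_
    filter_upwards [hb2.coeFn_toLp] with ξ h3
    rw [h3]
    simp only [map_mul, map_neg, Complex.conj_I, Complex.conj_ofReal, a, RCLike.inner_apply,
      conj_trivial, hb, ← Complex.exp_conj, smul_eq_mul]
    push_cast
    ring_nf
  rw [e2, L2.inner_def]
  refine (enorm_integral_le_lintegral_enorm _).trans_eq (lintegral_congr_ae ?_)
  filter_upwards [fourierInv_toLp_ae_eq hb1 hb2] with y hy
  rw [hy, RCLike.inner_apply, enorm_mul, mul_comm]
  congr 1
  rw [conj_fourierInv, ← ofReal_norm, ← ofReal_norm]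
  congr 2
  rw [Real.fourierInv_eq', Real.fourier_eq']
  refine integral_congr_ae (ae_of_all _ fun ξ => ?_)
  simp only [hb, map_mul, Complex.conj_ofReal, ← Complex.exp_conj, smul_eq_mul, map_neg,
    Complex.conj_I, RCLike.inner_apply, conj_trivial]
  rw [← mul_assoc, ← Complex.exp_add]
  push_cast
  ring_nf

theorem fourierInv_comp_div (η : ℝ → ℂ) {t : ℝ} (ht : 0 < t) (x : ℝ) :
    𝓕⁻ (fun ξ => η (ξ / t)) x = t * 𝓕⁻ η (t * x) := by
  rw [Real.fourierInv_eq', Real.fourierInv_eq']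
  have h := Measure.integral_comp_div (fun ξ : ℝ =>
    Complex.exp (((2 * π * inner ℝ ξ (t * x) : ℝ) : ℂ) * Complex.I) • η ξ) t
  rw [abs_of_pos ht, Complex.real_smul] at h
  rw [← h]
  refine integral_congr_ae (ae_of_all _ fun ξ => ?_)
  simp only [RCLike.inner_apply, conj_trivial]
  congr 4
  field_simp

/-- A fixed smooth cutoff. -/
noncomputable def cutoff : ContDiffBump (0 : ℝ) := ⟨1 / 2, 1, by norm_num, by norm_num⟩

theorem exists_fourierInv_cutoff_le : ∃ D : ℝ, 0 ≤ D ∧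
    ∀ x, ‖𝓕⁻ (fun ξ => (cutoff ξ : ℂ)) x‖ ≤ D * (1 + x ^ 2)⁻¹ := by
  have h1 : HasCompactSupport fun ξ => (cutoff ξ : ℂ) :=
    cutoff.hasCompactSupport.comp_left (g := Complex.ofReal) rfl
  have h2 : ContDiff ℝ (⊤ : ℕ∞) fun ξ => (cutoff ξ : ℂ) :=
    Complex.ofRealCLM.contDiff.comp cutoff.contDiff
  set S : SchwartzMap ℝ ℂ := h1.toSchwartzMap h2
  have hS : ((𝓕⁻ S : SchwartzMap ℝ ℂ) : ℝ → ℂ) = 𝓕⁻ fun ξ => (cutoff ξ : ℂ) := by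
    rw [SchwartzMap.fourierInv_coe]; rfl
  obtain ⟨D0, hD0, h0⟩ := (𝓕⁻ S : SchwartzMap ℝ ℂ).decay 0 0
  obtain ⟨D2, hD2, h2⟩ := (𝓕⁻ S : SchwartzMap ℝ ℂ).decay 2 0
  refine ⟨D0 + D2, by positivity, fun x => ?_⟩
  have a0 := h0 x
  have a2 := h2 x
  rw [norm_iteratedFDeriv_zero, hS] at a0 a2
  rw [← div_eq_mul_inv, le_div_iff₀ (by positivity)]
  rw [Real.norm_eq_abs, sq_abs] at a2
  linarith

/-- The smooth low-frequency cutoff at scale `t`. -/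
noncomputable def smoothLow (t ξ : ℝ) : ℝ := cutoff (ξ / t)

theorem bddSym_smoothLow (t : ℝ) : BddSym (smoothLow t) :=
  ⟨cutoff.continuous.measurable.comp (measurable_id.div_const t), 1, fun _ => by
    rw [smoothLow, abs_of_nonneg cutoff.nonneg]
    exact cutoff.le_one⟩

theorem lowSym_eq (j : ℤ) (ξ : ℝ) : lowSym j ξ =
    smoothLow ((2 : ℝ) ^ (-j)) ξ + bandWeight (fun s => 1 - cutoff s) ((2 : ℝ) ^ (-j)) ξ := by
  have ht : (0 : ℝ) < 2 ^ (-j) := by positivity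
  set t : ℝ := 2 ^ (-j) with htdef
  have e : smoothLow t ξ = cutoff (|ξ| / t) := by
    rw [smoothLow]
    rcases abs_choice ξ with h | h
    · rw [h]
    · rw [h, neg_div, cutoff.neg]
  have hmem : ξ ∈ Set.Icc (-t) t ↔ |ξ| / t ≤ 1 := by rw [div_le_one ht, Set.mem_Icc, abs_le]
  have h0 : 0 ≤ |ξ| / t := by positivity
  have hd : dist (|ξ| / t) 0 = |ξ| / t := by rw [Real.dist_eq, sub_zero, abs_of_nonneg h0]
  unfold bandWeight lowSym
  rw [e, ← htdef]
  by_cases h1 : |ξ| / t ≤ 1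
  · rw [Set.indicator_of_mem (hmem.2 h1)]
    by_cases h2 : |ξ| / t ≤ 1 / 2
    · rw [Set.indicator_of_notMem (fun h => absurd h.1 (not_lt.2 h2)),
        cutoff.one_of_mem_closedBall, add_zero]
      rw [Metric.mem_closedBall, hd]
      exact h2
    · rw [Set.indicator_of_mem (s := Set.Ioc (1 / 2 : ℝ) 1) ⟨not_le.1 h2, h1⟩]
      ring
  · rw [Set.indicator_of_notMem (fun h => h1 (hmem.1 h)),
      Set.indicator_of_notMem (fun h => h1 h.2), cutoff.zero_of_le_dist, add_zero]
    rw [hd]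
    exact (not_le.1 h1).le

theorem exists_mulT_smoothLow_le : ∃ D : ENNReal, D ≠ ⊤ ∧ ∀ (t : ℝ), 0 < t → ∀ f : L2R,
    ∀ᵐ x, ‖mulT (smoothLow t) f x‖ₑ ≤ D * bumpAvg t⁻¹ (fun y => ‖f y‖ₑ) x := by
  obtain ⟨D, hD0, hD⟩ := exists_fourierInv_cutoff_le
  refine ⟨ENNReal.ofReal D, ENNReal.ofReal_ne_top, fun t ht f => ?_⟩
  have hc : Continuous fun ξ => (smoothLow t ξ : ℂ) :=
    Complex.continuous_ofReal.comp (cutoff.continuous.comp (continuous_id.div_const t))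
  have hs : HasCompactSupport fun ξ => (smoothLow t ξ : ℂ) := by
    refine HasCompactSupport.intro (isCompact_closedBall (0 : ℝ) t) fun ξ hξ => ?_
    have : smoothLow t ξ = 0 := by
      refine cutoff.zero_of_le_dist ?_
      rw [Metric.mem_closedBall, not_le, dist_zero_right, Real.norm_eq_abs] at hξ
      rw [dist_zero_right, norm_div, Real.norm_eq_abs, Real.norm_eq_abs, abs_of_pos ht]
      exact (one_le_div ht).2 hξ.le
    rw [this, Complex.ofReal_zero]
  filter_upwards [enorm_mulT_le_lintegral (bddSym_smoothLow t) (hc.integrable_of_hasCompactSupport hs)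
    (hc.memLp_of_hasCompactSupport hs) f] with x hx
  refine hx.trans ?_
  rw [bumpAvg, ← lintegral_const_mul' _ _ ENNReal.ofReal_ne_top]
  refine lintegral_mono fun y => ?_
  rw [← mul_assoc, ← ENNReal.ofReal_mul hD0, ← ofReal_norm]
  gcongr
  have e := fourierInv_comp_div (fun ξ => (cutoff ξ : ℂ)) ht (x - y)
  rw [show (fun ξ => (smoothLow t ξ : ℂ)) = fun ξ => (cutoff (ξ / t) : ℂ) from rfl, e, norm_mul,
    Complex.norm_real, Real.norm_of_nonneg ht.le]
  refine (mul_le_mul_of_nonneg_left (hD _) ht.le).trans_eq ?_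
  rw [mul_inv, inv_inv, div_inv_eq_mul, mul_comm (x - y) t]
  ring

end SmoothCutoff

section LacunaryMaximal

variable {p q : ℝ}

/-- The lacunary maximal function with rough frequency cutoffs is bounded on `L^p`. -/
theorem exists_maximal_lowSym (hpq : p.HolderConjugate q) : ∃ C : ENNReal, C ≠ ⊤ ∧
    ∀ (κ : Type) [Fintype κ] (e : κ → ℤ), Function.Injective e →
      ∀ w : L2R, MemLp w (ENNReal.ofReal p) → ∃ M : ℝ → ℝ, AEStronglyMeasurable M volume ∧
        (∀ x, 0 ≤ M x) ∧ (∀ᵐ x, ∀ k, ‖mulT (lowSym (e k)) w x‖ ≤ M x) ∧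
        eLpNorm M (ENNReal.ofReal p) volume ≤ C * eLpNorm w (ENNReal.ofReal p) volume := by
  obtain ⟨A, hA, HA⟩ := exists_iSup_bumpAvg hpq.lt
  obtain ⟨D, hD, HD⟩ := exists_mulT_smoothLow_le
  have hder : ∀ s ∈ Set.Icc (1 / 2 : ℝ) 1,
      HasDerivAt (fun s => 1 - cutoff s) (-deriv cutoff s) s := fun s _ => by
    have h1 : DifferentiableAt ℝ cutoff s :=
      (cutoff.contDiff (n := 1)).differentiable one_ne_zero s
    simpa using h1.hasDerivAt.const_sub 1
  have hcont : ContinuousOn (fun s => -deriv cutoff s) (Set.Icc (1 / 2) 1) :=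
    ((cutoff.contDiff (n := 1)).continuous_deriv le_rfl).neg.continuousOn
  obtain ⟨B, hB, HB⟩ := exists_colBd_bandWeight hpq hder hcont
  refine ⟨D * A + B, ENNReal.add_ne_top.2 ⟨ENNReal.mul_ne_top hD hA, hB⟩, ?_⟩
  intro κ _ e he w hw
  obtain ⟨b, hcol⟩ := HB κ e he
  have ht : ∀ k, (0 : ℝ) < 2 ^ (-e k) := fun k => by positivity
  have hwm := Lp.stronglyMeasurable w
  obtain ⟨hfin, hbd⟩ := HA κ (fun k => ((2 : ℝ) ^ (-e k))⁻¹) (fun k => inv_pos.2 (ht k)) w hwm hw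
  set T : ℝ → ENNReal := fun x => ⨆ k, bumpAvg ((2 : ℝ) ^ (-e k))⁻¹ (fun y => ‖w y‖ₑ) x
  set V := vecLp fun k => mulT (bandWeight (fun s => 1 - cutoff s) ((2 : ℝ) ^ (-e k))) w
  have hTm : Measurable T := Measurable.iSup fun k => measurable_bumpAvg _ hwm.measurable.enorm
  have hm1 : AEStronglyMeasurable (fun x => D.toReal * (T x).toReal) volume :=
    (hTm.ennreal_toReal.const_mul _).aestronglyMeasurable
  have hm2 : AEStronglyMeasurable (fun x => ‖V x‖) volume :=
    (stronglyMeasurable_vecLp _).norm.aestronglyMeasurable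
  refine ⟨fun x => D.toReal * (T x).toReal + ‖V x‖, hm1.add hm2, fun x => by positivity, ?_, ?_⟩
  · have h1 : ∀ᵐ x, ∀ k, ‖mulT (smoothLow ((2 : ℝ) ^ (-e k))) w x‖ₑ ≤
        D * bumpAvg ((2 : ℝ) ^ (-e k))⁻¹ (fun y => ‖w y‖ₑ) x := ae_all_iff.2 fun k => HD _ (ht k) w
    have h2 : ∀ᵐ x, ∀ k, mulT (lowSym (e k)) w x = mulT (smoothLow ((2 : ℝ) ^ (-e k))) w x +
        mulT (bandWeight (fun s => 1 - cutoff s) ((2 : ℝ) ^ (-e k))) w x := ae_all_iff.2 fun k => by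
      rw [show lowSym (e k) = _ from funext (lowSym_eq (e k)), mulT_sym_add (bddSym_smoothLow _) (b k)]
      exact Lp.coeFn_add _ _
    filter_upwards [h1, h2, hfin] with x h1 h2 h3 k
    rw [h2 k]
    refine (norm_add_le _ _).trans (add_le_add ?_
      (norm_apply_le_norm_vecFun (fun k => (mulT (bandWeight (fun s => 1 - cutoff s)
        ((2 : ℝ) ^ (-e k))) w : ℝ → ℂ)) k x))
    have h4 : ‖mulT (smoothLow ((2 : ℝ) ^ (-e k))) w x‖ₑ ≤ D * T x :=
      (h1 k).trans (by gcongr; exact le_iSup (fun k => bumpAvg ((2 : ℝ) ^ (-e k))⁻¹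
        (fun y => ‖w y‖ₑ) x) k)
    have h5 := ENNReal.toReal_mono (ENNReal.mul_ne_top hD h3.ne) h4
    rwa [toReal_enorm, ENNReal.toReal_mul] at h5
  · have hp1 : (1 : ENNReal) ≤ ENNReal.ofReal p := ENNReal.one_le_ofReal.2 hpq.lt.le
    refine (eLpNorm_add_le hm1 hm2 hp1).trans ?_
    rw [add_mul]
    refine add_le_add ?_ ((eLpNorm_norm _).trans_le (hcol w hw))
    have h6 : eLpNorm (fun x => D.toReal * (T x).toReal) (ENNReal.ofReal p) volume =
        ‖D.toReal‖ₑ * eLpNorm (fun x => (T x).toReal) (ENNReal.ofReal p) volume :=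
      eLpNorm_const_smul D.toReal (fun x => (T x).toReal) _ _
    rw [h6, ← ofReal_norm, Real.norm_of_nonneg ENNReal.toReal_nonneg, ENNReal.ofReal_toReal hD,
      mul_assoc]
    gcongr

end LacunaryMaximal

section Trilinear

/-- Essentially bounded elements of `L²`. -/
def EssBdd (u : L2R) : Prop := ∃ C : ℝ, ∀ᵐ x, ‖u x‖ ≤ C

/-- The trilinear form `∫ h̄ u w`. -/
noncomputable def tri (h u w : L2R) : ℂ := ∫ x, (starRingEnd ℂ) (h x) * (u x * w x)

theorem memLp_mul_of_essBdd (u : L2R) {w : L2R} (hw : EssBdd w) : MemLp (fun x => u x * w x) 2 := by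
  obtain ⟨C, hC⟩ := hw
  refine MemLp.of_le_mul (c := C) (Lp.memLp u)
    ((Lp.aestronglyMeasurable u).mul (Lp.aestronglyMeasurable w)) ?_
  filter_upwards [hC] with x hx
  rw [norm_mul, mul_comm]
  exact mul_le_mul_of_nonneg_right hx (norm_nonneg _)

theorem integrable_tri (h u : L2R) {w : L2R} (hw : EssBdd w) :
    Integrable fun x => (starRingEnd ℂ) (h x) * (u x * w x) :=
  (Lp.memLp h).star.integrable_mul (memLp_mul_of_essBdd u hw)

theorem EssBdd.add {u v : L2R} (hu : EssBdd u) (hv : EssBdd v) : EssBdd (u + v) := by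
  obtain ⟨C, hC⟩ := hu
  obtain ⟨D, hD⟩ := hv
  refine ⟨C + D, ?_⟩
  filter_upwards [hC, hD, Lp.coeFn_add u v] with x h1 h2 h3
  rw [h3]
  exact (norm_add_le _ _).trans (add_le_add h1 h2)

theorem essBdd_zero : EssBdd 0 := ⟨0, by
  filter_upwards [Lp.coeFn_zero ℂ 2 (volume : Measure ℝ)] with x hx
  rw [hx, Pi.zero_apply, norm_zero]⟩

theorem EssBdd.sum {α : Type*} {s : Finset α} {u : α → L2R} (hu : ∀ a ∈ s, EssBdd (u a)) :
    EssBdd (∑ a ∈ s, u a) := by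
  classical
  induction s using Finset.induction_on with
  | empty => simpa using essBdd_zero
  | insert a s ha ih =>
    rw [Finset.sum_insert ha]
    exact (hu a (Finset.mem_insert_self _ _)).add (ih fun b hb => hu b (Finset.mem_insert_of_mem hb))

theorem tri_add_left (h h' u : L2R) {w : L2R} (hw : EssBdd w) :
    tri (h + h') u w = tri h u w + tri h' u w := by
  unfold tri
  rw [← integral_add (integrable_tri h u hw) (integrable_tri h' u hw)]
  refine integral_congr_ae ?_
  filter_upwards [Lp.coeFn_add h h'] with x hx
  rw [hx, Pi.add_apply, map_add]
  ring

theorem tri_add_mid (h u u' : L2R) {w : L2R} (hw : EssBdd w) :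
    tri h (u + u') w = tri h u w + tri h u' w := by
  unfold tri
  rw [← integral_add (integrable_tri h u hw) (integrable_tri h u' hw)]
  refine integral_congr_ae ?_
  filter_upwards [Lp.coeFn_add u u'] with x hx
  rw [hx, Pi.add_apply]
  ring

theorem tri_comm (h u w : L2R) : tri h u w = tri h w u := by
  unfold tri
  simp only [mul_comm]

theorem tri_add_right (h u : L2R) {w w' : L2R} (hw : EssBdd w) (hw' : EssBdd w') :
    tri h u (w + w') = tri h u w + tri h u w' := by
  unfold tri
  rw [← integral_add (integrable_tri h u hw) (integrable_tri h u hw')]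
  refine integral_congr_ae ?_
  filter_upwards [Lp.coeFn_add w w'] with x hx
  rw [hx, Pi.add_apply]
  ring

theorem tri_zero_mid (h w : L2R) : tri h 0 w = 0 := by
  unfold tri
  refine integral_eq_zero_of_ae ?_
  filter_upwards [Lp.coeFn_zero ℂ 2 (volume : Measure ℝ)] with x hx
  rw [hx, Pi.zero_apply, zero_mul, mul_zero]

theorem tri_zero_right (h u : L2R) : tri h u 0 = 0 := by
  rw [tri_comm, tri_zero_mid]

theorem tri_sum_mid {α : Type*} (s : Finset α) (h : L2R) (u : α → L2R) {w : L2R} (hw : EssBdd w) :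
    tri h (∑ a ∈ s, u a) w = ∑ a ∈ s, tri h (u a) w := by
  classical
  induction s using Finset.induction_on with
  | empty => simp [tri_zero_mid]
  | insert a s ha ih => rw [Finset.sum_insert ha, Finset.sum_insert ha, tri_add_mid _ _ _ hw, ih]

theorem tri_sub_mid (h u u' : L2R) {w : L2R} (hw : EssBdd w) :
    tri h (u - u') w = tri h u w - tri h u' w := by
  have := tri_add_mid h (u - u') u' hw
  rw [sub_add_cancel] at this
  rw [this, add_sub_cancel_right]

theorem tri_sum_right {α : Type*} (s : Finset α) (h u : L2R) {w : α → L2R}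
    (hw : ∀ a ∈ s, EssBdd (w a)) : tri h u (∑ a ∈ s, w a) = ∑ a ∈ s, tri h u (w a) := by
  classical
  induction s using Finset.induction_on with
  | empty => simp [tri_zero_right]
  | insert a s ha ih =>
    rw [Finset.sum_insert ha, Finset.sum_insert ha, tri_add_right _ _
      (hw a (Finset.mem_insert_self _ _))
      (EssBdd.sum fun b hb => hw b (Finset.mem_insert_of_mem hb)),
      ih fun b hb => hw b (Finset.mem_insert_of_mem hb)]

theorem memLp_symbol {s : Set ℝ} (hs : MeasurableSet s) (hv : volume s ≠ ⊤) :
    MemLp (fun ξ => ((s.indicator (fun _ => (1 : ℝ)) ξ : ℝ) : ℂ)) 2 := by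
  have h : (fun ξ => ((s.indicator (fun _ => (1 : ℝ)) ξ : ℝ) : ℂ)) = s.indicator fun _ => (1 : ℂ) := by
    ext ξ
    by_cases h : ξ ∈ s
    · simp [h]
    · simp [h]
  rw [h]
  exact memLp_indicator_const 2 hs 1 (Or.inr hv)

theorem memLp_lowSym (j : ℤ) : MemLp (fun ξ => (lowSym j ξ : ℂ)) 2 :=
  memLp_symbol measurableSet_Icc (by simp)

theorem memLp_bandSym (j : ℤ) : MemLp (fun ξ => (bandSym j ξ : ℂ)) 2 := by
  refine memLp_symbol ((measurableSet_le measurable_const measurable_norm).inter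
    (measurableSet_le measurable_norm measurable_const)) ?_
  refine measure_ne_top_of_subset (t := {ξ : ℝ | (2 : ℝ) ^ (-j - 1) ≤ |ξ| ∧ |ξ| ≤ (2 : ℝ) ^ (-j)})
    (s := Set.Icc (-(2 : ℝ) ^ (-j)) ((2 : ℝ) ^ (-j))) (fun ξ hξ => abs_le.1 hξ.2) ?_
  rw [Real.volume_Icc]
  exact ENNReal.ofReal_ne_top

theorem exists_mulT_eq_fourierInv {w : ℝ → ℝ} (hw : BddSym w) (hw2 : MemLp (fun ξ => (w ξ : ℂ)) 2)
    (f : L2R) : ∃ a : ℝ → ℂ, Integrable a ∧ MemLp a 2 ∧ (∀ ξ, w ξ = 0 → a ξ = 0) ∧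
      mulT w f =ᵐ[volume] 𝓕⁻ a := by
  have ha : Integrable fun ξ => (w ξ : ℂ) * (𝓕 f : L2R) ξ := hw2.integrable_mul (Lp.memLp _)
  have ha2 : MemLp (fun ξ => (w ξ : ℂ) * (𝓕 f : L2R) ξ) 2 := hw.memLp (Lp.memLp _)
  refine ⟨_, ha, ha2, fun ξ h => by rw [h, Complex.ofReal_zero, zero_mul], ?_⟩
  have e1 : mulT w f = 𝓕⁻ (ha2.toLp _) := by
    rw [mulT]
    congr 1
    exact (ae_eq_symMul hw Filter.EventuallyEq.rfl _ ha2.coeFn_toLp).symm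
  rw [e1]
  exact fourierInv_toLp_ae_eq ha ha2

theorem norm_fourierInv_le (a : ℝ → ℂ) (x : ℝ) : ‖𝓕⁻ a x‖ ≤ ∫ ξ, ‖a ξ‖ := by
  rw [Real.fourierInv_eq_fourier_neg]
  exact norm_fourier_le a _

theorem essBdd_mulT {w : ℝ → ℝ} (hw : BddSym w) (hw2 : MemLp (fun ξ => (w ξ : ℂ)) 2) (f : L2R) :
    EssBdd (mulT w f) := by
  obtain ⟨a, -, -, -, h⟩ := exists_mulT_eq_fourierInv hw hw2 f
  refine ⟨∫ ξ, ‖a ξ‖, ?_⟩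
  filter_upwards [h] with x hx
  rw [hx]
  exact norm_fourierInv_le a x

open scoped Convolution in
/-- The product of two band-limited functions is orthogonal to functions without frequencies in the
sum of the bands. -/
theorem tri_eq_zero {v w : ℝ → ℝ} (hv : BddSym v) (hv2 : MemLp (fun ξ => (v ξ : ℂ)) 2)
    (hw : BddSym w) (hw2 : MemLp (fun ξ => (w ξ : ℂ)) 2) (r f g : L2R)
    (hr : ∀ᵐ ξ, (∃ s t, v s ≠ 0 ∧ w t ≠ 0 ∧ s + t = ξ) → (𝓕 r : L2R) ξ = 0) :
    tri r (mulT v f) (mulT w g) = 0 := by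
  obtain ⟨a, ha, ha2, ha0, hae⟩ := exists_mulT_eq_fourierInv hv hv2 f
  obtain ⟨c, hc, hc2, hc0, hce⟩ := exists_mulT_eq_fourierInv hw hw2 g
  set d : ℝ → ℂ := a ⋆[ContinuousLinearMap.mul ℂ ℂ] c with hd
  have hd1 : Integrable d := ha.integrable_convolution _ hc
  have hdb : ∀ x, ‖d x‖ ≤ (∫ t, (‖a t‖ ^ 2)) + ∫ t, ‖c t‖ ^ 2 := fun x => by
    have i1 := ha2.integrable_norm_pow (p := 2) two_ne_zero
    have i2 := hc2.integrable_norm_pow (p := 2) two_ne_zero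
    have i3 : Integrable fun t => ‖c (x - t)‖ ^ 2 := i2.comp_sub_left x
    have e : ∫ t, ‖c (x - t)‖ ^ 2 = ∫ t, ‖c t‖ ^ 2 :=
      integral_sub_left_eq_self (fun t => ‖c t‖ ^ 2) volume x
    rw [← e, ← integral_add i1 i3]
    refine norm_integral_le_of_norm_le (i1.add i3) (ae_of_all _ fun t => ?_)
    simp only [ContinuousLinearMap.mul_apply', norm_mul]
    nlinarith [sq_nonneg (‖a t‖ - ‖c (x - t)‖), sq_nonneg (‖a t‖), sq_nonneg ‖c (x - t)‖]
  have hd2 : MemLp d 2 := by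
    refine (memLp_two_iff_integrable_sq_norm hd1.1).2 ?_
    refine (hd1.norm.const_mul ((∫ t, (‖a t‖ ^ 2)) + ∫ t, ‖c t‖ ^ 2)).mono' (hd1.1.norm.pow 2)
      (ae_of_all _ fun x => ?_)
    rw [Real.norm_of_nonneg (by positivity), sq]
    exact mul_le_mul_of_nonneg_right (hdb x) (norm_nonneg _)
  have hprod : ∀ x, 𝓕⁻ d x = 𝓕⁻ a x * 𝓕⁻ c x := fun x => by
    simp only [Real.fourierInv_eq_fourier_neg]
    exact Real.fourier_mul_convolution_eq ha hc _
  have e1 : tri r (mulT v f) (mulT w g) = inner ℂ r (𝓕⁻ (hd2.toLp d) : L2R) := by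
    rw [L2.inner_def]
    refine integral_congr_ae ?_
    filter_upwards [hae, hce, fourierInv_toLp_ae_eq hd1 hd2] with x h1 h2 h3
    rw [h1, h2, h3, hprod, RCLike.inner_apply]
    ring
  rw [e1, ← Lp.inner_fourier_eq, fourier_fourierInv_eq, L2.inner_def]
  refine integral_eq_zero_of_ae ?_
  filter_upwards [hr, hd2.coeFn_toLp] with ξ h1 h2
  rw [h2, RCLike.inner_apply, Pi.zero_apply]
  by_cases h3 : d ξ = 0
  · rw [h3, zero_mul]
  · have h4 := support_convolution_subset (L := ContinuousLinearMap.mul ℂ ℂ) (μ := volume)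
      (f := a) (g := c) (Function.mem_support.2 h3)
    obtain ⟨s, hs, t, ht, hst⟩ := Set.mem_add.1 h4
    rw [h1 ⟨s, t, fun h => hs (ha0 s h), fun h => ht (hc0 t h), hst⟩, map_zero, mul_zero]

end Trilinear

section ParaproductEstimates

variable {r s t : ℝ} {κ : Type} [Fintype κ]

theorem enorm_tri_le (h u w : L2R) : ‖tri h u w‖ₑ ≤ ∫⁻ x, ‖h x‖ₑ * ‖u x‖ₑ * ‖w x‖ₑ := by
  unfold tri
  refine (enorm_integral_le_lintegral_enorm _).trans_eq (lintegral_congr fun x => ?_)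
  rw [enorm_mul, enorm_mul, RCLike.enorm_conj, mul_assoc]

theorem lintegral_mul_mul_le (hr : 0 < r) (hs : 0 < s) (ht : 0 < t)
    (hsum : 1 / r + 1 / s + 1 / t = 1) {E₁ E₂ E₃ : Type*} [NormedAddCommGroup E₁]
    [NormedAddCommGroup E₂] [NormedAddCommGroup E₃] {A : ℝ → E₁} {B : ℝ → E₂} {D : ℝ → E₃}
    (hA : AEStronglyMeasurable A) (hB : AEStronglyMeasurable B) (hD : AEStronglyMeasurable D) :
    ∫⁻ x, ‖A x‖ₑ * ‖B x‖ₑ * ‖D x‖ₑ ≤ eLpNorm A (ENNReal.ofReal r) volume *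
      eLpNorm B (ENNReal.ofReal s) volume * eLpNorm D (ENNReal.ofReal t) volume := by
  have h := ENNReal.lintegral_prod_norm_pow_le (μ := (volume : Measure ℝ)) (Finset.univ : Finset (Fin 3))
    (f := ![fun x => ‖A x‖ₑ ^ r, fun x => ‖B x‖ₑ ^ s, fun x => ‖D x‖ₑ ^ t])
    (p := ![1 / r, 1 / s, 1 / t])
    (by
      intro i _
      fin_cases i
      · exact hA.enorm.pow_const _
      · exact hB.enorm.pow_const _
      · exact hD.enorm.pow_const _)
    (by simpa [Fin.sum_univ_three] using hsum)
    (by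
      intro i _
      fin_cases i
      · exact (one_div_pos.2 hr).le
      · exact (one_div_pos.2 hs).le
      · exact (one_div_pos.2 ht).le)
  simp only [Fin.prod_univ_three, Matrix.cons_val_zero, Matrix.cons_val_one, Matrix.cons_val] at h
  have e : ∀ {q : ℝ}, 0 < q → ∀ y : ENNReal, (y ^ q) ^ (1 / q) = y := fun hq y => by
    rw [← ENNReal.rpow_mul, mul_one_div_cancel hq.ne', ENNReal.rpow_one]
  simp only [e hr, e hs, e ht] at h
  rw [eLpNorm_eq_lintegral_rpow_enorm_toReal (by simpa using hr) ENNReal.ofReal_ne_top,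
    eLpNorm_eq_lintegral_rpow_enorm_toReal (by simpa using hs) ENNReal.ofReal_ne_top,
    eLpNorm_eq_lintegral_rpow_enorm_toReal (by simpa using ht) ENNReal.ofReal_ne_top,
    ENNReal.toReal_ofReal hr.le, ENNReal.toReal_ofReal hs.le, ENNReal.toReal_ofReal ht.le]
  exact h

theorem sum_lintegral_mul_mul_le (hr : 0 < r) (hs : 0 < s) (ht : 0 < t)
    (hsum : 1 / r + 1 / s + 1 / t = 1) {E : Type*} [NormedAddCommGroup E] (a b c : κ → L2R)
    {M : ℝ → E} (hM : AEStronglyMeasurable M) (hc : ∀ᵐ x, ∀ k, ‖c k x‖ ≤ ‖M x‖) :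
    ∑ k, ∫⁻ x, ‖a k x‖ₑ * ‖b k x‖ₑ * ‖c k x‖ₑ ≤ eLpNorm (vecLp a) (ENNReal.ofReal r) volume *
      eLpNorm (vecLp b) (ENNReal.ofReal s) volume * eLpNorm M (ENNReal.ofReal t) volume := by
  refine le_trans ?_ (lintegral_mul_mul_le hr hs ht hsum
    (stronglyMeasurable_vecLp a).aestronglyMeasurable
    (stronglyMeasurable_vecLp b).aestronglyMeasurable hM)
  have hm : ∀ k ∈ Finset.univ, AEMeasurable (fun x => ‖a k x‖ₑ * ‖b k x‖ₑ * ‖c k x‖ₑ) volume :=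
    fun k _ => ((Lp.aestronglyMeasurable (a k)).enorm.mul
      (Lp.aestronglyMeasurable (b k)).enorm).mul (Lp.aestronglyMeasurable (c k)).enorm
  rw [← lintegral_finsetSum' _ hm]
  refine lintegral_mono_ae ?_
  filter_upwards [hc] with x hx
  have h1 : ∑ k, ‖a k x‖ * ‖b k x‖ ≤ ‖vecLp a x‖ * ‖vecLp b x‖ := by
    refine le_of_sq_le_sq ?_ (by positivity)
    rw [mul_pow, norm_vecFun_sq, norm_vecFun_sq]
    exact Finset.sum_mul_sq_le_sq_mul_sq _ _ _
  have h2 : ∑ k, ‖a k x‖ * ‖b k x‖ * ‖c k x‖ ≤ ‖vecLp a x‖ * ‖vecLp b x‖ * ‖M x‖ := by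
    refine le_trans (Finset.sum_le_sum fun k _ =>
      mul_le_mul_of_nonneg_left (hx k) (by positivity)) ?_
    rw [← Finset.sum_mul]
    exact mul_le_mul_of_nonneg_right h1 (norm_nonneg _)
  simp only [← ofReal_norm]
  have e : ∀ y z w : ℝ, 0 ≤ y → 0 ≤ z → ENNReal.ofReal y * ENNReal.ofReal z * ENNReal.ofReal w =
      ENNReal.ofReal (y * z * w) := fun y z w hy hz => by
    rw [← ENNReal.ofReal_mul hy, ← ENNReal.ofReal_mul (mul_nonneg hy hz)]
  simp only [e _ _ _ (norm_nonneg _) (norm_nonneg _)]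
  rw [← ENNReal.ofReal_sum_of_nonneg fun k _ => by positivity]
  exact ENNReal.ofReal_le_ofReal h2

theorem abs_add_mem_band {e b : ℤ} (hb : e + 2 ≤ b) {x y : ℝ} (hx : bandSym e x ≠ 0)
    (hy : lowSym b y ≠ 0) : (2 : ℝ) ^ (-e - 2) ≤ |x + y| ∧ |x + y| ≤ (2 : ℝ) ^ (-e + 1) := by
  have h1 : (2 : ℝ) ^ (-e - 1) ≤ |x| ∧ |x| ≤ (2 : ℝ) ^ (-e) := by
    by_contra h
    exact hx (bandSym_eq_zero h)
  have h2 : |y| ≤ (2 : ℝ) ^ (-b) := by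
    by_contra h
    exact hy (Set.indicator_of_notMem (s := Set.Icc (-(2 : ℝ) ^ (-b)) ((2 : ℝ) ^ (-b)))
      (fun h' => h (abs_le.2 h')) _)
  have h3 : (2 : ℝ) ^ (-b) ≤ (2 : ℝ) ^ (-e - 2) :=
    zpow_le_zpow_right₀ one_le_two (by omega)
  have e1 : (2 : ℝ) ^ (-e - 1) = 2 * (2 : ℝ) ^ (-e - 2) := by
    rw [← zpow_one_add₀ two_ne_zero]; congr 1; ring
  have e2 : (2 : ℝ) ^ (-e) = 4 * (2 : ℝ) ^ (-e - 2) := by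
    rw [show (4 : ℝ) = 2 ^ (2 : ℤ) by norm_num, ← zpow_add₀ two_ne_zero]; congr 1; ring
  have e3 : (2 : ℝ) ^ (-e + 1) = 8 * (2 : ℝ) ^ (-e - 2) := by
    rw [show (8 : ℝ) = 2 ^ (3 : ℤ) by norm_num, ← zpow_add₀ two_ne_zero]; congr 1; ring
  have h4 : (0 : ℝ) < (2 : ℝ) ^ (-e - 2) := by positivity
  constructor
  · have := abs_sub_abs_le_abs_sub x (-y)
    rw [sub_neg_eq_add, abs_neg] at this
    linarith
  · have := abs_add_le x y
    linarith

theorem bandSym_add_add_eq_one (e : ℤ) {ξ : ℝ} (h1 : (2 : ℝ) ^ (-e - 2) ≤ |ξ|)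
    (h2 : |ξ| ≤ (2 : ℝ) ^ (-e + 1)) (h3 : |ξ| ≠ (2 : ℝ) ^ (-e)) (h4 : |ξ| ≠ (2 : ℝ) ^ (-e - 1)) :
    bandSym (e + -1) ξ + bandSym e ξ + bandSym (e + 1) ξ = 1 := by
  have i1 : (2 : ℝ) ^ (-e - 1) < (2 : ℝ) ^ (-e) := zpow_lt_zpow_right₀ one_lt_two (by omega)
  have x1 : -(e + -1) - 1 = -e := by ring
  have x2 : -(e + -1) = -e + 1 := by ring
  have x3 : -(e + 1) - 1 = -e - 2 := by ring
  have x4 : -(e + 1) = -e - 1 := by ring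
  rcases lt_or_gt_of_ne h3 with h5 | h5
  · rw [bandSym_eq_zero (j := e + -1) (by rw [x1]; exact fun h => absurd h.1 (not_le.2 h5))]
    rcases lt_or_gt_of_ne h4 with h6 | h6
    · rw [bandSym_eq_zero (j := e) fun h => absurd h.1 (not_le.2 h6),
        bandSym_eq_one (j := e + 1) (by rw [x3, x4]; exact ⟨h1, h6.le⟩)]
      norm_num
    · rw [bandSym_eq_one (j := e) ⟨h6.le, h5.le⟩,
        bandSym_eq_zero (j := e + 1) (by rw [x4]; exact fun h => absurd h.2 (not_le.2 h6))]
      norm_num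
  · rw [bandSym_eq_one (j := e + -1) (by rw [x1, x2]; exact ⟨h5.le, h2⟩),
      bandSym_eq_zero (j := e) fun h => absurd h.2 (not_le.2 h5),
      bandSym_eq_zero (j := e + 1) (by rw [x4]; exact fun h => absurd h.2 (not_le.2 (i1.trans h5)))]
    norm_num

theorem essBdd_lowSym (j : ℤ) (w : L2R) : EssBdd (mulT (lowSym j) w) :=
  essBdd_mulT (bddSym_lowSym j) (memLp_lowSym j) w

theorem essBdd_bandSym (j : ℤ) (w : L2R) : EssBdd (mulT (bandSym j) w) :=
  essBdd_mulT (bddSym_bandSym j) (memLp_bandSym j) w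

theorem tri_band_low {e b : ℤ} (hb : e + 2 ≤ b) (h u w : L2R) :
    tri h (mulT (bandSym e) u) (mulT (lowSym b) w) =
      tri (mulT (bandSym (e + -1)) h) (mulT (bandSym e) u) (mulT (lowSym b) w) +
      tri (mulT (bandSym e) h) (mulT (bandSym e) u) (mulT (lowSym b) w) +
      tri (mulT (bandSym (e + 1)) h) (mulT (bandSym e) u) (mulT (lowSym b) w) := by
  have hw := essBdd_lowSym b w
  have b1 := (bddSym_bandSym (e + -1)).add (bddSym_bandSym e)
  have b2 := b1.add (bddSym_bandSym (e + 1))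
  have h0 := tri_eq_zero (bddSym_bandSym e) (memLp_bandSym e) (bddSym_lowSym b) (memLp_lowSym b)
    (h - mulT (fun ξ => bandSym (e + -1) ξ + bandSym e ξ + bandSym (e + 1) ξ) h) u w (by
      have hF : (𝓕 (h - mulT (fun ξ => bandSym (e + -1) ξ + bandSym e ξ + bandSym (e + 1) ξ) h) :
          L2R) = 𝓕 h - 𝓕 (mulT (fun ξ => bandSym (e + -1) ξ + bandSym e ξ + bandSym (e + 1) ξ) h) := by
        rw [eq_sub_iff_add_eq, ← FourierTransform.fourier_add, sub_add_cancel]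
      rw [hF]
      filter_upwards [Lp.coeFn_sub (𝓕 h : L2R)
        (𝓕 (mulT (fun ξ => bandSym (e + -1) ξ + bandSym e ξ + bandSym (e + 1) ξ) h)),
        coeFn_fourier_mulT b2 h, ae_abs_ne ((2 : ℝ) ^ (-e)), ae_abs_ne ((2 : ℝ) ^ (-e - 1))]
        with ξ h1 h2 h3 h4
      rintro ⟨x, y, hx, hy, rfl⟩
      obtain ⟨h5, h6⟩ := abs_add_mem_band hb hx hy
      rw [h1, Pi.sub_apply, h2, bandSym_add_add_eq_one e h5 h6 h3 h4, Complex.ofReal_one, one_mul,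
        sub_self])
  rw [← tri_add_left _ _ _ hw, ← tri_add_left _ _ _ hw, ← mulT_sym_add (bddSym_bandSym _)
    (bddSym_bandSym _), ← mulT_sym_add b1 (bddSym_bandSym _)]
  have h1 := tri_add_left (h - mulT (fun ξ => bandSym (e + -1) ξ + bandSym e ξ + bandSym (e + 1) ξ) h)
    (mulT (fun ξ => bandSym (e + -1) ξ + bandSym e ξ + bandSym (e + 1) ξ) h) (mulT (bandSym e) u) hw
  rw [sub_add_cancel, h0, zero_add] at h1
  exact h1

/-- The product of two Littlewood–Paley square functions. -/
theorem exists_sum_tri_band_band_le (hr : 1 < r) (hs : 1 < s) (ht : 1 < t)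
    (hsum : 1 / r + 1 / s + 1 / t = 1) : ∃ C : ENNReal, C ≠ ⊤ ∧ ∀ (κ : Type) [Fintype κ]
      (e₁ e₂ : κ → ℤ), Function.Injective e₁ → Function.Injective e₂ → ∀ h u w : L2R,
      MemLp u (ENNReal.ofReal s) → MemLp w (ENNReal.ofReal t) →
      ‖∑ k, tri h (mulT (bandSym (e₁ k)) u) (mulT (bandSym (e₂ k)) w)‖ₑ ≤
        C * (eLpNorm h (ENNReal.ofReal r) volume * eLpNorm u (ENNReal.ofReal s) volume *
          eLpNorm w (ENNReal.ofReal t) volume) := by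
  obtain ⟨C₂, hC₂, H₂⟩ := exists_colBd_bandSym (Real.HolderConjugate.conjExponent hs)
  obtain ⟨C₃, hC₃, H₃⟩ := exists_colBd_bandSym (Real.HolderConjugate.conjExponent ht)
  refine ⟨C₂ * C₃, ENNReal.mul_ne_top hC₂ hC₃, fun κ _ e₁ e₂ he₁ he₂ h u w hu hw => ?_⟩
  refine (enorm_sum_le _ _).trans ((Finset.sum_le_sum fun k _ => enorm_tri_le _ _ _).trans ?_)
  have h1 := sum_lintegral_mul_mul_le (κ := κ) (r := s) (s := t) (t := r) (by linarith) (by linarith)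
    (by linarith) (by linarith) (fun k => mulT (bandSym (e₁ k)) u) (fun k => mulT (bandSym (e₂ k)) w)
    (fun _ => h) (Lp.aestronglyMeasurable h) (ae_of_all _ fun x k => le_rfl)
  calc _ = ∑ k, ∫⁻ x, ‖mulT (bandSym (e₁ k)) u x‖ₑ * ‖mulT (bandSym (e₂ k)) w x‖ₑ * ‖h x‖ₑ := by
        refine Finset.sum_congr rfl fun k _ => lintegral_congr fun x => ?_
        ring
    _ ≤ _ := h1
    _ ≤ _ := by
        refine (mul_le_mul_left (mul_le_mul' (H₂ κ e₁ he₁ u hu) (H₃ κ e₂ he₂ w hw)) _).trans_eq ?_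
        ring

/-- The paraproduct with frequency separation. -/
theorem exists_sum_tri_band_low_le (hr : 1 < r) (hs : 1 < s) (ht : 1 < t)
    (hsum : 1 / r + 1 / s + 1 / t = 1) : ∃ C : ENNReal, C ≠ ⊤ ∧ ∀ (κ : Type) [Fintype κ]
      (e b : κ → ℤ), Function.Injective e → Function.Injective b → (∀ k, e k + 2 ≤ b k) →
      ∀ h u w : L2R, MemLp h (ENNReal.ofReal r) → MemLp u (ENNReal.ofReal s) →
      MemLp w (ENNReal.ofReal t) →
      ‖∑ k, tri h (mulT (bandSym (e k)) u) (mulT (lowSym (b k)) w)‖ₑ ≤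
        C * (eLpNorm h (ENNReal.ofReal r) volume * eLpNorm u (ENNReal.ofReal s) volume *
          eLpNorm w (ENNReal.ofReal t) volume) := by
  obtain ⟨C₁, hC₁, H₁⟩ := exists_colBd_bandSym (Real.HolderConjugate.conjExponent hr)
  obtain ⟨C₂, hC₂, H₂⟩ := exists_colBd_bandSym (Real.HolderConjugate.conjExponent hs)
  obtain ⟨C₃, hC₃, H₃⟩ := exists_maximal_lowSym (Real.HolderConjugate.conjExponent ht)
  refine ⟨3 * (C₁ * C₂ * C₃), ENNReal.mul_ne_top (by simp)
    (ENNReal.mul_ne_top (ENNReal.mul_ne_top hC₁ hC₂) hC₃), fun κ _ e b he hb heb h u w hh hu hw => ?_⟩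
  obtain ⟨M, hMm, hM0, hMle, hMn⟩ := H₃ κ b hb w hw
  have key : ∀ d : κ → ℤ, Function.Injective d →
      ‖∑ k, tri (mulT (bandSym (d k)) h) (mulT (bandSym (e k)) u) (mulT (lowSym (b k)) w)‖ₑ ≤
        (C₁ * C₂ * C₃) * (eLpNorm h (ENNReal.ofReal r) volume *
          eLpNorm u (ENNReal.ofReal s) volume * eLpNorm w (ENNReal.ofReal t) volume) := fun d hd => by
    refine (enorm_sum_le _ _).trans ((Finset.sum_le_sum fun k _ => enorm_tri_le _ _ _).trans ?_)
    refine (sum_lintegral_mul_mul_le (r := r) (s := s) (t := t) (by linarith) (by linarith)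
      (by linarith) hsum _ _ _ hMm ?_).trans ?_
    · filter_upwards [hMle] with x hx k
      rw [Real.norm_of_nonneg (hM0 x)]
      exact hx k
    · refine (mul_le_mul' (mul_le_mul' (H₁ κ d hd h hh) (H₂ κ e he u hu)) hMn).trans_eq ?_
      ring
  have hinj : ∀ c : ℤ, Function.Injective fun k => e k + c := fun c =>
    (add_left_injective c).comp he
  simp only [fun k => tri_band_low (heb k) h u w, Finset.sum_add_distrib]
  refine (enorm_add_le _ _).trans ((add_le_add ((enorm_add_le _ _).trans (add_le_add
    (key _ (hinj (-1))) (key _ he))) (key _ (hinj 1))).trans_eq ?_)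
  ring

end ParaproductEstimates

section SymbolIdentities

theorem bandSym_mul_self (j : ℤ) (ξ : ℝ) : bandSym j ξ * bandSym j ξ = bandSym j ξ := by
  by_cases h : (2 : ℝ) ^ (-j - 1) ≤ |ξ| ∧ |ξ| ≤ (2 : ℝ) ^ (-j)
  · rw [bandSym_eq_one h, one_mul]
  · rw [bandSym_eq_zero h, zero_mul]

theorem lowSym_eq_one {j : ℤ} {ξ : ℝ} (h : |ξ| ≤ (2 : ℝ) ^ (-j)) : lowSym j ξ = 1 :=
  Set.indicator_of_mem (s := Set.Icc (-(2 : ℝ) ^ (-j)) ((2 : ℝ) ^ (-j))) (abs_le.1 h) _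

theorem lowSym_eq_zero {j : ℤ} {ξ : ℝ} (h : (2 : ℝ) ^ (-j) < |ξ|) : lowSym j ξ = 0 :=
  Set.indicator_of_notMem (s := Set.Icc (-(2 : ℝ) ^ (-j)) ((2 : ℝ) ^ (-j)))
    (fun h' => absurd (abs_le.2 h') (not_le.2 h)) _

theorem mulT_bandSym_self (j : ℤ) (f : L2R) :
    mulT (bandSym j) (mulT (bandSym j) f) = mulT (bandSym j) f := by
  rw [mulT_mulT (bddSym_bandSym j) (bddSym_bandSym j)]
  simp only [bandSym_mul_self]

theorem mulT_lowSym_succ (j : ℤ) (f : L2R) :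
    mulT (lowSym j) f = mulT (lowSym (j + 1)) f + mulT (bandSym j) f := by
  rw [← mulT_sym_add (bddSym_lowSym _) (bddSym_bandSym _)]
  refine mulT_congr (bddSym_lowSym _) ((bddSym_lowSym _).add (bddSym_bandSym _)) ?_ f
  have x1 : -(j + 1) = -j - 1 := by ring
  have h3 : (2 : ℝ) ^ (-j - 1) < (2 : ℝ) ^ (-j) := zpow_lt_zpow_right₀ one_lt_two (by omega)
  filter_upwards [ae_abs_ne ((2 : ℝ) ^ (-j - 1))] with ξ h1
  rcases lt_or_gt_of_ne h1 with h2 | h2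
  · rw [lowSym_eq_one (h2.trans h3).le, lowSym_eq_one (by rw [x1]; exact h2.le),
      bandSym_eq_zero fun h => absurd h.1 (not_le.2 h2), add_zero]
  · rw [lowSym_eq_zero (j := j + 1) (by rw [x1]; exact h2), zero_add]
    rcases le_or_gt |ξ| ((2 : ℝ) ^ (-j)) with h4 | h4
    · rw [lowSym_eq_one h4, bandSym_eq_one ⟨h2.le, h4⟩]
    · rw [lowSym_eq_zero h4, bandSym_eq_zero fun h => absurd h.2 (not_le.2 h4)]

theorem mulT_lowSym_eq_add_sum (a : ℤ) (n : ℕ) (f : L2R) : mulT (lowSym a) f =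
    mulT (lowSym (a + n)) f + ∑ i ∈ Finset.range n, mulT (bandSym (a + i)) f := by
  induction n with
  | zero => simp
  | succ n ih =>
    rw [ih, Finset.sum_range_succ, mulT_lowSym_succ (a + n)]
    push_cast
    rw [add_assoc a]
    abel

theorem mulT_lowSym_bandSym (b m : ℤ) (f : L2R) :
    mulT (lowSym b) (mulT (bandSym m) f) = if b ≤ m then mulT (bandSym m) f else 0 := by
  rw [mulT_mulT (bddSym_lowSym b) (bddSym_bandSym m)]
  split_ifs with h
  · refine mulT_congr ((bddSym_lowSym b).mul (bddSym_bandSym m)) (bddSym_bandSym m)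
      (ae_of_all _ fun ξ => ?_) f
    by_cases h1 : (2 : ℝ) ^ (-m - 1) ≤ |ξ| ∧ |ξ| ≤ (2 : ℝ) ^ (-m)
    · simp only [lowSym_eq_one (j := b) (h1.2.trans (zpow_le_zpow_right₀ one_le_two (by omega))),
        one_mul]
    · simp only [bandSym_eq_zero h1, mul_zero]
  · refine mulT_eq_zero ?_ ((bddSym_lowSym b).mul (bddSym_bandSym m)) f
    filter_upwards [ae_abs_ne ((2 : ℝ) ^ (-m - 1))] with ξ h1
    have h2 : (2 : ℝ) ^ (-b) ≤ (2 : ℝ) ^ (-m - 1) := zpow_le_zpow_right₀ one_le_two (by omega)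
    rcases lt_or_gt_of_ne h1 with h3 | h3
    · rw [bandSym_eq_zero fun h => absurd h.1 (not_le.2 h3), mul_zero]
    · rw [lowSym_eq_zero (h2.trans_lt h3), zero_mul]

end SymbolIdentities

section Reconstruction

variable {p q : ℝ} {κ : Type} [Fintype κ]

theorem enorm_sum_inner_le (hpq : p.HolderConjugate q) (g f : κ → L2R) :
    ‖∑ k, inner ℂ (g k) (f k)‖ₑ ≤ eLpNorm (vecLp f) (ENNReal.ofReal p) volume *
      eLpNorm (vecLp g) (ENNReal.ofReal q) volume := by
  have e1 : ∑ k, inner ℂ (g k) (f k) = ∫ x, inner ℂ (vecLp g x) (vecLp f x) := by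
    simp only [L2.inner_def, PiLp.inner_apply]
    rw [integral_finsetSum _ fun k _ => L2.integrable_inner (g k) (f k)]
    rfl
  rw [e1]
  refine (enorm_integral_le_lintegral_enorm _).trans ?_
  refine (lintegral_mono fun x => ?_).trans ((ENNReal.lintegral_mul_le_Lp_mul_Lq volume hpq
    (stronglyMeasurable_vecLp f).aestronglyMeasurable.enorm
    (stronglyMeasurable_vecLp g).aestronglyMeasurable.enorm).trans_eq ?_)
  · simp only [Pi.mul_apply, ← ofReal_norm]
    rw [← ENNReal.ofReal_mul (norm_nonneg _), mul_comm ‖vecLp f x‖]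
    exact ENNReal.ofReal_le_ofReal (norm_inner_le_norm _ _)
  · rw [eLpNorm_eq_lintegral_rpow_enorm_toReal (by simpa using hpq.pos) ENNReal.ofReal_ne_top,
      eLpNorm_eq_lintegral_rpow_enorm_toReal (by simpa using hpq.symm.pos) ENNReal.ofReal_ne_top,
      ENNReal.toReal_ofReal hpq.pos.le, ENNReal.toReal_ofReal hpq.symm.pos.le]

/-- Partial sums of the Littlewood–Paley decomposition are bounded in `L^p`. -/
theorem exists_eLpNorm_sum_bandSym_le (hpq : p.HolderConjugate q) : ∃ C : ENNReal, C ≠ ⊤ ∧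
    ∀ (κ : Type) [Fintype κ] (e : κ → ℤ), Function.Injective e → ∀ f : L2R,
      MemLp f (ENNReal.ofReal p) →
      eLpNorm (∑ k, mulT (bandSym (e k)) f : L2R) (ENNReal.ofReal p) volume ≤
        C * eLpNorm f (ENNReal.ofReal p) volume := by
  obtain ⟨C, hC, H⟩ := exists_colBd_bandSym hpq
  obtain ⟨D, hD, K⟩ := exists_colBd_bandSym hpq.symm
  refine ⟨C * D, ENNReal.mul_ne_top hC hD, fun κ _ e he f hf => ?_⟩
  rw [← eLpNorm_vecFun_unit]
  refine eLpNorm_vecLp_le_of_dual (κ := Unit)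
    (f := fun _ => ∑ k, mulT (bandSym (e k)) f) hpq fun g hg => ?_
  have hg' : MemLp (g ()) (ENNReal.ofReal q) := by
    refine ⟨Lp.aestronglyMeasurable _, ?_⟩
    rw [← eLpNorm_vecFun_unit]
    exact hg.2
  have e1 : ∑ i : Unit, inner ℂ (g i) (∑ k, mulT (bandSym (e k)) f) =
      ∑ k, inner ℂ (mulT (bandSym (e k)) (g ())) (mulT (bandSym (e k)) f) := by
    simp only [Finset.univ_unique, Finset.sum_singleton, inner_sum]
    refine Finset.sum_congr rfl fun k _ => ?_
    rw [inner_mulT_left (bddSym_bandSym _), mulT_bandSym_self]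
  rw [e1]
  refine (enorm_sum_inner_le hpq _ _).trans
    ((mul_le_mul' (H κ e he f hf) (K κ e he (g ()) hg')).trans_eq ?_)
  have e2 : eLpNorm (vecLp g) (ENNReal.ofReal q) volume =
      eLpNorm (g ()) (ENNReal.ofReal q) volume :=
    eLpNorm_vecFun_unit (g ()) _
  rw [e2]
  ring

end Reconstruction

section Assembly

theorem sum_range_add_two_eq (k : ℕ) (G : ℤ → L2R) :
    ∑ i ∈ Finset.range (k + 2), G ((k : ℤ) + i) =
      ∑ i ∈ Finset.range (k - 1), G ((k : ℤ) + i) + (if 1 ≤ k then G (2 * (k : ℤ) - 1) else 0) +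
        G (2 * (k : ℤ)) + G (2 * (k : ℤ) + 1) := by
  rw [Finset.sum_range_succ, Finset.sum_range_succ]
  have h : ∑ i ∈ Finset.range k, G ((k : ℤ) + i) =
      ∑ i ∈ Finset.range (k - 1), G ((k : ℤ) + i) + (if 1 ≤ k then G (2 * (k : ℤ) - 1) else 0) := by
    cases k with
    | zero => simp
    | succ n =>
      rw [Finset.sum_range_succ, Nat.add_sub_cancel, if_pos (by omega)]
      congr 2
      push_cast
      ring
  rw [h]
  congr 2
  · congr 1
    ring
  · push_cast
    ring

theorem sum_sum_range_eq {M : Type*} [AddCommMonoid M] (F : Finset ℕ) (G : ℕ → ℕ → M) :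
    ∑ k ∈ F, ∑ i ∈ Finset.range (k - 1), G k (k + i) =
      ∑ j ∈ Finset.Icc 1 (2 * F.sup id), ∑ k ∈ F with k ≤ j ∧ j + 2 ≤ 2 * k, G k j := by
  have h : ∀ k ∈ F, ∑ i ∈ Finset.range (k - 1), G k (k + i) =
      ∑ j ∈ Finset.Icc 1 (2 * F.sup id) with k ≤ j ∧ j + 2 ≤ 2 * k, G k j := fun k hk => by
    have hk' : k ≤ F.sup id := Finset.le_sup (f := id) hk
    refine Finset.sum_bij (fun i _ => k + i) (fun i hi => ?_) (fun i _ i' _ h => by omega)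
      (fun j hj => ?_) fun i _ => rfl
    · simp only [Finset.mem_range, Finset.mem_filter, Finset.mem_Icc] at hi ⊢
      omega
    · simp only [Finset.mem_range, Finset.mem_filter, Finset.mem_Icc] at hj ⊢
      exact ⟨j - k, by omega, by omega⟩
  rw [Finset.sum_congr rfl h]
  simp only [Finset.sum_filter]
  exact Finset.sum_comm

theorem sum_filter_bandSym_eq (F : Finset ℕ) {j : ℕ} (hj : 1 ≤ j) (f : L2R) :
    ∑ k ∈ F with k ≤ j ∧ j + 2 ≤ 2 * k, mulT (bandSym (2 * (k : ℤ))) f =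
      mulT (lowSym ((j : ℤ) + 2)) (∑ k ∈ F, mulT (bandSym (2 * (k : ℤ))) f) -
        mulT (lowSym (2 * (j : ℤ) + 1)) (∑ k ∈ F, mulT (bandSym (2 * (k : ℤ))) f) := by
  rw [mulT_sum (bddSym_lowSym _), mulT_sum (bddSym_lowSym _), ← Finset.sum_sub_distrib,
    Finset.sum_filter]
  refine Finset.sum_congr rfl fun k _ => ?_
  rw [mulT_lowSym_bandSym, mulT_lowSym_bandSym]
  by_cases h1 : j + 2 ≤ 2 * k
  · by_cases h2 : k ≤ j
    · rw [if_pos ⟨h2, h1⟩, if_pos (by omega), if_neg (by omega), sub_zero]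
    · rw [if_neg fun h => h2 h.1, if_pos (by omega), if_pos (by omega), sub_self]
  · rw [if_neg fun h => h1 h.2, if_neg (by omega), if_neg (by omega), sub_self]

theorem sum_tri_bandSym_lowSym_eq (F : Finset ℕ) (h f g : L2R) :
    ∑ k ∈ F, tri h (mulT (bandSym (2 * (k : ℤ))) f) (mulT (lowSym k) g) =
      ∑ k ∈ F, tri h (mulT (bandSym (2 * (k : ℤ))) f) (mulT (lowSym (2 * (k : ℤ) + 2)) g) +
      (∑ j ∈ Finset.Icc 1 (2 * F.sup id), tri h (mulT (bandSym (j : ℤ)) g)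
          (mulT (lowSym ((j : ℤ) + 2)) (∑ k ∈ F, mulT (bandSym (2 * (k : ℤ))) f)) -
        ∑ j ∈ Finset.Icc 1 (2 * F.sup id), tri h (mulT (bandSym (j : ℤ)) g)
          (mulT (lowSym (2 * (j : ℤ) + 1)) (∑ k ∈ F, mulT (bandSym (2 * (k : ℤ))) f))) +
      ∑ k ∈ F with 1 ≤ k,
        tri h (mulT (bandSym (2 * (k : ℤ))) f) (mulT (bandSym (2 * (k : ℤ) - 1)) g) +
      ∑ k ∈ F, tri h (mulT (bandSym (2 * (k : ℤ))) f) (mulT (bandSym (2 * (k : ℤ))) g) +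
      ∑ k ∈ F, tri h (mulT (bandSym (2 * (k : ℤ))) f) (mulT (bandSym (2 * (k : ℤ) + 1)) g) := by
  have hP : ∀ k ∈ F, tri h (mulT (bandSym (2 * (k : ℤ))) f) (mulT (lowSym k) g) =
      tri h (mulT (bandSym (2 * (k : ℤ))) f) (mulT (lowSym (2 * (k : ℤ) + 2)) g) +
      ∑ i ∈ Finset.range (k - 1),
        tri h (mulT (bandSym (2 * (k : ℤ))) f) (mulT (bandSym ((k + i : ℕ) : ℤ)) g) +
      (if 1 ≤ k then tri h (mulT (bandSym (2 * (k : ℤ))) f) (mulT (bandSym (2 * (k : ℤ) - 1)) g)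
        else 0) +
      tri h (mulT (bandSym (2 * (k : ℤ))) f) (mulT (bandSym (2 * (k : ℤ))) g) +
      tri h (mulT (bandSym (2 * (k : ℤ))) f) (mulT (bandSym (2 * (k : ℤ) + 1)) g) := fun k _ => by
    have e1 : (k : ℤ) + ((k + 2 : ℕ) : ℤ) = 2 * (k : ℤ) + 2 := by push_cast; ring
    have b1 := essBdd_lowSym (2 * (k : ℤ) + 2) g
    have b2 : EssBdd (∑ i ∈ Finset.range (k - 1), mulT (bandSym ((k : ℤ) + i)) g) :=
      EssBdd.sum fun i _ => essBdd_bandSym _ g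
    have b3 : EssBdd (if 1 ≤ k then mulT (bandSym (2 * (k : ℤ) - 1)) g else 0) := by
      split_ifs
      · exact essBdd_bandSym _ g
      · exact essBdd_zero
    have b4 := essBdd_bandSym (2 * (k : ℤ)) g
    have b5 := essBdd_bandSym (2 * (k : ℤ) + 1) g
    rw [mulT_lowSym_eq_add_sum k (k + 2) g, e1, sum_range_add_two_eq k fun j => mulT (bandSym j) g,
      tri_add_right _ _ b1 (((b2.add b3).add b4).add b5), tri_add_right _ _ ((b2.add b3).add b4) b5,
      tri_add_right _ _ (b2.add b3) b4, tri_add_right _ _ b2 b3,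
      tri_sum_right _ _ _ fun i _ => essBdd_bandSym _ g]
    have e2 : tri h (mulT (bandSym (2 * (k : ℤ))) f)
        (if 1 ≤ k then mulT (bandSym (2 * (k : ℤ) - 1)) g else 0) =
        if 1 ≤ k then tri h (mulT (bandSym (2 * (k : ℤ))) f) (mulT (bandSym (2 * (k : ℤ) - 1)) g)
        else 0 := by
      split_ifs
      · rfl
      · exact tri_zero_right _ _
    rw [e2]
    push_cast
    ring
  rw [Finset.sum_congr rfl hP]
  simp only [Finset.sum_add_distrib]
  rw [sum_sum_range_eq F fun k j => tri h (mulT (bandSym (2 * (k : ℤ))) f) (mulT (bandSym (j : ℤ)) g),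
    ← Finset.sum_filter, ← Finset.sum_sub_distrib]
  congr 4
  refine Finset.sum_congr rfl fun j hj => ?_
  have hb := essBdd_bandSym (j : ℤ) g
  rw [← tri_sum_mid _ _ _ hb, sum_filter_bandSym_eq F (Finset.mem_Icc.1 hj).1, tri_sub_mid _ _ _ hb,
    tri_comm, tri_comm h _ (mulT (bandSym (j : ℤ)) g)]

/-- The dual form of the quadratically scaled paraproduct is bounded. -/
theorem exists_sum_tri_le {r s t : ℝ} (hr : 1 < r) (hs : 1 < s) (ht : 1 < t)
    (hsum : 1 / r + 1 / s + 1 / t = 1) : ∃ C : ENNReal, C ≠ ⊤ ∧ ∀ (F : Finset ℕ) (h f g : L2R),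
      MemLp h (ENNReal.ofReal r) → MemLp f (ENNReal.ofReal s) → MemLp g (ENNReal.ofReal t) →
      ‖∑ k ∈ F, tri h (mulT (bandSym (2 * (k : ℤ))) f) (mulT (lowSym k) g)‖ₑ ≤
        C * (eLpNorm h (ENNReal.ofReal r) volume * eLpNorm f (ENNReal.ofReal s) volume *
          eLpNorm g (ENNReal.ofReal t) volume) := by
  obtain ⟨C₁, hC₁, H₁⟩ := exists_sum_tri_band_low_le hr hs ht hsum
  obtain ⟨C₂, hC₂, H₂⟩ := exists_sum_tri_band_band_le hr hs ht hsum
  obtain ⟨C₃, hC₃, H₃⟩ := exists_sum_tri_band_low_le hr ht hs (by linarith)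
  obtain ⟨C₄, hC₄, H₄⟩ := exists_eLpNorm_sum_bandSym_le (Real.HolderConjugate.conjExponent hs)
  refine ⟨C₁ + 2 * (C₃ * C₄) + 3 * C₂, by finiteness, fun F h f g hh hf hg => ?_⟩
  have i0 : ∀ (s : Finset ℕ) (c d : ℤ), c ≠ 0 →
      Function.Injective fun k : s => c * ((k : ℕ) : ℤ) + d := fun s c d hc k k' h => by
    have := mul_left_cancel₀ hc (add_right_cancel h)
    exact Subtype.ext (by exact_mod_cast this)
  have i1 : ∀ s : Finset ℕ, Function.Injective fun k : s => 2 * ((k : ℕ) : ℤ) := fun s => by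
    simpa using i0 s 2 0 two_ne_zero
  have i2 : ∀ s : Finset ℕ, Function.Injective fun k : s => ((k : ℕ) : ℤ) := fun s => by
    simpa using i0 s 1 0 one_ne_zero
  set N := eLpNorm h (ENNReal.ofReal r) volume * eLpNorm f (ENNReal.ofReal s) volume *
          eLpNorm g (ENNReal.ofReal t) volume with hN
  set f' : L2R := ∑ k ∈ F, mulT (bandSym (2 * (k : ℤ))) f with hf'
  have hf'n : eLpNorm f' (ENNReal.ofReal s) volume ≤ C₄ * eLpNorm f (ENNReal.ofReal s) volume := by
    rw [hf', ← Finset.sum_coe_sort]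
    exact H₄ F _ (i1 F) f hf
  have hf'm : MemLp f' (ENNReal.ofReal s) :=
    ⟨Lp.aestronglyMeasurable _, hf'n.trans_lt (ENNReal.mul_lt_top hC₄.lt_top hf.2)⟩
  have t1 : ‖∑ k ∈ F, tri h (mulT (bandSym (2 * (k : ℤ))) f)
      (mulT (lowSym (2 * (k : ℤ) + 2)) g)‖ₑ ≤ C₁ * N := by
    rw [← Finset.sum_coe_sort]
    exact H₁ F _ _ (i1 F) (i0 F 2 2 two_ne_zero) (fun k => le_rfl) h f g hh hf hg
  have t2 : ∀ (s : Finset ℕ) (d : ℤ), ‖∑ k ∈ s, tri h (mulT (bandSym (2 * (k : ℤ))) f)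
      (mulT (bandSym (2 * (k : ℤ) + d)) g)‖ₑ ≤ C₂ * N := fun s d => by
    rw [← Finset.sum_coe_sort]
    exact H₂ s _ _ (i1 s) (i0 s 2 d two_ne_zero) h f g hf hg
  have t3 : ∀ c d : ℤ, c ≠ 0 → (∀ j : ℕ, 1 ≤ j → (j : ℤ) + 2 ≤ c * (j : ℤ) + d) →
      ‖∑ j ∈ Finset.Icc 1 (2 * F.sup id), tri h (mulT (bandSym (j : ℤ)) g)
        (mulT (lowSym (c * (j : ℤ) + d)) f')‖ₑ ≤ C₃ * C₄ * N := fun c d hc hcd => by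
    rw [← Finset.sum_coe_sort]
    refine (H₃ (Finset.Icc 1 (2 * F.sup id)) _ _ (i2 _) (i0 _ c d hc)
      (fun k => hcd k (Finset.mem_Icc.1 k.2).1) h g f' hh hg hf'm).trans ?_
    refine (mul_le_mul_right (mul_le_mul_right hf'n _) _).trans_eq ?_
    rw [hN]
    ring
  have t4 := t3 1 2 one_ne_zero fun j _ => by omega
  have t5 := t3 2 1 two_ne_zero fun j _ => by omega
  have t6 := t2 (F.filter (1 ≤ ·)) (-1)
  have t7 := t2 F 0
  have t8 := t2 F 1
  simp only [one_mul, add_zero, ← sub_eq_add_neg] at t4 t6 t7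
  rw [sum_tri_bandSym_lowSym_eq]
  refine (enorm_add_le _ _).trans ((add_le_add ((enorm_add_le _ _).trans (add_le_add
    ((enorm_add_le _ _).trans (add_le_add ((enorm_add_le _ _).trans (add_le_add t1
      (enorm_sub_le.trans (add_le_add t4 t5)))) t6)) t7)) t8).trans_eq ?_)
  ring

end Assembly

section SchwartzFunctions

/-- Fourier multipliers of Schwartz functions agree with their `L²` versions. -/
theorem mulT_toLp_schwartz_ae_eq {w : ℝ → ℝ} (hw : BddSym w) (f : SchwartzMap ℝ ℂ) :
    mulT w ((f.memLp 2).toLp f) =ᵐ[volume] 𝓕⁻ fun ξ : ℝ => (w ξ : ℂ) * 𝓕 (f : ℝ → ℂ) ξ := by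
  have hF : 𝓕 (f : ℝ → ℂ) = ((𝓕 f : SchwartzMap ℝ ℂ) : ℝ → ℂ) := (SchwartzMap.fourier_coe f).symm
  have ha : Integrable fun ξ : ℝ => (w ξ : ℂ) * 𝓕 (f : ℝ → ℂ) ξ := by
    rw [hF, ← memLp_one_iff_integrable]
    exact hw.memLp ((𝓕 f : SchwartzMap ℝ ℂ).memLp 1)
  have ha2 : MemLp (fun ξ : ℝ => (w ξ : ℂ) * 𝓕 (f : ℝ → ℂ) ξ) 2 := by
    rw [hF]
    exact hw.memLp ((𝓕 f : SchwartzMap ℝ ℂ).memLp 2)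
  have h : (𝓕⁻ (ha2.toLp _) : L2R) = mulT w ((f.memLp 2).toLp f) := by
    refine eq_mulT_of_fourier hw ?_
    rw [FourierTransform.fourier_fourierInv_eq]
    filter_upwards [ha2.coeFn_toLp, fourier_toLp_ae_eq f.integrable (f.memLp 2)] with ξ h1 h2
    rw [h1, h2]
  rw [← h]
  exact fourierInv_toLp_ae_eq ha ha2

theorem Qop_ae_eq (k : ℤ) (f : SchwartzMap ℝ ℂ) :
    Qop k (f : ℝ → ℂ) =ᵐ[volume] mulT (bandSym k) ((f.memLp 2).toLp f) := by
  refine Filter.EventuallyEq.trans (Filter.EventuallyEq.of_eq ?_)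
    (mulT_toLp_schwartz_ae_eq (bddSym_bandSym k) f).symm
  unfold Qop
  congr 1
  ext ξ
  by_cases h : (2 : ℝ) ^ (-k - 1) ≤ |ξ| ∧ |ξ| ≤ (2 : ℝ) ^ (-k)
  · rw [bandSym_eq_one h, Set.indicator_of_mem
      (s := {ξ : ℝ | (2 : ℝ) ^ (-k - 1) ≤ |ξ| ∧ |ξ| ≤ (2 : ℝ) ^ (-k)}) h, Complex.ofReal_one]
  · rw [bandSym_eq_zero h, Set.indicator_of_notMem
      (s := {ξ : ℝ | (2 : ℝ) ^ (-k - 1) ≤ |ξ| ∧ |ξ| ≤ (2 : ℝ) ^ (-k)}) h, Complex.ofReal_zero]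

theorem Pop_ae_eq (k : ℤ) (f : SchwartzMap ℝ ℂ) :
    Pop k (f : ℝ → ℂ) =ᵐ[volume] mulT (lowSym k) ((f.memLp 2).toLp f) := by
  refine Filter.EventuallyEq.trans (Filter.EventuallyEq.of_eq ?_)
    (mulT_toLp_schwartz_ae_eq (bddSym_lowSym k) f).symm
  unfold Pop
  congr 1
  ext ξ
  by_cases h : |ξ| ≤ (2 : ℝ) ^ (-k)
  · rw [lowSym_eq_one h, Set.indicator_of_mem
      (s := Set.Icc (-(2 : ℝ) ^ (-k)) ((2 : ℝ) ^ (-k))) (abs_le.1 h), Complex.ofReal_one]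
  · rw [lowSym_eq_zero (not_le.1 h), Set.indicator_of_notMem
      (s := Set.Icc (-(2 : ℝ) ^ (-k)) ((2 : ℝ) ^ (-k))) fun h' => h (abs_le.2 h'),
      Complex.ofReal_zero]

theorem memLp_toLp_schwartz (f : SchwartzMap ℝ ℂ) (r : ENNReal) :
    MemLp ((f.memLp 2).toLp f : L2R) r :=
  (f.memLp r).ae_eq (f.memLp 2).coeFn_toLp.symm

theorem eLpNorm_toLp_schwartz (f : SchwartzMap ℝ ℂ) (r : ENNReal) :
    eLpNorm ((f.memLp 2).toLp f : L2R) r volume = eLpNorm f r volume :=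
  eLpNorm_congr_ae (f.memLp 2).coeFn_toLp

theorem exists_eLpNorm_sum_mul_le {p r s t : ℝ} (hpr : p.HolderConjugate r) (hs : 1 < s)
    (ht : 1 < t) (hsum : 1 / r + 1 / s + 1 / t = 1) : ∃ C : ENNReal, C ≠ ⊤ ∧
      ∀ (F : Finset ℕ) (f g : L2R), MemLp f (ENNReal.ofReal s) → MemLp g (ENNReal.ofReal t) →
      eLpNorm (fun x => ∑ k ∈ F, mulT (bandSym (2 * (k : ℤ))) f x * mulT (lowSym k) g x)
        (ENNReal.ofReal p) volume ≤
        C * eLpNorm f (ENNReal.ofReal s) volume * eLpNorm g (ENNReal.ofReal t) volume := by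
  obtain ⟨C, hC, H⟩ := exists_sum_tri_le hpr.symm.lt hs ht hsum
  refine ⟨C, hC, fun F f g hf hg => ?_⟩
  have hm : MemLp (fun x => ∑ k ∈ F, mulT (bandSym (2 * (k : ℤ))) f x * mulT (lowSym k) g x) 2 :=
    memLp_finsetSum F fun k _ => memLp_mul_of_essBdd _ (essBdd_lowSym k g)
  rw [← eLpNorm_congr_ae hm.coeFn_toLp, ← eLpNorm_vecFun_unit]
  refine eLpNorm_vecLp_le_of_dual (κ := Unit) (f := fun _ => hm.toLp _) hpr fun h hh => ?_
  have e2 : eLpNorm (vecLp h) (ENNReal.ofReal r) volume =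
      eLpNorm (h ()) (ENNReal.ofReal r) volume :=
    eLpNorm_vecFun_unit (h ()) _
  have hh' : MemLp (h ()) (ENNReal.ofReal r) := ⟨Lp.aestronglyMeasurable _, e2 ▸ hh.2⟩
  have e1 : ∑ i : Unit, inner ℂ (h i) (hm.toLp _) =
      ∑ k ∈ F, tri (h ()) (mulT (bandSym (2 * (k : ℤ))) f) (mulT (lowSym k) g) := by
    simp only [Finset.univ_unique, Finset.sum_singleton, tri]
    rw [← integral_finsetSum F (f := fun k x => (starRingEnd ℂ) (h () x) *
      (mulT (bandSym (2 * (k : ℤ))) f x * mulT (lowSym k) g x))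
      fun k _ => integrable_tri _ _ (essBdd_lowSym k g), L2.inner_def]
    refine integral_congr_ae ?_
    filter_upwards [hm.coeFn_toLp] with x hx
    rw [hx, RCLike.inner_apply, Finset.sum_mul]
    refine Finset.sum_congr rfl fun k _ => ?_
    rw [mul_comm]
  rw [e1, e2]
  refine (H F (h ()) f g hh' hf hg).trans_eq ?_
  ring

end SchwartzFunctions

/-- Theorem (quadratically scaled paraproduct bound):
`‖Σ_{k∈F} Q_{2k}(f) P_k(g)‖_{p₃'} ≲ ‖f‖_{p₁} ‖g‖_{p₂}` for Hölder exponents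
`1 < p₁, p₂, p₃ < ∞` with `1/p₁ + 1/p₂ + 1/p₃ = 1`. -/
theorem quadratic_paraproduct_bound
    (p₁ p₂ p₃ : ℝ) (hp₁ : 1 < p₁) (hp₂ : 1 < p₂) (hp₃ : 1 < p₃)
    (hsum : 1 / p₁ + 1 / p₂ + 1 / p₃ = 1) :
    ∃ C : ℝ, 0 < C ∧ ∀ (F : Finset ℕ) (f g : SchwartzMap ℝ ℂ),
      eLpNorm (fun x : ℝ => ∑ k ∈ F, Qop (2 * (k : ℤ)) (f : ℝ → ℂ) x * Pop (k : ℤ) (g : ℝ → ℂ) x)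
        (ENNReal.ofReal (p₃ / (p₃ - 1))) volume
      ≤ ENNReal.ofReal C * eLpNorm (f : ℝ → ℂ) (ENNReal.ofReal p₁) volume *
          eLpNorm (g : ℝ → ℂ) (ENNReal.ofReal p₂) volume := by
  have hc : (p₃ / (p₃ - 1)).HolderConjugate p₃ := (Real.HolderConjugate.conjExponent hp₃).symm
  obtain ⟨C, hC, H⟩ := exists_eLpNorm_sum_mul_le hc hp₁ hp₂ (by linarith)
  refine ⟨C.toReal + 1, by positivity, fun F f g => ?_⟩
  have h := H F ((f.memLp 2).toLp f) ((g.memLp 2).toLp g) (memLp_toLp_schwartz f _)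
    (memLp_toLp_schwartz g _)
  rw [eLpNorm_toLp_schwartz, eLpNorm_toLp_schwartz] at h
  have e : (fun x : ℝ => ∑ k ∈ F, Qop (2 * (k : ℤ)) (f : ℝ → ℂ) x * Pop (k : ℤ) (g : ℝ → ℂ) x)
      =ᵐ[volume] fun x => ∑ k ∈ F, mulT (bandSym (2 * (k : ℤ))) ((f.memLp 2).toLp f) x *
        mulT (lowSym k) ((g.memLp 2).toLp g) x := by
    filter_upwards [ae_all_iff.2 fun k : ℕ => Qop_ae_eq (2 * (k : ℤ)) f,
      ae_all_iff.2 fun k : ℕ => Pop_ae_eq (k : ℤ) g] with x h1 h2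
    exact Finset.sum_congr rfl fun k _ => by rw [h1, h2]
  rw [eLpNorm_congr_ae e]
  refine h.trans (mul_le_mul_left (mul_le_mul_left ?_ _) _)
  rw [ENNReal.ofReal_add ENNReal.toReal_nonneg zero_le_one, ENNReal.ofReal_toReal hC]
  exact le_self_add
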